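/- If Γ is a graph of girth at least 5 on 27 vertices with 65 edges, then (δ(Γ), Δ(Γ)) = (4,5) and Γ has an embedded S_{5,[4,4,4,4,4]} star; that is, Γ has a vertex of degree 5 all five of whose neighbours have degree at least 5. -/

import Mathlib

open SimpleGraph

/-- `Γ` has girth at least 5: every cycle has length at least 5. -/
def GirthAtLeast5 {V : Type*} (G : SimpleGraph V) : Prop :=
  ∀ ⦃u : V⦄ (w : G.Walk u u), w.IsCycle → 5 ≤ w.length

/-- `G` has an embedded `S_{D,[e 0, …, e (D-1)]}` star: a vertex `x` of degree `D`
whose `D` neighbours can be enumerated as `y 0, …, y (D-1)` with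
`deg (y i) ≥ e i + 1` for each `i`. -/
def HasEmbeddedStar {V : Type*} [Fintype V] (G : SimpleGraph V) [DecidableRel G.Adj]
    (D : ℕ) (e : Fin D → ℕ) : Prop :=
  ∃ (x : V) (y : Fin D → V), G.degree x = D ∧ Function.Injective y ∧
    (∀ i, G.Adj x (y i)) ∧ ∀ i, e i + 1 ≤ G.degree (y i)

set_option linter.unusedSectionVars false
namespace Sv

structure Inst where
  cs : List (List Nat × Nat × Nat)
  ord : List (Nat × Nat)
  balls : List Nat
  dom : Nat

def frc {α : Type} (x : Nat) (k : Nat → α) : α := Nat.rec (k 0) (fun n _ => k (Nat.succ n)) x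
def onS {α : Type} (s : Nat × Nat) (k : Nat → Nat → α) : α := Prod.rec k s
def mkS (N E : Nat) : Nat × Nat := frc N fun N => frc E fun E => (N, E)
def ite' {α : Type} (b : Bool) (x y : α) : α := Bool.rec y x b
def fold {α β : Type} (l : List α) (f : α → β → β) (b : β) : β :=
  List.rec (motive := fun _ => β → β) (fun b => b) (fun a _ ih b => ih (f a b)) l b

def bits (n x : Nat) : List Nat :=
  Nat.rec (motive := fun _ => Nat → List Nat) (fun _ => [])
    (fun _ ih x => frc x fun x => ite' (Nat.beq x 0) [] (frc (Nat.log2 x) fun i => i :: ih (Nat.xor x (Nat.shiftLeft 1 i)))) n x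
/-- number of set bits -/
def cnt (n x : Nat) : Nat :=
  Nat.rec (motive := fun _ => Nat → Nat → Nat) (fun _ a => a)
    (fun _ ih x a => frc x fun x => ite' (Nat.beq x 0) a (ih (Nat.xor x (Nat.shiftLeft 1 (Nat.log2 x))) (Nat.succ a))) n x 0

def row (n M v : Nat) : Nat := Nat.mod (Nat.shiftRight M (Nat.mul n v)) (Nat.pow 2 n)
def orRow (n M v m : Nat) : Nat := Nat.lor M (Nat.shiftLeft (Nat.mod m (Nat.pow 2 n)) (Nat.mul n v))
def diff (x y : Nat) : Nat := frc x fun x => Nat.xor x (Nat.land x y)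
def clr (x i : Nat) : Nat := diff x (Nat.shiftLeft 1 i)

def half2 (n b : Nat) (l : List Nat) (E : Nat) : Nat :=
  fold l (fun r E => orRow n E r (Nat.shiftLeft 1 b)) E
def half (n N a b nb : Nat) (l : List Nat) (E : Nat) : Nat :=
  fold l (fun t E => frc (clr (row n N t) a) fun q =>
      half2 n b (bits n q) (orRow n (orRow n E t (Nat.lor nb (Nat.shiftLeft 1 b))) b q)) E

def addE (n a b : Nat) (s : Nat × Nat) : Nat × Nat :=
  onS s fun N E =>
  frc (clr (row n N a) b) fun na =>
  frc (clr (row n N b) a) fun nb =>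
  mkS (orRow n (orRow n N a (Nat.shiftLeft 1 b)) b (Nat.shiftLeft 1 a))
   (half n N a b nb (bits n na) (half n N b a na (bits n nb) (orRow n (orRow n E a nb) b na)))

def exc (n v m : Nat) (s : Nat × Nat) : Nat × Nat :=
  onS s fun N E => frc m fun m => mkS N (half2 n v (bits n m) (orRow n E v m))

def card1 (n v m k : Nat) (s : Nat × Nat) : Nat × Nat :=
  onS s fun N E =>
  frc (Nat.land (row n N v) m) fun nn =>
  frc (diff m (row n E v)) fun pp =>
  frc (cnt n nn) fun a =>
  ite' (Nat.beq nn pp) (ite' (Nat.beq a k) (N,E) (1,1)) <|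
  frc (cnt n pp) fun b =>
  ite' (Nat.ble (Nat.succ k) a) (1,1) <|
  ite' (Nat.ble (Nat.succ b) k) (1,1) <|
  ite' (Nat.beq a k) (exc n v (diff pp nn) (N,E)) <|
  ite' (Nat.beq b k) (fold (bits n (diff pp nn)) (fun t s => addE n v t s) (N,E)) (N,E)

def ball1 (n rx w : Nat) (s : Nat × Nat) : Nat × Nat :=
  onS s fun N E =>
  ite' (Nat.beq (Nat.land rx (row n N w)) 0)
    (frc (diff rx (row n E w)) fun c =>
    ite' (Nat.beq c 0) (1,1) <|
    frc (Nat.log2 c) fun i => ite' (Nat.beq c (Nat.shiftLeft 1 i)) (addE n w i (N,E)) (N,E))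
    (N,E)

def ballX (n dom x : Nat) (s : Nat × Nat) : Nat × Nat :=
  onS s fun N E =>
  frc (row n N x) fun rx =>
  ite' (Nat.beq (Nat.lor rx (row n E x)) (Nat.pred (Nat.pow 2 n)))
    (fold (bits n (clr (diff dom rx) x)) (fun w s => ball1 n rx w s) (N,E)) (N,E)

def pass (n : Nat) (I : Inst) (s : Nat × Nat) : Nat × Nat :=
  fold I.balls (fun x s => ballX n I.dom x s)
    (fold I.cs (fun c s => fold c.1 (fun v s => card1 n v c.2.1 c.2.2 s) s) s)

def pick (n N E : Nat) (l : List (Nat × Nat)) : Nat × Nat :=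
  List.rec (motive := fun _ => Nat × Nat) (0,0) (fun c _ ih =>
    frc (diff (diff c.2 (row n N c.1)) (row n E c.1)) fun fr =>
    ite' (Nat.beq fr 0) ih (c.1, fr)) l

def tb (m i : Nat) : Bool := Nat.beq (Nat.land (Nat.shiftRight m i) 1) 1
def elm (i : Nat) (l : List Nat) : Bool :=
  List.rec (motive := fun _ => Bool) false (fun a _ ih => ite' (Nat.beq a i) true ih) l
def beqB (a b : Bool) : Bool := ite' a b (ite' b false true)
def an (a b : Bool) : Bool := ite' a b false
def csOK (w x : Nat) (l : List (List Nat × Nat × Nat)) : Bool :=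
  List.rec (motive := fun _ => Bool) true (fun c _ ih =>
   an (beqB (elm w c.1) (elm x c.1)) (an (beqB (tb c.2.1 w) (tb c.2.1 x)) ih)) l
def twinM (n M w x : Nat) : Bool :=
  frc (Nat.lor (Nat.shiftLeft 1 w) (Nat.shiftLeft 1 x)) fun wx =>
  Nat.beq (diff (row n M w) wx) (diff (row n M x) wx)
def colOK (n M w x : Nat) : Bool :=
  Nat.rec (motive := fun _ => Bool) true (fun r ih =>
    an (ite' (Nat.beq r w) true (ite' (Nat.beq r x) true (beqB (tb M (n*r+w)) (tb M (n*r+x))))) ih) n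
def twin (n : Nat) (I : Inst) (N E : Nat) (w x : Nat) : Bool :=
  an (twinM n N w x) <| an (twinM n E w x) <| an (csOK w x I.cs) <| an (beqB (tb I.dom w) (tb I.dom x)) <|
  an (beqB (elm w I.balls) false) <| an (beqB (elm x I.balls) false) <|
  an (colOK n N w x) (colOK n E w x)

def twins (n : Nat) (I : Inst) (N E : Nat) (v w : Nat) (l : List Nat) : Nat :=
  fold l (fun x m => ite' (twin n I N E w x) (ite' (Nat.beq x v) m (Nat.lor (Nat.shiftLeft 1 x) m)) m) (Nat.shiftLeft 1 w)

def solve (n : Nat) (I : Inst) (f : Nat) (s : Nat × Nat) : Bool :=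
  Nat.rec (motive := fun _ => Nat × Nat → Bool) (fun _ => false) (fun _ ih s =>
    onS s fun N E => onS (pass n I (N,E)) fun N' E' =>
    ite' (Nat.beq (Nat.land N' E') 0) 
     (ite' (an (Nat.beq N N') (Nat.beq E E'))
       (onS (pick n N E I.ord) fun v fr =>
         ite' (Nat.beq fr 0) false <|
         frc (Nat.log2 fr) fun w => 
         ite' (Nat.beq v w) false <|
         an (ih (addE n v w (N,E))) (ih (exc n v (twins n I N E v w (bits n fr)) (N,E))))
      (ih (N',E')))
     true) f s

def i1 : Inst where
  cs := [([0,1,2,3,4,5], 63, 0), ([0,1,2,3,4,5], 65472, 3), ([6,7], 63, 1), ([6,7], 65472, 3),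
    ([8,9,10,11,12,13,14,15], 63, 2), ([8,9,10,11,12,13,14,15], 65472, 2)]
  ord := [(6,63),(6,65472),(7,63),(7,65472),(8,63),(8,65472),(9,63),(9,65472),(10,63),(10,65472),(11,63),(11,65472),
    (12,63),(12,65472),(13,63),(13,65472),(14,63),(14,65472),(15,63),(15,65472)]
  balls := []
  dom := 0
def i2 : Inst where
  cs := [([21,20,19,18], 3932160, 0), ([21,20,19,18], 262142, 5), ([17,16,15,14,13,12,11,10,9,8,7,6,5,4,3,2,1], 4194302, 4), ([0], 3932160, 0), ([0], 262142, 3)]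
  ord := [(21,4194303),(20,4194303),(19,4194303),(18,4194303),(17,4194303),(16,4194303),(15,4194303),(14,4194303),(13,4194303),(12,4194303),(11,4194303),(10,4194303),(9,4194303),(8,4194303),(7,4194303),(6,4194303),(5,4194303),(4,4194303),(3,4194303),(2,4194303),(1,4194303),(0,4194303)]
  balls := [21,20,19,18]
  dom := 4194302
def diagM (n : Nat) : Nat → Nat
  | 0 => 0
  | k+1 => Nat.lor (diagM n k) (Nat.shiftLeft 1 (n*k+k))
end Sv

namespace Sv

theorem frc_eq {α : Type} (x : Nat) (k : Nat → α) : frc x k = k x := by cases x <;> rfl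
theorem onS_eq {α : Type} (N E : Nat) (k : Nat → Nat → α) : onS (N,E) k = k N E := rfl
theorem mkS_eq (N E : Nat) : mkS N E = (N,E) := by simp [mkS, frc_eq]
theorem ite'_eq {α : Type} (b : Bool) (x y : α) : ite' b x y = if b = true then x else y := by
  cases b <;> rfl
theorem an_eq (a b : Bool) : an a b = (a && b) := by cases a <;> rfl
theorem fold_inv {α β : Type} (P : β → Prop) (f : α → β → β) (l : List α) :
    ∀ b, (∀ a ∈ l, ∀ s, P s → P (f a s)) → P b → P (fold l f b) := by
  induction l with
  | nil => intro b _ h; exact h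
  | cons a l ih =>
    intro b h hb
    exact ih (f a b) (fun c hc => h c (List.mem_cons_of_mem _ hc)) (h a List.mem_cons_self b hb)

theorem tb_shl1 (i j : Nat) : (Nat.shiftLeft 1 i).testBit j = decide (i = j) := by
  have : Nat.shiftLeft 1 i = 2^i := by
    show 1 <<< i = 2^i
    rw [Nat.shiftLeft_eq]; simp
  rw [this, Nat.testBit_two_pow]
theorem tb_row (n M v b : Nat) : (row n M v).testBit b = (decide (b < n) && M.testBit (n*v+b)) := by
  have : row n M v = (M >>> (n*v)) % 2^n := rfl
  rw [this, Nat.testBit_mod_two_pow, Nat.testBit_shiftRight]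
theorem tb_orRow (n M v m a b : Nat) (hb : b < n) :
    (orRow n M v m).testBit (n*a+b) = (M.testBit (n*a+b) || (decide (a = v) && m.testBit b)) := by
  have : orRow n M v m = M ||| ((m % 2^n) <<< (n*v)) := rfl
  rw [this, Nat.testBit_or, Nat.testBit_shiftLeft, Nat.testBit_mod_two_pow]
  congr 1
  by_cases h : a = v
  · subst h; simp [hb]
  · rcases Nat.lt_or_gt_of_ne h with h | h
    · have : n * (a+1) ≤ n * v := Nat.mul_le_mul_left n h
      rw [Nat.mul_add] at this
      have h2 : ¬ (n*v ≤ n*a+b) := by omega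
      simp [h2, Nat.ne_of_lt h]
    · have : n * (v+1) ≤ n * a := Nat.mul_le_mul_left n h
      rw [Nat.mul_add] at this
      have h2 : ¬ (n*a+b-n*v < n) := by omega
      simp [h2, Nat.ne_of_gt h]
theorem tb_diff (x y b : Nat) : (diff x y).testBit b = (x.testBit b && !y.testBit b) := by
  have : diff x y = x ^^^ (x &&& y) := by unfold diff; rw [frc_eq]; rfl
  rw [this, Nat.testBit_xor, Nat.testBit_and]
  cases x.testBit b <;> cases y.testBit b <;> rfl
theorem tb_clr (x i b : Nat) : (clr x i).testBit b = (x.testBit b && !decide (i = b)) := by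
  unfold clr; rw [tb_diff, tb_shl1]
theorem tb_lor (x y b : Nat) : (Nat.lor x y).testBit b = (x.testBit b || y.testBit b) :=
  Nat.testBit_or x y b
theorem tb_land (x y b : Nat) : (Nat.land x y).testBit b = (x.testBit b && y.testBit b) :=
  Nat.testBit_and x y b
theorem tb_xor (x y b : Nat) : (Nat.xor x y).testBit b = (x.testBit b ^^ y.testBit b) :=
  Nat.testBit_xor x y b
theorem tb_log2 (x : Nat) (h : x ≠ 0) : x.testBit (Nat.log2 x) = true := Nat.testBit_log2 h
theorem beq_iff (a b : Nat) : Nat.beq a b = true ↔ a = b := 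
  ⟨Nat.eq_of_beq_eq_true, fun h => h ▸ Nat.beq_refl a⟩

theorem bits_zero (x : Nat) : bits 0 x = [] := rfl
theorem bits_succ (n x : Nat) : bits (n+1) x = if x = 0 then [] else
    Nat.log2 x :: bits n (Nat.xor x (Nat.shiftLeft 1 (Nat.log2 x))) := by
  have e : bits (n+1) x = frc x fun x => ite' (Nat.beq x 0) [] (frc (Nat.log2 x) fun i => i :: bits n (Nat.xor x (Nat.shiftLeft 1 i))) := rfl
  rw [e, frc_eq, ite'_eq]; simp only [beq_iff, frc_eq]
theorem mem_bits (n : Nat) : ∀ x i, i ∈ bits n x → x.testBit i = true := by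
  induction n with
  | zero => intro x i h; rw [bits_zero] at h; simp at h
  | succ n ih =>
    intro x i h
    rw [bits_succ] at h
    split_ifs at h with h0
    · simp at h
    · rcases List.mem_cons.1 h with h | h
      · rw [h]; exact tb_log2 x h0
      · have := ih _ _ h
        rw [tb_xor, tb_shl1] at this
        by_cases e : x.log2 = i
        · rw [← e]; exact tb_log2 x h0
        · simpa [e] using this

/-- the set of bits below n -/
def bs (n x : Nat) : Finset Nat := (Finset.range n).filter (fun i => x.testBit i = true)
def cntA (f x a : Nat) : Nat :=
  Nat.rec (motive := fun _ => Nat → Nat → Nat) (fun _ a => a)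
    (fun _ ih x a => frc x fun x => ite' (Nat.beq x 0) a (ih (Nat.xor x (Nat.shiftLeft 1 (Nat.log2 x))) (Nat.succ a))) f x a
theorem cntA_succ (f x a : Nat) : cntA (f+1) x a = if x = 0 then a else
    cntA f (Nat.xor x (Nat.shiftLeft 1 (Nat.log2 x))) (a+1) := by
  have e : cntA (f+1) x a = frc x fun x => ite' (Nat.beq x 0) a (cntA f (Nat.xor x (Nat.shiftLeft 1 (Nat.log2 x))) (Nat.succ a)) := rfl
  rw [e, frc_eq, ite'_eq]; simp only [beq_iff]
theorem cntA_eq (n : Nat) : ∀ f x a, x < 2^n → (bs n x).card ≤ f → cntA f x a = a + (bs n x).card := by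
  intro f
  induction f with
  | zero => intro x a _ h; show a = _; omega
  | succ f ih =>
    intro x a hx h
    rw [cntA_succ]
    split_ifs with h0
    · subst h0; simp [bs]
    · have hl : x.log2 < n := (Nat.log2_lt h0).2 hx
      have hb : bs n (Nat.xor x (Nat.shiftLeft 1 (Nat.log2 x))) = (bs n x).erase x.log2 := by
        ext i
        simp only [bs, Finset.mem_filter, Finset.mem_range, Finset.mem_erase, tb_xor, tb_shl1]
        by_cases e : x.log2 = i
        · subst e; simp [tb_log2 x h0]
        · simp [e, Ne.symm e]
      have hm : x.log2 ∈ bs n x := by simp [bs, hl, tb_log2 x h0]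
      have hc := Finset.card_erase_add_one hm
      have hlt : Nat.xor x (Nat.shiftLeft 1 (Nat.log2 x)) < 2^n := by
        apply Nat.xor_lt_two_pow hx
        show 1 <<< _ < _
        rw [Nat.shiftLeft_eq, one_mul]; exact Nat.pow_lt_pow_right (by omega) hl
      rw [ih _ _ hlt (by rw [hb]; omega), hb]; omega
theorem cnt_eq (n x : Nat) (h : x < 2^n) : cnt n x = (bs n x).card := by
  have h1 : (bs n x).card ≤ n := by
    unfold bs; simpa only [Finset.card_range] using Finset.card_filter_le (Finset.range n) (fun i => x.testBit i = true)
  have := cntA_eq n n x 0 h h1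
  rw [Nat.zero_add] at this; exact this

structure GoodA (n : Nat) (A : Nat → Nat → Prop) : Prop where
  sym : ∀ a b, A a b → A b a
  irr : ∀ a, ¬ A a a
  no3 : ∀ a b c, A a b → A b c → A c a → False
  no4 : ∀ a b c d, A a b → A b c → A c d → A d a → a ≠ c → b ≠ d → False
  lt : ∀ a b, A a b → a < n ∧ b < n

def IN (n : Nat) (A : Nat → Nat → Prop) (N : Nat) : Prop :=
  ∀ a b, b < n → N.testBit (n*a+b) = true → A a b
def IE (n : Nat) (A : Nat → Nat → Prop) (E : Nat) : Prop :=
  ∀ a b, b < n → E.testBit (n*a+b) = true → ¬ A a b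
def Inv (n : Nat) (A : Nat → Nat → Prop) (s : Nat × Nat) : Prop := IN n A s.1 ∧ IE n A s.2

section
variable {n : Nat} {A : Nat → Nat → Prop} (hA : GoodA n A)

theorem IN_orRow {N v m : Nat} (h : IN n A N) (hm : ∀ b, b < n → m.testBit b = true → A v b) :
    IN n A (orRow n N v m) := by
  intro a b hb ht
  rw [tb_orRow _ _ _ _ _ _ hb] at ht
  simp only [Bool.or_eq_true, Bool.and_eq_true, decide_eq_true_eq] at ht
  rcases ht with ht | ⟨rfl, ht⟩
  · exact h a b hb ht
  · exact hm b hb ht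
theorem IE_orRow {N v m : Nat} (h : IE n A N) (hm : ∀ b, b < n → m.testBit b = true → ¬ A v b) :
    IE n A (orRow n N v m) := by
  intro a b hb ht
  rw [tb_orRow _ _ _ _ _ _ hb] at ht
  simp only [Bool.or_eq_true, Bool.and_eq_true, decide_eq_true_eq] at ht
  rcases ht with ht | ⟨rfl, ht⟩
  · exact h a b hb ht
  · exact hm b hb ht
theorem IE_half2 {b : Nat} {l : List Nat} {E : Nat} (h : IE n A E) (hl : ∀ r ∈ l, ¬ A r b) :
    IE n A (half2 n b l E) := by
  unfold half2
  refine fold_inv (IE n A) _ l E ?_ h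
  intro r hr E hE
  refine IE_orRow hE ?_
  intro c _ hc
  rw [tb_shl1] at hc
  have := of_decide_eq_true hc
  subst this; exact hl r hr
include hA
theorem row_A {N v b : Nat} (h : IN n A N) (hb : (row n N v).testBit b = true) : A v b := by
  rw [tb_row] at hb
  simp only [Bool.and_eq_true, decide_eq_true_eq] at hb
  exact h v b hb.1 hb.2
theorem row_nA {N v b : Nat} (h : IE n A N) (hb : (row n N v).testBit b = true) : ¬ A v b := by
  rw [tb_row] at hb
  simp only [Bool.and_eq_true, decide_eq_true_eq] at hb
  exact h v b hb.1 hb.2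

theorem IE_half {N a b nb : Nat} {l : List Nat} {E : Nat} (hN : IN n A N) (h : IE n A E) (hab : A a b)
    (hnb : ∀ s, nb.testBit s = true → A b s ∧ s ≠ a) (hl : ∀ t ∈ l, A a t ∧ t ≠ b) :
    IE n A (half n N a b nb l E) := by
  unfold half
  refine fold_inv (IE n A) _ l E ?_ h
  intro t ht E hE
  rw [frc_eq]
  obtain ⟨hat, htb⟩ := hl t ht
  have hq : ∀ r, (clr (row n N t) a).testBit r = true → A t r ∧ a ≠ r := by
    intro r hr
    rw [tb_clr] at hr
    simp only [Bool.and_eq_true, Bool.not_eq_true', decide_eq_false_iff_not] at hr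
    exact ⟨row_A hA hN hr.1, hr.2⟩
  refine IE_half2 (IE_orRow (IE_orRow hE ?_) ?_) ?_
  · intro c _ hc hct
    rw [tb_lor, tb_shl1] at hc
    simp only [Bool.or_eq_true, decide_eq_true_eq] at hc
    rcases hc with hc | rfl
    · obtain ⟨h1, h2⟩ := hnb c hc
      exact hA.no4 a b c t hab h1 (hA.sym _ _ hct) (hA.sym _ _ hat) (Ne.symm h2) (Ne.symm htb)
    · exact hA.no3 a t b hat hct (hA.sym _ _ hab)
  · intro c _ hc hbc
    obtain ⟨h1, h2⟩ := hq c hc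
    exact hA.no4 a b c t hab hbc (hA.sym _ _ h1) (hA.sym _ _ hat) h2 (Ne.symm htb)
  · intro c hc hbc
    obtain ⟨h1, h2⟩ := hq c (mem_bits _ _ _ hc)
    exact hA.no4 a b c t hab (hA.sym _ _ hbc) (hA.sym _ _ h1) (hA.sym _ _ hat) h2 (Ne.symm htb)

theorem Inv_addE {a b : Nat} {s : Nat × Nat} (h : Inv n A s) (hab : A a b) : Inv n A (addE n a b s) := by
  obtain ⟨N, E⟩ := s
  obtain ⟨hN, hE⟩ := h
  simp only at hN hE
  have hba := hA.sym _ _ hab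
  simp only [addE, onS_eq, frc_eq, mkS_eq]
  have hna : ∀ s, (clr (row n N a) b).testBit s = true → A a s ∧ s ≠ b := by
    intro r hr
    rw [tb_clr] at hr
    simp only [Bool.and_eq_true, Bool.not_eq_true', decide_eq_false_iff_not] at hr
    exact ⟨row_A hA hN hr.1, Ne.symm hr.2⟩
  have hnb : ∀ s, (clr (row n N b) a).testBit s = true → A b s ∧ s ≠ a := by
    intro r hr
    rw [tb_clr] at hr
    simp only [Bool.and_eq_true, Bool.not_eq_true', decide_eq_false_iff_not] at hr
    exact ⟨row_A hA hN hr.1, Ne.symm hr.2⟩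
  refine ⟨?_, ?_⟩
  · refine IN_orRow (IN_orRow hN ?_) ?_
    · intro c _ hc
      rw [tb_shl1] at hc
      rw [← of_decide_eq_true hc]; exact hab
    · intro c _ hc
      rw [tb_shl1] at hc
      rw [← of_decide_eq_true hc]; exact hba
  · refine IE_half hA hN (IE_half hA hN (IE_orRow (IE_orRow hE ?_) ?_) hba hna ?_) hab hnb ?_
    · intro c _ hc hac
      exact hA.no3 a b c hab (hnb c hc).1 (hA.sym _ _ hac)
    · intro c _ hc hac
      exact hA.no3 b a c hba (hna c hc).1 (hA.sym _ _ hac)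
    · intro t ht; exact hnb t (mem_bits _ _ _ ht)
    · intro t ht; exact hna t (mem_bits _ _ _ ht)

theorem Inv_exc {v m : Nat} {s : Nat × Nat} (h : Inv n A s) (hm : ∀ b, m.testBit b = true → ¬ A v b) :
    Inv n A (exc n v m s) := by
  obtain ⟨N, E⟩ := s
  obtain ⟨hN, hE⟩ := h
  simp only at hN hE
  simp only [exc, onS_eq, frc_eq, mkS_eq]
  refine ⟨hN, IE_half2 (IE_orRow hE fun b _ hb => hm b hb) ?_⟩
  intro r hr hrv
  exact hm r (mem_bits _ _ _ hr) (hA.sym _ _ hrv)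

open Classical in
theorem Inv_card1 {v m k : Nat} {s : Nat × Nat} (h : Inv n A s) (hmn : m < 2^n)
    (hk : ((Finset.range n).filter (fun b => m.testBit b = true ∧ A v b)).card = k) :
    Inv n A (card1 n v m k s) := by
  obtain ⟨N, E⟩ := s
  have h' := h
  obtain ⟨hN, hE⟩ := h
  simp only at hN hE
  have hnn : Nat.land (row n N v) m < 2^n := Nat.and_lt_two_pow _ hmn
  have hpp : diff m (row n E v) < 2^n := by
    apply Nat.lt_of_le_of_lt _ hmn
    apply Nat.le_of_testBit
    intro i hi; rw [tb_diff] at hi; simp only [Bool.and_eq_true] at hi; exact hi.1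
  simp only [card1, onS_eq, frc_eq, ite'_eq, beq_iff, cnt_eq _ _ hnn, cnt_eq _ _ hpp, Nat.ble_eq]
  set T := (Finset.range n).filter (fun b => m.testBit b = true ∧ A v b) with hT
  set nn := Nat.land (row n N v) m with hnndef
  set pp := diff m (row n E v) with hppdef
  have h1 : bs n nn ⊆ T := by
    intro b hb
    simp only [bs, Finset.mem_filter, Finset.mem_range, hnndef, tb_land, Bool.and_eq_true] at hb
    simp only [hT, Finset.mem_filter, Finset.mem_range]
    exact ⟨hb.1, hb.2.2, row_A hA hN hb.2.1⟩
  have h2 : T ⊆ bs n pp := by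
    intro b hb
    simp only [hT, Finset.mem_filter, Finset.mem_range] at hb
    simp only [bs, Finset.mem_filter, Finset.mem_range, hppdef, tb_diff, Bool.and_eq_true, Bool.not_eq_true']
    refine ⟨hb.1, hb.2.1, ?_⟩
    by_contra hc
    exact row_nA hA hE (by simpa using hc) hb.2.2
  have c1 := Finset.card_le_card h1
  have c2 := Finset.card_le_card h2
  have hd : ∀ b, (diff pp nn).testBit b = true → pp.testBit b = true ∧ ¬ nn.testBit b = true := by
    intro b hb
    rw [tb_diff] at hb
    simpa using hb
  have hppm : ∀ b, pp.testBit b = true → m.testBit b = true := by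
    intro b hb
    rw [hppdef, tb_diff] at hb
    simp only [Bool.and_eq_true] at hb
    exact hb.1
  split_ifs with q1 q2 q3 q4 q5 q6
  · exact h'
  · rw [← q1] at c2; omega
  · omega
  · omega
  · refine Inv_exc hA h' ?_
    intro b hb hvb
    have hbl := (hA.lt _ _ hvb).2
    obtain ⟨x1, x2⟩ := hd b hb
    have e : bs n nn = T := Finset.eq_of_subset_of_card_le h1 (by omega)
    have : b ∈ T := by
      simp only [hT, Finset.mem_filter, Finset.mem_range]
      exact ⟨hbl, hppm b x1, hvb⟩
    rw [← e] at this
    simp only [bs, Finset.mem_filter] at this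
    exact x2 this.2
  · refine fold_inv (Inv n A) _ _ _ ?_ h'
    intro b hb s hs
    obtain ⟨x1, x2⟩ := hd b (mem_bits _ _ _ hb)
    refine Inv_addE hA hs ?_
    have e : T = bs n pp := Finset.eq_of_subset_of_card_le h2 (by omega)
    have hbl : b < n := by
      by_contra hc
      have := Nat.testBit_lt_two_pow (lt_of_lt_of_le hpp (Nat.pow_le_pow_right (by omega) (not_lt.1 hc)))
      rw [this] at x1; exact absurd x1 (by simp)
    have : b ∈ T := by
      rw [e]; simp only [bs, Finset.mem_filter, Finset.mem_range]; exact ⟨hbl, x1⟩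
    simp only [hT, Finset.mem_filter] at this
    exact this.2.2
  · exact h'

theorem Inv_ball1 {rx w : Nat} {s : Nat × Nat} (h : Inv n A s) (hw : ∃ i, rx.testBit i = true ∧ A w i) :
    Inv n A (ball1 n rx w s) := by
  obtain ⟨N, E⟩ := s
  have h' := h
  obtain ⟨hN, hE⟩ := h
  simp only at hN hE
  simp only [ball1, onS_eq, frc_eq, ite'_eq, beq_iff]
  obtain ⟨i, h1, h2⟩ := hw
  have hc : (diff rx (row n E w)).testBit i = true := by
    rw [tb_diff, h1]
    by_contra hc
    exact row_nA hA hE (by simpa using hc) h2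
  split_ifs with q1 q2 q3
  · rw [q2] at hc; simp at hc
  · refine Inv_addE hA h' ?_
    rw [q3, tb_shl1] at hc
    rw [of_decide_eq_true hc]; exact h2
  · exact h'
  · exact h'

theorem Inv_ballX {dom x : Nat} {s : Nat × Nat} (h : Inv n A s)
    (hx : ∀ w, dom.testBit w = true → w ≠ x → ¬ A x w → ∃ i, A x i ∧ A w i) :
    Inv n A (ballX n dom x s) := by
  obtain ⟨N, E⟩ := s
  have h' := h
  obtain ⟨hN, hE⟩ := h
  simp only at hN hE
  simp only [ballX, onS_eq, frc_eq, ite'_eq, beq_iff]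
  split_ifs with q
  · have hful : ∀ i, A x i → (row n N x).testBit i = true := by
      intro i hi
      have hil := (hA.lt _ _ hi).2
      have : (Nat.lor (row n N x) (row n E x)).testBit i = true := by
        rw [q]
        show (2^n-1).testBit i = true
        rw [Nat.testBit_two_pow_sub_one]; simpa using hil
      rw [tb_lor] at this
      simp only [Bool.or_eq_true] at this
      rcases this with t | t
      · exact t
      · exact absurd hi (row_nA hA hE t)
    refine fold_inv (Inv n A) _ _ _ ?_ h'
    intro w hw s hs
    have := mem_bits _ _ _ hw
    rw [tb_clr, tb_diff] at this
    simp only [Bool.and_eq_true, Bool.not_eq_true', decide_eq_false_iff_not] at this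
    refine Inv_ball1 hA hs ?_
    obtain ⟨i, h1, h2⟩ := hx w this.1.1 (Ne.symm this.2) (by
      intro hc
      have := hful w hc
      simp_all)
    exact ⟨i, hful i h1, h2⟩
  · exact h'
end

open Classical in
structure Sem (n : Nat) (I : Inst) (A : Nat → Nat → Prop) : Prop extends GoodA n A where
  cs : ∀ c ∈ I.cs, ∀ v ∈ c.1,
    ((Finset.range n).filter (fun b => c.2.1.testBit b = true ∧ A v b)).card = c.2.2
  ball : ∀ x ∈ I.balls, ∀ w, I.dom.testBit w = true → w ≠ x → ¬ A x w → ∃ i, A x i ∧ A w i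

theorem Inv_pass {n : Nat} {I : Inst} {A : Nat → Nat → Prop} (hA : Sem n I A) (hI : ∀ c ∈ I.cs, c.2.1 < 2^n)
    {s : Nat × Nat} (h : Inv n A s) : Inv n A (pass n I s) := by
  unfold pass
  refine fold_inv (Inv n A) _ _ _ (fun x hx s hs => Inv_ballX hA.toGoodA hs (hA.ball x hx)) ?_
  refine fold_inv (Inv n A) _ _ _ ?_ h
  intro c hc s hs
  refine fold_inv (Inv n A) _ _ _ ?_ hs
  intro v hv s hs
  exact Inv_card1 hA.toGoodA hs (hI c hc) (hA.cs c hc v hv)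

theorem elm_iff (i : Nat) (l : List Nat) : elm i l = true ↔ i ∈ l := by
  induction l with
  | nil => simp [elm]
  | cons a l ih =>
    have : elm i (a :: l) = ite' (Nat.beq a i) true (elm i l) := rfl
    rw [this, ite'_eq]; simp only [beq_iff]
    split_ifs with h
    · simp [h]
    · rw [ih]; simp [Ne.symm h]
theorem beqB_iff (a b : Bool) : beqB a b = true ↔ a = b := by cases a <;> cases b <;> decide
theorem tb_eq (m i : Nat) : tb m i = m.testBit i := by
  unfold tb
  rw [Bool.eq_iff_iff, beq_iff]
  rw [Nat.testBit_eq_decide_div_mod_eq]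
  show (m >>> i) &&& 1 = 1 ↔ _
  rw [Nat.and_one_is_mod, Nat.shiftRight_eq_div_pow]; simp
theorem csOK_iff (w x : Nat) (l : List (List Nat × Nat × Nat)) (h : csOK w x l = true) :
    ∀ c ∈ l, (w ∈ c.1 ↔ x ∈ c.1) ∧ (c.2.1.testBit w = c.2.1.testBit x) := by
  induction l with
  | nil => simp
  | cons c l ih =>
    have e : csOK w x (c :: l) = an (beqB (elm w c.1) (elm x c.1)) (an (beqB (tb c.2.1 w) (tb c.2.1 x)) (csOK w x l)) := rfl
    rw [e] at h
    simp only [an_eq, Bool.and_eq_true, beqB_iff, tb_eq] at h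
    intro c' hc'
    rcases List.mem_cons.1 hc' with rfl | hc'
    · refine ⟨?_, h.2.1⟩
      rw [← elm_iff, ← elm_iff, h.1]
    · exact ih h.2.2 c' hc'
theorem twinM_iff (n M w x : Nat) (h : twinM n M w x = true) (b : Nat) (hb : b < n) (h1 : b ≠ w) (h2 : b ≠ x) :
    M.testBit (n*w+b) = M.testBit (n*x+b) := by
  unfold twinM at h
  rw [frc_eq, beq_iff] at h
  have := congrArg (fun t => t.testBit b) h
  simp only [tb_diff, tb_row, tb_lor, tb_shl1] at this
  simpa [hb, Ne.symm h1, Ne.symm h2] using this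
def colOKf (n M w x f : Nat) : Bool :=
  Nat.rec (motive := fun _ => Bool) true (fun r ih =>
    an (ite' (Nat.beq r w) true (ite' (Nat.beq r x) true (beqB (tb M (n*r+w)) (tb M (n*r+x))))) ih) f
theorem colOKf_iff (n M w x f : Nat) (h : colOKf n M w x f = true) :
    ∀ r < f, r ≠ w → r ≠ x → M.testBit (n*r+w) = M.testBit (n*r+x) := by
  induction f with
  | zero => intro r hr; omega
  | succ f ih =>
    have e : colOKf n M w x (f+1) = an (ite' (Nat.beq f w) true (ite' (Nat.beq f x) true (beqB (tb M (n*f+w)) (tb M (n*f+x))))) (colOKf n M w x f) := rfl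
    rw [e] at h
    simp only [an_eq, Bool.and_eq_true, ite'_eq, beq_iff, tb_eq] at h
    intro r hr h1 h2
    by_cases hrf : r = f
    · subst hrf
      have := h.1
      simp only [h1, h2, if_false] at this
      exact (beqB_iff _ _).1 this
    · exact ih h.2 r (by omega) h1 h2

theorem swap_swap_apply (w x a : Nat) : Equiv.swap w x (Equiv.swap w x a) = a := by simp

open Classical in
theorem twin_sem {n : Nat} {I : Inst} {A : Nat → Nat → Prop} (hA : Sem n I A) {N E w x : Nat}
    (hw : w < n) (hx : x < n)
    (h : Inv n A (N,E)) (ht : twin n I N E w x = true) :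
    Sem n I (fun a b => A (Equiv.swap w x a) (Equiv.swap w x b)) ∧
    Inv n (fun a b => A (Equiv.swap w x a) (Equiv.swap w x b)) (N,E) := by
  unfold twin at ht
  simp only [an_eq, Bool.and_eq_true, beqB_iff, tb_eq] at ht
  obtain ⟨t1, t2, t3, t4, t5, t6, t7, t8⟩ := ht
  have t7' := colOKf_iff n N w x n t7
  have t8' := colOKf_iff n E w x n t8
  have t1' := twinM_iff n N w x t1
  have t2' := twinM_iff n E w x t2
  have t3' := csOK_iff _ _ _ t3
  have t5' : w ∉ I.balls := by rw [← elm_iff, t5]; simp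
  have t6' : x ∉ I.balls := by rw [← elm_iff, t6]; simp
  set σ := Equiv.swap w x with hσ
  have σσ : ∀ a, σ (σ a) = a := swap_swap_apply w x
  have σlt : ∀ a, σ a < n ↔ a < n := by
    intro a
    by_cases h1 : a = w
    · rw [h1, hσ, Equiv.swap_apply_left]; simp [hw, hx]
    · by_cases h2 : a = x
      · rw [h2, hσ, Equiv.swap_apply_right]; simp [hw, hx]
      · rw [hσ, Equiv.swap_apply_of_ne_of_ne h1 h2]
  have σtb : ∀ m : Nat, m.testBit w = m.testBit x → ∀ a, m.testBit (σ a) = m.testBit a := by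
    intro m hm a
    by_cases h1 : a = w
    · rw [h1, hσ, Equiv.swap_apply_left, hm]
    · by_cases h2 : a = x
      · rw [h2, hσ, Equiv.swap_apply_right, hm]
      · rw [hσ, Equiv.swap_apply_of_ne_of_ne h1 h2]
  refine ⟨⟨⟨?_, ?_, ?_, ?_, ?_⟩, ?_, ?_⟩, ?_⟩
  · intro a b h; exact hA.sym _ _ h
  · intro a h; exact hA.irr _ h
  · intro a b c; exact hA.no3 _ _ _
  · intro a b c d h1 h2 h3 h4 h5 h6
    exact hA.no4 _ _ _ _ h1 h2 h3 h4 (fun e => h5 (σ.injective e)) (fun e => h6 (σ.injective e))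
  · intro a b h
    have := hA.lt _ _ h
    rwa [σlt, σlt] at this
  · intro c hc v hv
    have hσv : σ v ∈ c.1 := by
      have := (t3' c hc).1
      by_cases h1 : v = w
      · rw [h1, hσ, Equiv.swap_apply_left]; rw [h1] at hv; exact this.1 hv
      · by_cases h2 : v = x
        · rw [h2, hσ, Equiv.swap_apply_right]; rw [h2] at hv; exact this.2 hv
        · rw [hσ, Equiv.swap_apply_of_ne_of_ne h1 h2]; exact hv
    rw [← hA.cs c hc (σ v) hσv]
    refine Finset.card_bij (fun b _ => σ b) ?_ ?_ ?_
    · intro b hb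
      simp only [Finset.mem_filter, Finset.mem_range] at hb ⊢
      rw [σlt, σtb _ (t3' c hc).2]; exact hb
    · intro b _ b' _ e; exact σ.injective e
    · intro b hb
      refine ⟨σ b, ?_, σσ b⟩
      simp only [Finset.mem_filter, Finset.mem_range] at hb ⊢
      rw [σlt, σtb _ (t3' c hc).2, σσ]; exact hb
  · intro y hy v hv hvy hna
    have hyw : y ≠ w := fun e => t5' (e ▸ hy)
    have hyx : y ≠ x := fun e => t6' (e ▸ hy)
    have hσy : σ y = y := Equiv.swap_apply_of_ne_of_ne hyw hyx
    obtain ⟨i, h1, h2⟩ := hA.ball y hy (σ v) (by rw [σtb _ t4]; exact hv) (by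
      intro e; apply hvy; rw [← σσ v, e, hσy]) (by rw [hσy] at hna; exact hna)
    exact ⟨σ i, by rw [σσ, hσy]; exact h1, by rw [σσ]; exact h2⟩
  · have gen : ∀ (M : Nat) (Q : Nat → Nat → Prop), (∀ a b, b < n → M.testBit (n*a+b) = true → Q a b) →
        (∀ a b, Q a b → Q b a) → (∀ a b, b < n → n ≤ a → M.testBit (n*a+b) = true → Q (σ a) (σ b)) →
        (∀ a b, M.testBit (n*a+a) = true → a < n → Q b b) →
        (∀ b < n, b ≠ w → b ≠ x → M.testBit (n*w+b) = M.testBit (n*x+b)) →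
        (∀ r < n, r ≠ w → r ≠ x → M.testBit (n*r+w) = M.testBit (n*r+x)) →
        ∀ a b, b < n → M.testBit (n*a+b) = true → Q (σ a) (σ b) := by
      intro M Q g1 g2 g3 g4 g5 g6 a b hb hab
      by_cases han : n ≤ a
      · exact g3 a b hb han hab
      have han : a < n := by omega
      by_cases hd : a = b
      · subst hd; exact g4 a _ hab hb
      by_cases aw : a = w
      · subst aw
        rw [show σ a = x from Equiv.swap_apply_left _ _]
        by_cases bx : b = x
        · subst bx
          rw [show σ b = a from Equiv.swap_apply_right _ _]
          exact g2 _ _ (g1 _ _ hb hab)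
        · rw [show σ b = b from Equiv.swap_apply_of_ne_of_ne (Ne.symm hd) bx]
          rw [g5 b hb (Ne.symm hd) bx] at hab
          exact g1 _ _ hb hab
      by_cases ax : a = x
      · subst ax
        rw [show σ a = w from Equiv.swap_apply_right _ _]
        by_cases bx : b = w
        · subst bx
          rw [show σ b = a from Equiv.swap_apply_left _ _]
          exact g2 _ _ (g1 _ _ hb hab)
        · rw [show σ b = b from Equiv.swap_apply_of_ne_of_ne bx (Ne.symm hd)]
          rw [← g5 b hb bx (Ne.symm hd)] at hab
          exact g1 _ _ hb hab
      rw [show σ a = a from Equiv.swap_apply_of_ne_of_ne aw ax]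
      by_cases bw : b = w
      · subst bw
        rw [show σ b = x from Equiv.swap_apply_left _ _]
        rw [g6 a han aw ax] at hab
        exact g1 _ _ hx hab
      by_cases bx : b = x
      · subst bx
        rw [show σ b = w from Equiv.swap_apply_right _ _]
        rw [← g6 a han aw ax] at hab
        exact g1 _ _ hw hab
      rw [show σ b = b from Equiv.swap_apply_of_ne_of_ne bw bx]
      exact g1 _ _ hb hab
    refine ⟨gen N A h.1 hA.sym ?_ ?_ t1' t7', gen E (fun a b => ¬ A a b) h.2 ?_ ?_ ?_ t2' t8'⟩
    · intro a b hb han hab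
      exact absurd (hA.lt _ _ (h.1 a b hb hab)).1 (by omega)
    · intro a b hab han
      exact absurd (h.1 a a han hab) (hA.irr _)
    · intro a b hn hba; exact hn (hA.sym _ _ hba)
    · intro a b hb han hab hc
      have := (hA.lt _ _ hc).1
      rw [σlt] at this; omega
    · intro a b _ _; exact hA.irr _

theorem twins_spec (n : Nat) (I : Inst) (N E v w : Nat) (l : List Nat) (b : Nat)
    (h : (twins n I N E v w l).testBit b = true) : b = w ∨ (b ≠ v ∧ b ∈ l ∧ twin n I N E w b = true) := by
  unfold twins at h
  revert b
  refine fold_inv (fun m : Nat => ∀ b, m.testBit b = true → b = w ∨ (b ≠ v ∧ b ∈ l ∧ twin n I N E w b = true)) _ l _ ?_ ?_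
  · intro a ha s hs b hb
    simp only [ite'_eq, beq_iff] at hb
    split_ifs at hb with h1 h2
    · exact hs b hb
    · rw [tb_lor, tb_shl1] at hb
      simp only [Bool.or_eq_true, decide_eq_true_eq] at hb
      rcases hb with rfl | hb
      · exact Or.inr ⟨h2, ha, h1⟩
      · exact hs b hb
    · exact hs b hb
  · intro b hb
    rw [tb_shl1] at hb
    exact Or.inl (of_decide_eq_true hb).symm

theorem pick_spec (n N E : Nat) (l : List (Nat × Nat)) (hl : ∀ c ∈ l, c.2 < 2^n) :
    (pick n N E l).2 < 2^n := by
  induction l with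
  | nil => exact Nat.two_pow_pos n
  | cons c l ih =>
    have e : pick n N E (c :: l) = frc (diff (diff c.2 (row n N c.1)) (row n E c.1)) fun fr =>
      ite' (Nat.beq fr 0) (pick n N E l) (c.1, fr) := rfl
    rw [e, frc_eq, ite'_eq]
    split_ifs
    · exact ih fun c hc => hl c (List.mem_cons_of_mem _ hc)
    · refine lt_of_le_of_lt ?_ (hl c List.mem_cons_self)
      apply Nat.le_of_testBit
      intro i hi; simp only [tb_diff, Bool.and_eq_true] at hi; exact hi.1.1

theorem solve_sound (n : Nat) (hn : 0 < n) (I : Inst) (hI : ∀ c ∈ I.cs, c.2.1 < 2^n) (hl : ∀ c ∈ I.ord, c.2 < 2^n) (f : Nat) :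
    ∀ s, solve n I f s = true → ∀ A, Sem n I A → ¬ Inv n A s := by
  induction f with
  | zero => intro s h; exact absurd h (by simp [solve])
  | succ f ih =>
    rintro ⟨N, E⟩ h A hA hs
    have e : solve n I (f+1) (N,E) = onS (pass n I (N,E)) fun N' E' =>
      ite' (Nat.beq (Nat.land N' E') 0) 
       (ite' (an (Nat.beq N N') (Nat.beq E E'))
         (onS (pick n N E I.ord) fun v fr =>
           ite' (Nat.beq fr 0) false <|
           frc (Nat.log2 fr) fun w => 
           ite' (Nat.beq v w) false <|
           an (solve n I f (addE n v w (N,E))) (solve n I f (exc n v (twins n I N E v w (bits n fr)) (N,E))))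
        (solve n I f (N',E')))
       true := rfl
    rw [e] at h
    have hp := Inv_pass hA hI hs
    generalize pass n I (N,E) = p at h hp
    obtain ⟨N', E'⟩ := p
    simp only [onS_eq, ite'_eq, beq_iff, an_eq, Bool.and_eq_true] at h
    have hne : Nat.land N' E' = 0 := by
      apply Nat.eq_of_testBit_eq
      intro i
      rw [tb_land, Nat.zero_testBit]
      by_contra hc
      simp only [Bool.not_eq_false, Bool.and_eq_true] at hc
      have hi : n * (i / n) + i % n = i := Nat.div_add_mod i n
      have hlt : i % n < n := Nat.mod_lt _ (by omega)
      exact hp.2 (i/n) (i%n) hlt (by rw [hi]; exact hc.2) (hp.1 (i/n) (i%n) hlt (by rw [hi]; exact hc.1))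
    rw [if_pos hne] at h
    split_ifs at h with h1
    · have hpk := pick_spec n N E I.ord hl
      generalize pick n N E I.ord = p at h hpk
      obtain ⟨v, fr⟩ := p
      simp only [onS_eq, frc_eq] at h hpk
      split_ifs at h with h2 h3
      simp only [Bool.and_eq_true] at h
      have hbn : ∀ b, fr.testBit b = true → b < n := by
        intro b hb
        by_contra hc
        have := Nat.testBit_lt_two_pow (lt_of_lt_of_le hpk (Nat.pow_le_pow_right (by omega) (not_lt.1 hc)))
        rw [this] at hb; exact absurd hb (by simp)
      have hwn : fr.log2 < n := hbn _ (tb_log2 _ h2)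
      have no1 : ∀ A, Sem n I A → Inv n A (N,E) → ¬ A v fr.log2 := fun A hA hs hvw =>
        ih _ h.1 A hA (Inv_addE hA.toGoodA hs hvw)
      refine ih _ h.2 A hA (Inv_exc hA.toGoodA hs ?_)
      intro b hb hvb
      rcases twins_spec _ _ _ _ _ _ _ _ hb with rfl | ⟨q1, q2, q3⟩
      · exact no1 A hA hs hvb
      · obtain ⟨r1, r2⟩ := twin_sem hA hwn (hbn _ (mem_bits _ _ _ q2)) hs q3
        refine no1 _ r1 r2 ?_
        rw [Equiv.swap_apply_left, Equiv.swap_apply_of_ne_of_ne h3 (Ne.symm q1)]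
        exact hvb
    · exact ih _ h A hA hp

theorem diagM_spec (n : Nat) {A : Nat → Nat → Prop} (hA : GoodA n A) (k : Nat) (hk : k ≤ n) : IE n A (diagM n k) := by
  induction k with
  | zero => intro a b _ h; simp [diagM] at h
  | succ k ih =>
    intro a b hb h
    have e : diagM n (k+1) = Nat.lor (diagM n k) (Nat.shiftLeft 1 (n*k+k)) := rfl
    rw [e, tb_lor, tb_shl1] at h
    simp only [Bool.or_eq_true, decide_eq_true_eq] at h
    rcases h with h | h
    · exact ih (by omega) a b hb h
    · have e1 : a = k := by
        have h1 : (n*a+b)/n = a := by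
          rw [Nat.mul_add_div (by omega), Nat.div_eq_of_lt hb]; rfl
        have h2 : (n*k+k)/n = k := by
          rw [Nat.mul_add_div (by omega), Nat.div_eq_of_lt (by omega : k < n)]; rfl
        rw [← h1, ← h, h2]
      subst e1
      have : a = b := by omega
      subst this; exact hA.irr _

theorem no_model (n : Nat) (hn : 0 < n) (I : Inst) (f : Nat) (hs : solve n I f (0, diagM n n) = true)
    (hI : ∀ c ∈ I.cs, c.2.1 < 2^n) (hl : ∀ c ∈ I.ord, c.2 < 2^n)
    (A : Nat → Nat → Prop) (hA : Sem n I A) : False :=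
  solve_sound n hn I hI hl f _ hs A hA ⟨fun a b _ h => by simp at h, diagM_spec n hA.toGoodA n le_rfl⟩
end Sv

namespace Gr
variable {V : Type} [DecidableEq V] (G : SimpleGraph V) [DecidableRel G.Adj]

structure Good : Prop where
  no3 : ∀ a b c, G.Adj a b → G.Adj b c → G.Adj c a → False
  no4 : ∀ a b c d, G.Adj a b → G.Adj b c → G.Adj c d → G.Adj d a → a ≠ c → b ≠ d → False

/-- number of neighbours of v in S -/
def d (S : Finset V) (v : V) : ℕ := (S.filter (G.Adj v)).card
/-- twice the number of edges inside S -/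
def E2 (S : Finset V) : ℕ := ∑ v ∈ S, d G S v

theorem ext_lab (φ : ℕ → V) (n k : ℕ) (S : Finset V) (hS : S.card = k) :
    ∃ φ' : ℕ → V, (∀ a < n, φ' a = φ a) ∧ (Finset.Ico n (n+k)).image φ' = S := by
  classical
  have e := S.equivFinOfCardEq hS
  refine ⟨fun a => if h : n ≤ a ∧ a - n < k then (e.symm ⟨a - n, h.2⟩ : V) else φ a, ?_, ?_⟩
  · intro a ha
    exact dif_neg (by omega)
  · ext v
    simp only [Finset.mem_image, Finset.mem_Ico]
    constructor
    · rintro ⟨a, ha, rfl⟩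
      rw [dif_pos (by omega)]
      exact (e.symm _).2
    · intro hv
      refine ⟨n + (e ⟨v, hv⟩ : ℕ), by omega, ?_⟩
      rw [dif_pos (by omega)]
      simp

theorem label_sem (hG : Good G) (n : ℕ) (I : Sv.Inst) (φ : ℕ → V) (hinj : Set.InjOn φ (Finset.range n))
    (hcs : ∀ c ∈ I.cs, ∀ v ∈ c.1, v < n ∧ d G ((Sv.bs n c.2.1).image φ) (φ v) = c.2.2)
    (hball : ∀ x ∈ I.balls, x < n ∧ ∀ w, I.dom.testBit w = true → w < n ∧
      (w ≠ x → ¬ G.Adj (φ x) (φ w) → ∃ i < n, G.Adj (φ x) (φ i) ∧ G.Adj (φ w) (φ i))) :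
    Sv.Sem n I (fun a b => a < n ∧ b < n ∧ G.Adj (φ a) (φ b)) := by
  classical
  refine ⟨⟨?_, ?_, ?_, ?_, ?_⟩, ?_, ?_⟩
  · rintro a b ⟨h1, h2, h3⟩; exact ⟨h2, h1, h3.symm⟩
  · rintro a ⟨_, _, h⟩; exact G.loopless.irrefl _ h
  · rintro a b c ⟨_, _, h1⟩ ⟨_, _, h2⟩ ⟨_, _, h3⟩; exact hG.no3 _ _ _ h1 h2 h3
  · rintro a b c e ⟨a1, b1, h1⟩ ⟨_, c1, h2⟩ ⟨_, d1, h3⟩ ⟨_, _, h4⟩ h5 h6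
    exact hG.no4 _ _ _ _ h1 h2 h3 h4
      (fun e => h5 (hinj (by simpa using a1) (by simpa using c1) e))
      (fun e => h6 (hinj (by simpa using b1) (by simpa using d1) e))
  · rintro a b ⟨h1, h2, _⟩; exact ⟨h1, h2⟩
  · intro c hc v hv
    obtain ⟨h1, h2⟩ := hcs c hc v hv
    rw [← h2, d]
    refine Finset.card_bij (fun b _ => φ b) ?_ ?_ ?_
    · intro b hb
      simp only [Finset.mem_filter, Finset.mem_range, Finset.mem_image, Sv.bs] at hb ⊢
      exact ⟨⟨b, ⟨hb.1, hb.2.1⟩, rfl⟩, hb.2.2.2.2⟩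
    · intro b hb b' hb' e
      simp only [Finset.mem_filter] at hb hb'
      exact hinj (by simpa using hb.1) (by simpa using hb'.1) e
    · intro y hy
      simp only [Finset.mem_filter, Finset.mem_range, Finset.mem_image, Sv.bs] at hy
      obtain ⟨⟨b, hb, rfl⟩, hadj⟩ := hy
      exact ⟨b, by simp only [Finset.mem_filter, Finset.mem_range]; exact ⟨hb.1, hb.2, h1, hb.1, hadj⟩, rfl⟩
  · intro x hx w hw hwx hna
    obtain ⟨h1, h2⟩ := hball x hx
    obtain ⟨h3, h4⟩ := h2 w hw
    obtain ⟨i, hi, h5, h6⟩ := h4 hwx (fun h => hna ⟨h1, h3, h⟩)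
    exact ⟨i, ⟨h1, hi, h5⟩, ⟨h3, hi, h6⟩⟩

theorem inj3 (φ : ℕ → V) (a b c : ℕ) (S T U : Finset V) (hab : a ≤ b) (hbc : b ≤ c)
    (hS : (Finset.Ico 0 a).image φ = S) (hT : (Finset.Ico a b).image φ = T) (hU : (Finset.Ico b c).image φ = U)
    (cS : S.card = a) (cT : T.card = b - a) (cU : U.card = c - b)
    (hST : Disjoint S T) (hSU : Disjoint S U) (hTU : Disjoint T U) : Set.InjOn φ (Finset.range c) := by
  have : (Finset.range c) = Finset.Ico 0 a ∪ Finset.Ico a b ∪ Finset.Ico b c := by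
    rw [Finset.range_eq_Ico, Finset.Ico_union_Ico_eq_Ico (by omega) hab, Finset.Ico_union_Ico_eq_Ico (by omega) hbc]
  rw [← Finset.card_image_iff, this, Finset.image_union, Finset.image_union, hS, hT, hU,
    Finset.card_union_of_disjoint, Finset.card_union_of_disjoint hST, ← this, Finset.card_range]
  · omega
  · rw [Finset.disjoint_union_left]; exact ⟨hSU, hTU⟩

theorem ok1 : Sv.solve 16 Sv.i1 200 (0, Sv.diagM 16 16) = true := by decide +kernel
theorem ok2 : Sv.solve 22 Sv.i2 400 (0, Sv.diagM 22 22) = true := by decide +kernel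

theorem no16 (hG : Good G) (T P Q : Finset V) (cT : T.card = 6) (cP : P.card = 2) (cQ : Q.card = 8)
    (hTP : Disjoint T P) (hTQ : Disjoint T Q) (hPQ : Disjoint P Q)
    (h1 : ∀ v ∈ T, d G T v = 0 ∧ d G (P ∪ Q) v = 3)
    (h2 : ∀ v ∈ P, d G T v = 1 ∧ d G (P ∪ Q) v = 3)
    (h3 : ∀ v ∈ Q, d G T v = 2 ∧ d G (P ∪ Q) v = 2) : False := by
  have hne : T.Nonempty := by rw [← Finset.card_pos]; omega
  obtain ⟨v0, _⟩ := hne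
  obtain ⟨φ1, _, b1⟩ := ext_lab (fun _ => v0) 0 6 T cT
  obtain ⟨φ2, a2, b2⟩ := ext_lab φ1 6 2 P cP
  obtain ⟨φ, a3, b3⟩ := ext_lab φ2 8 8 Q cQ
  have iT : (Finset.Ico 0 6).image φ = T := by
    rw [← b1]; apply Finset.image_congr; intro a ha
    simp only [Finset.coe_Ico, Set.mem_Ico] at ha
    rw [a3 a (by omega), a2 a (by omega)]
  have iP : (Finset.Ico 6 8).image φ = P := by
    rw [← b2]; apply Finset.image_congr; intro a ha
    simp only [Finset.coe_Ico, Set.mem_Ico] at ha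
    rw [a3 a (by omega)]
  have iQ : (Finset.Ico 8 16).image φ = Q := b3
  have hinj := inj3 φ 6 8 16 T P Q (by omega) (by omega) iT iP iQ cT cP cQ hTP hTQ hPQ
  have iPQ : (Finset.Ico 6 16).image φ = P ∪ Q := by
    rw [← Finset.Ico_union_Ico_eq_Ico (by omega : 6 ≤ 8) (by omega : 8 ≤ 16), Finset.image_union, iP, iQ]
  have e1 : Sv.bs 16 63 = Finset.Ico 0 6 := by decide
  have e2 : Sv.bs 16 65472 = Finset.Ico 6 16 := by decide
  have mT : ∀ a, a < 6 → φ a ∈ T := fun a h => iT ▸ Finset.mem_image_of_mem φ (Finset.mem_Ico.2 ⟨by omega, h⟩)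
  have mP : ∀ a, 6 ≤ a → a < 8 → φ a ∈ P := fun a h h' => iP ▸ Finset.mem_image_of_mem φ (Finset.mem_Ico.2 ⟨h, h'⟩)
  have mQ : ∀ a, 8 ≤ a → a < 16 → φ a ∈ Q := fun a h h' => iQ ▸ Finset.mem_image_of_mem φ (Finset.mem_Ico.2 ⟨h, h'⟩)
  refine Sv.no_model 16 (by omega) Sv.i1 200 ok1 (by decide) (by decide) _ (label_sem G hG 16 Sv.i1 φ hinj ?_ ?_)
  · intro c hc v hv
    simp only [Sv.i1, List.mem_cons, List.not_mem_nil, or_false] at hc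
    rcases hc with rfl | rfl | rfl | rfl | rfl | rfl
    · have hv' : v < 6 := by simp at hv; omega
      exact ⟨by omega, by simp only [e1, iT]; exact (h1 _ (mT v hv')).1⟩
    · have hv' : v < 6 := by simp at hv; omega
      exact ⟨by omega, by simp only [e2, iPQ]; exact (h1 _ (mT v hv')).2⟩
    · have hv' : 6 ≤ v ∧ v < 8 := by simp at hv; omega
      exact ⟨by omega, by simp only [e1, iT]; exact (h2 _ (mP v hv'.1 hv'.2)).1⟩
    · have hv' : 6 ≤ v ∧ v < 8 := by simp at hv; omega
      exact ⟨by omega, by simp only [e2, iPQ]; exact (h2 _ (mP v hv'.1 hv'.2)).2⟩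
    · have hv' : 8 ≤ v ∧ v < 16 := by simp at hv; omega
      exact ⟨by omega, by simp only [e1, iT]; exact (h3 _ (mQ v hv'.1 hv'.2)).1⟩
    · have hv' : 8 ≤ v ∧ v < 16 := by simp at hv; omega
      exact ⟨by omega, by simp only [e2, iPQ]; exact (h3 _ (mQ v hv'.1 hv'.2)).2⟩
  · intro x hx; simp [Sv.i1] at hx

theorem no22 (hG : Good G) (u : V) (L X : Finset V) (cL : L.card = 17) (cX : X.card = 4)
    (huL : u ∉ L) (huX : u ∉ X) (hLX : Disjoint L X)
    (h1 : ∀ v ∈ X, d G X v = 0 ∧ d G L v = 5)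
    (h2 : ∀ v ∈ L, d G (L ∪ X) v = 4)
    (h3 : d G X u = 0 ∧ d G L u = 3)
    (hb : ∀ x ∈ X, ∀ w ∈ L ∪ X, w ≠ x → ¬ G.Adj x w → ∃ i ∈ L, G.Adj x i ∧ G.Adj w i) : False := by
  obtain ⟨φ1, _, b1⟩ := ext_lab (fun _ => u) 0 1 {u} (by simp)
  obtain ⟨φ2, a2, b2⟩ := ext_lab φ1 1 17 L cL
  obtain ⟨φ, a3, b3⟩ := ext_lab φ2 18 4 X cX
  have iT : (Finset.Ico 0 1).image φ = {u} := by
    rw [← b1]; apply Finset.image_congr; intro a ha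
    simp only [Finset.coe_Ico, Set.mem_Ico] at ha
    rw [a3 a (by omega), a2 a (by omega)]
  have iP : (Finset.Ico 1 18).image φ = L := by
    rw [← b2]; apply Finset.image_congr; intro a ha
    simp only [Finset.coe_Ico, Set.mem_Ico] at ha
    rw [a3 a (by omega)]
  have iQ : (Finset.Ico 18 22).image φ = X := b3
  have hinj := inj3 φ 1 18 22 {u} L X (by omega) (by omega) iT iP iQ (by simp) cL cX
    (by simpa using huL) (by simpa using huX) hLX
  have iPQ : (Finset.Ico 1 22).image φ = L ∪ X := by
    rw [← Finset.Ico_union_Ico_eq_Ico (by omega : 1 ≤ 18) (by omega : 18 ≤ 22), Finset.image_union, iP, iQ]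
  have e1 : Sv.bs 22 3932160 = Finset.Ico 18 22 := by decide
  have e2 : Sv.bs 22 262142 = Finset.Ico 1 18 := by decide
  have e3 : Sv.bs 22 4194302 = Finset.Ico 1 22 := by decide
  have mT : ∀ a, a < 1 → φ a = u := fun a h => Finset.mem_singleton.1 (iT ▸ Finset.mem_image_of_mem φ (Finset.mem_Ico.2 ⟨by omega, h⟩))
  have mP : ∀ a, 1 ≤ a → a < 18 → φ a ∈ L := fun a h h' => iP ▸ Finset.mem_image_of_mem φ (Finset.mem_Ico.2 ⟨h, h'⟩)
  have mQ : ∀ a, 18 ≤ a → a < 22 → φ a ∈ X := fun a h h' => iQ ▸ Finset.mem_image_of_mem φ (Finset.mem_Ico.2 ⟨h, h'⟩)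
  have mPQ : ∀ a, 1 ≤ a → a < 22 → φ a ∈ L ∪ X := fun a h h' => iPQ ▸ Finset.mem_image_of_mem φ (Finset.mem_Ico.2 ⟨h, h'⟩)
  refine Sv.no_model 22 (by omega) Sv.i2 400 ok2 (by decide) (by decide) _ (label_sem G hG 22 Sv.i2 φ hinj ?_ ?_)
  · intro c hc v hv
    simp only [Sv.i2, List.mem_cons, List.not_mem_nil, or_false] at hc
    rcases hc with rfl | rfl | rfl | rfl | rfl
    · have hv' : 18 ≤ v ∧ v < 22 := by simp at hv; omega
      exact ⟨by omega, by simp only [e1, iQ]; exact (h1 _ (mQ v hv'.1 hv'.2)).1⟩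
    · have hv' : 18 ≤ v ∧ v < 22 := by simp at hv; omega
      exact ⟨by omega, by simp only [e2, iP]; exact (h1 _ (mQ v hv'.1 hv'.2)).2⟩
    · have hv' : 1 ≤ v ∧ v < 18 := by simp at hv; omega
      exact ⟨by omega, by simp only [e3, iPQ]; exact (h2 _ (mP v hv'.1 hv'.2))⟩
    · have hv' : v < 1 := by simp at hv; omega
      exact ⟨by omega, by simp only [e1, iQ]; rw [mT v hv']; exact h3.1⟩
    · have hv' : v < 1 := by simp at hv; omega
      exact ⟨by omega, by simp only [e2, iP]; rw [mT v hv']; exact h3.2⟩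
  · intro x hx
    have hx' : 18 ≤ x ∧ x < 22 := by simp [Sv.i2] at hx; omega
    refine ⟨hx'.2, ?_⟩
    intro w hw
    have hw22 : w < 22 := by
      by_contra hc
      have : (4194302 : ℕ) < 2^22 := by norm_num
      have := Nat.testBit_lt_two_pow (lt_of_lt_of_le this (Nat.pow_le_pow_right (by omega) (not_lt.1 hc)))
      rw [show Sv.i2.dom = 4194302 from rfl, this] at hw
      exact absurd hw (by simp)
    have hw1 : w ∈ Finset.Ico 1 22 := by
      rw [← e3]; simp only [Sv.bs, Finset.mem_filter, Finset.mem_range]; exact ⟨hw22, hw⟩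
    rw [Finset.mem_Ico] at hw1
    refine ⟨hw22, ?_⟩
    intro hwx hna
    obtain ⟨i, hi, h5, h6⟩ := hb (φ x) (mQ x hx'.1 hx'.2) (φ w) (mPQ w hw1.1 hw1.2)
      (fun e => hwx (hinj (by simpa using hw22) (by simpa using hx'.2) e)) hna
    rw [← iP, Finset.mem_image] at hi
    obtain ⟨j, hj, rfl⟩ := hi
    rw [Finset.mem_Ico] at hj
    exact ⟨j, by omega, h5, h6⟩
end Gr

set_option linter.unusedSectionVars false
namespace Gr
variable {V : Type} [DecidableEq V] {G : SimpleGraph V} [DecidableRel G.Adj]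

theorem d_union {A B : Finset V} (h : Disjoint A B) (v : V) : d G (A ∪ B) v = d G A v + d G B v := by
  unfold d
  rw [Finset.filter_union, Finset.card_union_of_disjoint (Finset.disjoint_filter_filter h)]
theorem d_split {T S : Finset V} (h : T ⊆ S) (v : V) : d G S v = d G T v + d G (S \ T) v := by
  rw [← d_union Finset.disjoint_sdiff, Finset.union_sdiff_of_subset h]
theorem d_mono {T S : Finset V} (h : T ⊆ S) (v : V) : d G T v ≤ d G S v :=
  Finset.card_le_card (Finset.filter_subset_filter _ h)
theorem d_pos {S : Finset V} {u v : V} (hu : u ∈ S) (h : G.Adj v u) : 1 ≤ d G S v :=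
  Finset.card_pos.2 ⟨u, Finset.mem_filter.2 ⟨hu, h⟩⟩
theorem d_ex {S : Finset V} {v : V} (h : 1 ≤ d G S v) : ∃ u ∈ S, G.Adj v u := by
  obtain ⟨u, hu⟩ := Finset.card_pos.1 h
  exact ⟨u, (Finset.mem_filter.1 hu).1, (Finset.mem_filter.1 hu).2⟩
theorem d_zero {S : Finset V} {v : V} (h : ∀ u ∈ S, ¬ G.Adj v u) : d G S v = 0 := by
  unfold d; rw [Finset.card_eq_zero, Finset.filter_eq_empty_iff]; exact fun u hu => h u hu
theorem d_zero' {S : Finset V} {v : V} (h : d G S v = 0) : ∀ u ∈ S, ¬ G.Adj v u := by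
  intro u hu huv; have := d_pos (G := G) hu huv; omega
theorem d_one {S : Finset V} {v u : V} (hu : u ∈ S) (hvu : G.Adj v u) (h : d G S v ≤ 1) :
    ∀ w ∈ S, G.Adj v w → w = u := by
  intro w hw hvw
  exact Finset.card_le_one.1 h w (Finset.mem_filter.2 ⟨hw, hvw⟩) u (Finset.mem_filter.2 ⟨hu, hvu⟩)
theorem d_le_card (S : Finset V) (v : V) : d G S v ≤ S.card := Finset.card_filter_le _ _
theorem d_two {S : Finset V} {v u w : V} (hu : u ∈ S) (hvu : G.Adj v u) (hw : w ∈ S) (hvw : G.Adj v w) (h : u ≠ w) :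
    2 ≤ d G S v := by
  have : ({u, w} : Finset V) ⊆ S.filter (G.Adj v) := by
    intro x hx
    simp only [Finset.mem_insert, Finset.mem_singleton] at hx
    rcases hx with rfl | rfl
    · exact Finset.mem_filter.2 ⟨hu, hvu⟩
    · exact Finset.mem_filter.2 ⟨hw, hvw⟩
  have := Finset.card_le_card this
  rwa [Finset.card_pair h] at this
theorem d_insert {S : Finset V} {u v : V} (hu : u ∉ S) : d G (insert u S) v = d G S v + if G.Adj v u then 1 else 0 := by
  unfold d
  rw [Finset.filter_insert]
  split_ifs with h
  · rw [Finset.card_insert_of_notMem (by simp [hu])]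
  · rfl

theorem dsum_comm (A B : Finset V) : ∑ v ∈ A, d G B v = ∑ v ∈ B, d G A v := by
  simp only [d, Finset.card_filter]
  rw [Finset.sum_comm]
  refine Finset.sum_congr rfl fun v _ => Finset.sum_congr rfl fun u _ => ?_
  simp only [G.adj_comm]

theorem E2_sdiff {T S : Finset V} (h : T ⊆ S) :
    E2 G S + E2 G T = E2 G (S \ T) + 2 * ∑ v ∈ T, d G S v := by
  have h1 : E2 G S = ∑ v ∈ S \ T, d G S v + ∑ v ∈ T, d G S v := (Finset.sum_sdiff h).symm
  have h2 : ∑ v ∈ S \ T, d G S v = ∑ v ∈ S \ T, d G T v + E2 G (S \ T) := by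
    rw [E2, ← Finset.sum_add_distrib]; exact Finset.sum_congr rfl fun v _ => d_split h v
  have h3 : ∑ v ∈ T, d G S v = E2 G T + ∑ v ∈ T, d G (S \ T) v := by
    rw [E2, ← Finset.sum_add_distrib]; exact Finset.sum_congr rfl fun v _ => d_split h v
  have h4 := dsum_comm (G := G) T (S \ T)
  omega

theorem d_self_insert (v : V) (T : Finset V) : d G (insert v T) v = d G T v := by
  unfold d; rw [Finset.filter_insert, if_neg (G.loopless.irrefl v)]
theorem E2_single (v : V) : E2 G {v} = 0 := by
  simp [E2, d, Finset.filter_singleton]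
theorem E2_insert {v : V} {T : Finset V} (h : v ∉ T) : E2 G (insert v T) = E2 G T + 2 * d G T v := by
  have h1 := E2_sdiff (G := G) (T := {v}) (S := insert v T) (by simp)
  rw [E2_single, Finset.sum_singleton, d_self_insert] at h1
  have : insert v T \ {v} = T := by
    ext x; simp only [Finset.mem_sdiff, Finset.mem_insert, Finset.mem_singleton]
    constructor
    · rintro ⟨h1 | h1, h2⟩ <;> tauto
    · intro hx; exact ⟨Or.inr hx, fun e => h (e ▸ hx)⟩
  rw [this] at h1; exact h1
theorem E2_even (S : Finset V) : ∃ e, E2 G S = 2 * e := by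
  induction S using Finset.induction_on with
  | empty => exact ⟨0, rfl⟩
  | insert v T h ih => obtain ⟨e, he⟩ := ih; exact ⟨e + d G T v, by rw [E2_insert h, he]; ring⟩
theorem E2_insert_ge {v u : V} {T : Finset V} (h : v ∉ T) (hu : u ∈ T) (hvu : G.Adj v u) :
    E2 G T + 2 ≤ E2 G (insert v T) := by
  rw [E2_insert h]; have := d_pos (G := G) hu hvu; omega
theorem E2_pair {u v : V} (h : G.Adj u v) : 2 ≤ E2 G {u, v} := by
  have := E2_insert_ge (G := G) (T := {v}) (v := u) (u := v) (by simpa using h.ne) (by simp) h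
  omega
theorem E2_indep {S : Finset V} (h : ∀ u ∈ S, ∀ v ∈ S, ¬ G.Adj u v) : E2 G S = 0 :=
  Finset.sum_eq_zero fun u hu => d_zero (h u hu)
theorem E2_pos {S : Finset V} (h : E2 G S ≠ 0) : ∃ u ∈ S, ∃ v ∈ S, G.Adj u v := by
  by_contra hc; push Not at hc; exact h (E2_indep hc)

/-- second neighbourhood counting -/
theorem ball_aux (hG : Good G) {S : Finset V} {v : V} (hv : v ∈ S) (W : Finset V) (hW : W ⊆ S) (hvW : v ∉ W)
    (hW1 : ∀ w ∈ W, ¬ G.Adj v w) (hW2 : ∀ w ∈ W, ∀ u ∈ S, G.Adj v u → ¬ G.Adj u w) :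
    1 + ∑ u ∈ S.filter (G.Adj v), d G S u + W.card ≤ S.card := by
  set N := S.filter (G.Adj v) with hN
  have mN : ∀ u, u ∈ N ↔ u ∈ S ∧ G.Adj v u := fun u => by rw [hN, Finset.mem_filter]
  let P : V → Finset V := fun u => (S.filter (G.Adj u)).erase v
  have hP : ∀ u x, x ∈ P u ↔ x ≠ v ∧ x ∈ S ∧ G.Adj u x := fun u x => by
    simp only [P, Finset.mem_erase, Finset.mem_filter]
  have cP : ∀ u ∈ N, (P u).card + 1 = d G S u := by
    intro u hu
    exact Finset.card_erase_add_one (Finset.mem_filter.2 ⟨hv, ((mN u).1 hu).2.symm⟩)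
  have dP : ∀ u ∈ N, ∀ u' ∈ N, u ≠ u' → Disjoint (P u) (P u') := by
    intro u hu u' hu' hne
    rw [Finset.disjoint_left]
    intro x hx hx'
    rw [hP] at hx hx'
    exact hG.no4 v u x u' ((mN u).1 hu).2 hx.2.2 hx'.2.2.symm ((mN u').1 hu').2.symm (Ne.symm hx.1) hne
  have hcard : (N.biUnion P).card = ∑ u ∈ N, (P u).card := Finset.card_biUnion dP
  have hs : ∑ u ∈ N, d G S u = ∑ u ∈ N, (P u).card + N.card := by
    rw [Finset.card_eq_sum_ones, ← Finset.sum_add_distrib]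
    exact Finset.sum_congr rfl fun u hu => (cP u hu).symm
  have d1 : Disjoint N (N.biUnion P) := by
    rw [Finset.disjoint_left]
    intro x hx hx'
    obtain ⟨u, hu, hxu⟩ := Finset.mem_biUnion.1 hx'
    rw [hP] at hxu
    exact hG.no3 v u x ((mN u).1 hu).2 hxu.2.2 ((mN x).1 hx).2.symm
  have d2 : Disjoint {v} (N ∪ N.biUnion P) := by
    rw [Finset.disjoint_singleton_left, Finset.mem_union, Finset.mem_biUnion]
    rintro (h | ⟨u, _, h⟩)
    · exact G.loopless.irrefl _ ((mN v).1 h).2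
    · rw [hP] at h; exact h.1 rfl
  have d3 : Disjoint ({v} ∪ (N ∪ N.biUnion P)) W := by
    rw [Finset.disjoint_right]
    intro w hw hc
    simp only [Finset.mem_union, Finset.mem_singleton, Finset.mem_biUnion] at hc
    rcases hc with rfl | hc | ⟨u, hu, hc⟩
    · exact hvW hw
    · exact hW1 w hw ((mN w).1 hc).2
    · rw [hP] at hc; exact hW2 w hw u ((mN u).1 hu).1 ((mN u).1 hu).2 hc.2.2
  have hsub : ({v} ∪ (N ∪ N.biUnion P)) ∪ W ⊆ S := by
    intro x hx
    simp only [Finset.mem_union, Finset.mem_singleton, Finset.mem_biUnion] at hx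
    rcases hx with (rfl | hx | ⟨u, hu, hx⟩) | hx
    · exact hv
    · exact ((mN x).1 hx).1
    · rw [hP] at hx; exact hx.2.1
    · exact hW hx
  have := Finset.card_le_card hsub
  rw [Finset.card_union_of_disjoint d3, Finset.card_union_of_disjoint d2, Finset.card_union_of_disjoint d1, hcard,
    Finset.card_singleton] at this
  omega

theorem ball (hG : Good G) {S : Finset V} {v : V} (hv : v ∈ S) :
    1 + ∑ u ∈ S.filter (G.Adj v), d G S u ≤ S.card := by
  have := ball_aux hG hv ∅ (by simp) (by simp) (by simp) (by simp)
  simpa using this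
theorem ball_full (hG : Good G) {S : Finset V} {v : V} (hv : v ∈ S)
    (h : S.card ≤ 1 + ∑ u ∈ S.filter (G.Adj v), d G S u) {w : V} (hw : w ∈ S) (hwv : w ≠ v) (hna : ¬ G.Adj v w) :
    ∃ u ∈ S, G.Adj v u ∧ G.Adj u w := by
  by_contra hc
  push Not at hc
  have := ball_aux hG hv {w} (by simpa using hw) (by simpa using hwv.symm) (by simpa using hna)
    (by intro x hx; rw [Finset.mem_singleton] at hx; subst hx; exact hc)
  simp at this; omega
/-- ball bound where neighbours have degree ≥ k, and those outside F have degree ≥ k+1 -/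
theorem ball_le (hG : Good G) {S : Finset V} {v : V} (hv : v ∈ S) (k : ℕ) (h : ∀ u ∈ S, k ≤ d G S u) :
    1 + k * d G S v ≤ S.card := by
  have h1 := ball hG hv
  have h2 : (S.filter (G.Adj v)).card • k ≤ ∑ u ∈ S.filter (G.Adj v), d G S u :=
    Finset.card_nsmul_le_sum _ _ _ fun u hu => h u (Finset.mem_filter.1 hu).1
  rw [smul_eq_mul] at h2
  have : d G S v = (S.filter (G.Adj v)).card := rfl
  rw [this, mul_comm]; omega
theorem nbr_sum {S F : Finset V} {v : V} (k : ℕ) (hF : F ⊆ S) (h1 : ∀ u ∈ S, k ≤ d G S u)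
    (h2 : ∀ u ∈ S, u ∉ F → k + 1 ≤ d G S u) :
    k * d G S v + d G (S \ F) v ≤ ∑ u ∈ S.filter (G.Adj v), d G S u := by
  have : S.filter (G.Adj v) = F.filter (G.Adj v) ∪ (S \ F).filter (G.Adj v) := by
    rw [← Finset.filter_union, Finset.union_sdiff_of_subset hF]
  rw [this, Finset.sum_union (Finset.disjoint_filter_filter Finset.disjoint_sdiff)]
  have a1 : (F.filter (G.Adj v)).card • k ≤ ∑ u ∈ F.filter (G.Adj v), d G S u :=
    Finset.card_nsmul_le_sum _ _ _ fun u hu => h1 u (hF (Finset.mem_filter.1 hu).1)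
  have a2 : ((S \ F).filter (G.Adj v)).card • (k+1) ≤ ∑ u ∈ (S \ F).filter (G.Adj v), d G S u :=
    Finset.card_nsmul_le_sum _ _ _ fun u hu => by
      have := (Finset.mem_filter.1 hu).1
      rw [Finset.mem_sdiff] at this
      exact h2 u this.1 this.2
  rw [smul_eq_mul] at a1 a2
  rw [d_split hF]
  unfold d at *
  nlinarith
theorem ball_le2 (hG : Good G) {S F : Finset V} {v : V} (hv : v ∈ S) (k : ℕ) (hF : F ⊆ S) (h1 : ∀ u ∈ S, k ≤ d G S u)
    (h2 : ∀ u ∈ S, u ∉ F → k + 1 ≤ d G S u) :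
    1 + k * d G S v + d G (S \ F) v ≤ S.card := by
  have := ball hG hv
  have := nbr_sum (G := G) (v := v) k hF h1 h2
  omega

/-- pair counting -/
theorem pairs (hG : Good G) (A S : Finset V) :
    ∑ w ∈ S, d G A w * (d G A w - 1) + E2 G A ≤ A.card * (A.card - 1) := by
  have key : ∀ a ∈ A, ∑ w ∈ S.filter (G.Adj a), (d G A w - 1) + d G A a ≤ A.card - 1 := by
    intro a ha
    let P : V → Finset V := fun u => (A.filter (G.Adj u)).erase a
    have hP : ∀ u x, x ∈ P u ↔ x ≠ a ∧ x ∈ A ∧ G.Adj u x := fun u x => by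
      simp only [P, Finset.mem_erase, Finset.mem_filter]
    have cP : ∀ u ∈ S.filter (G.Adj a), (P u).card = d G A u - 1 := by
      intro u hu
      exact Finset.card_erase_of_mem (Finset.mem_filter.2 ⟨ha, (Finset.mem_filter.1 hu).2.symm⟩)
    have dP : ∀ u ∈ S.filter (G.Adj a), ∀ u' ∈ S.filter (G.Adj a), u ≠ u' → Disjoint (P u) (P u') := by
      intro u hu u' hu' hne
      rw [Finset.disjoint_left]
      intro x hx hx'
      rw [hP] at hx hx'
      exact hG.no4 a u x u' (Finset.mem_filter.1 hu).2 hx.2.2 hx'.2.2.symm (Finset.mem_filter.1 hu').2.symm (Ne.symm hx.1) hne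
    have hcard := Finset.card_biUnion dP
    have hd : Disjoint ((S.filter (G.Adj a)).biUnion P) (A.filter (G.Adj a)) := by
      rw [Finset.disjoint_left]
      intro x hx hx'
      obtain ⟨u, hu, hxu⟩ := Finset.mem_biUnion.1 hx
      rw [hP] at hxu
      exact hG.no3 a u x (Finset.mem_filter.1 hu).2 hxu.2.2 (Finset.mem_filter.1 hx').2.symm
    have hsub : (S.filter (G.Adj a)).biUnion P ∪ A.filter (G.Adj a) ⊆ A.erase a := by
      intro x hx
      rw [Finset.mem_erase]
      rcases Finset.mem_union.1 hx with hx | hx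
      · obtain ⟨u, hu, hxu⟩ := Finset.mem_biUnion.1 hx
        rw [hP] at hxu
        exact ⟨hxu.1, hxu.2.1⟩
      · exact ⟨fun e => G.loopless.irrefl a (e ▸ (Finset.mem_filter.1 hx).2), (Finset.mem_filter.1 hx).1⟩
    have := Finset.card_le_card hsub
    rw [Finset.card_union_of_disjoint hd, hcard, Finset.card_erase_of_mem ha, Finset.sum_congr rfl cP] at this
    exact this
  have h1 : ∑ a ∈ A, (∑ w ∈ S.filter (G.Adj a), (d G A w - 1) + d G A a) ≤ A.card • (A.card - 1) :=
    Finset.sum_le_card_nsmul _ _ _ key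
  rw [Finset.sum_add_distrib, smul_eq_mul] at h1
  refine le_trans (le_of_eq ?_) h1
  congr 1
  simp only [Finset.sum_filter]
  rw [Finset.sum_comm]
  refine Finset.sum_congr rfl fun w _ => ?_
  rw [← Finset.sum_filter, Finset.sum_const, smul_eq_mul]
  unfold d
  simp only [G.adj_comm]

variable (G) in
def Bd (n m : ℕ) : Prop := ∀ S : Finset V, S.card = n → E2 G S ≤ 2 * m

theorem delT {k m : ℕ} (hB : Bd G k m) {S T : Finset V} (hT : T ⊆ S) (hc : S.card = k + T.card) :
    E2 G S + E2 G T ≤ 2 * m + 2 * ∑ v ∈ T, d G S v := by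
  rw [E2_sdiff hT]
  have := hB (S \ T) (by rw [Finset.card_sdiff_of_subset hT]; omega)
  omega
theorem del1 {k m : ℕ} (hB : Bd G k m) {S : Finset V} {v : V} (hv : v ∈ S) (hc : S.card = k + 1) :
    E2 G S ≤ 2 * m + 2 * d G S v := by
  have := delT hB (T := {v}) (by simpa using hv) (by simpa using hc)
  rw [Finset.sum_singleton] at this; omega
theorem del2 {k m : ℕ} (hB : Bd G k m) {S : Finset V} {u v : V} (hu : u ∈ S) (hv : v ∈ S) (h : G.Adj u v) (hc : S.card = k + 2) :
    E2 G S + 2 ≤ 2 * m + 2 * (d G S u + d G S v) := by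
  have := delT hB (T := {u, v}) (by intro x hx; simp at hx; rcases hx with rfl | rfl <;> assumption)
    (by rw [Finset.card_pair h.ne]; exact hc)
  rw [Finset.sum_pair h.ne] at this
  have := E2_pair h; omega
theorem setup {n m : ℕ} (hB : Bd G n m) {S : Finset V} (hc : S.card = n + 1) (hn : 1 ≤ n) :
    ∃ e, E2 G S = 2 * e ∧ (n - 1) * e ≤ (n + 1) * m ∧ ∀ v ∈ S, e ≤ m + d G S v := by
  obtain ⟨e, he⟩ := E2_even (G := G) S
  have h1 : ∀ v ∈ S, e ≤ m + d G S v := by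
    intro v hv; have := del1 hB hv hc; omega
  refine ⟨e, he, ?_, h1⟩
  have h2 : S.card • e ≤ ∑ v ∈ S, (m + d G S v) := Finset.card_nsmul_le_sum _ _ _ h1
  rw [Finset.sum_add_distrib, Finset.sum_const, smul_eq_mul, smul_eq_mul, hc] at h2
  have h3 : ∑ v ∈ S, d G S v = 2 * e := he
  rw [h3] at h2
  obtain ⟨k, rfl⟩ : ∃ k, n = k + 1 := ⟨n - 1, by omega⟩
  simp only [Nat.add_sub_cancel]
  nlinarith
theorem Bd_step {n m m' : ℕ} (hB : Bd G n m) (hn : 1 ≤ n) (h : (n + 1) * m < (n - 1) * (m' + 1)) : Bd G (n+1) m' := by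
  intro S hc
  obtain ⟨e, he, h1, _⟩ := setup hB hc hn
  by_contra hcon
  have : m' + 1 ≤ e := by omega
  have := Nat.mul_le_mul_left (n-1) this
  omega

/-- three consecutive degrees -/
theorem three_deg {S : Finset V} (a : ℕ) (h : ∀ v ∈ S, a ≤ d G S v ∧ d G S v ≤ a + 2) :
    (S.filter (fun v => d G S v = a)).card + (S.filter (fun v => d G S v = a+1)).card +
      (S.filter (fun v => d G S v = a+2)).card = S.card ∧
    (S.filter (fun v => d G S v = a+1)).card + 2 * (S.filter (fun v => d G S v = a+2)).card + a * S.card = E2 G S := by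
  simp only [Finset.card_filter, E2]
  rw [Finset.card_eq_sum_ones S]
  simp only [Finset.mul_sum, ← Finset.sum_add_distrib]
  constructor
  · refine Finset.sum_congr rfl fun v hv => ?_
    have := h v hv
    split_ifs <;> omega
  · refine Finset.sum_congr rfl fun v hv => ?_
    have := h v hv
    split_ifs <;> omega

theorem sum_const_le {A : Finset V} {f : V → ℕ} {k : ℕ} (h : ∀ v ∈ A, f v ≤ k) : ∑ v ∈ A, f v ≤ A.card * k := by
  simpa using Finset.sum_le_card_nsmul A f k h
theorem le_sum_const {A : Finset V} {f : V → ℕ} {k : ℕ} (h : ∀ v ∈ A, k ≤ f v) : A.card * k ≤ ∑ v ∈ A, f v := by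
  simpa using Finset.card_nsmul_le_sum A f k h
theorem sum_const_eq {A : Finset V} {f : V → ℕ} {k : ℕ} (h : ∀ v ∈ A, f v = k) : ∑ v ∈ A, f v = A.card * k := by
  rw [Finset.sum_congr rfl h]; simp
end Gr

namespace Gr
variable {V : Type} [DecidableEq V] {G : SimpleGraph V} [DecidableRel G.Adj]

theorem del_star {k m : ℕ} (hB : Bd G k m) {S N : Finset V} {v : V} (hv : v ∈ S) (hN : N ⊆ S)
    (hadj : ∀ u ∈ N, G.Adj v u) (hc : S.card = k + (N.card + 1)) :
    E2 G S + 2 * N.card ≤ 2 * m + 2 * (d G S v + ∑ u ∈ N, d G S u) := by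
  have hvN : v ∉ N := fun h => G.loopless.irrefl _ (hadj v h)
  have := delT hB (T := insert v N) (Finset.insert_subset hv hN)
    (by rw [Finset.card_insert_of_notMem hvN]; exact hc)
  rw [Finset.sum_insert hvN, E2_insert hvN] at this
  have h2 : d G N v = N.card := by
    unfold d; rw [Finset.filter_true_of_mem hadj]
  rw [h2] at this
  omega
theorem common (hG : Good G) (S : Finset V) {x w : V} (h : x ≠ w) : d G (S.filter (G.Adj x)) w ≤ 1 := by
  unfold d
  rw [Finset.card_le_one]
  intro a ha b hb
  simp only [Finset.mem_filter] at ha hb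
  by_contra hab
  exact hG.no4 x a w b ha.1.2 ha.2.symm hb.2 hb.1.2.symm h hab
theorem cls (F : Finset V) (f : V → ℕ) (g : ℕ → ℕ) (k : ℕ) (h : ∀ v ∈ F, f v < k) :
    ∑ v ∈ F, g (f v) = ∑ i ∈ Finset.range k, (F.filter (fun v => f v = i)).card * g i := by
  rw [← Finset.sum_fiberwise_of_maps_to (s := F) (t := Finset.range k) (g := f) (fun v hv => Finset.mem_range.2 (h v hv))]
  refine Finset.sum_congr rfl fun i _ => ?_
  refine sum_const_eq fun v hv => ?_
  rw [(Finset.mem_filter.1 hv).2]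
theorem clsc (F : Finset V) (f : V → ℕ) (k : ℕ) (h : ∀ v ∈ F, f v < k) :
    F.card = ∑ i ∈ Finset.range k, (F.filter (fun v => f v = i)).card := by
  have := cls F f (fun _ => 1) k h
  simpa using this
/-- choose j neighbours -/
theorem pickN {S : Finset V} {v : V} {j : ℕ} (h : j ≤ d G S v) :
    ∃ N ⊆ S, N.card = j ∧ ∀ u ∈ N, G.Adj v u := by
  obtain ⟨N, hN, hc⟩ := Finset.exists_subset_card_eq h
  exact ⟨N, hN.trans (Finset.filter_subset _ _), hc, fun u hu => (Finset.mem_filter.1 (hN hu)).2⟩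
theorem ex_big {S : Finset V} {n k : ℕ} (hc : S.card = n) (h : n * k < E2 G S) : ∃ v ∈ S, k + 1 ≤ d G S v := by
  by_contra hcon
  push Not at hcon
  have : ∑ v ∈ S, d G S v ≤ S.card * k := sum_const_le fun v hv => by have := hcon v hv; omega
  rw [hc] at this
  have h2 : E2 G S = ∑ v ∈ S, d G S v := rfl
  omega

theorem b10 (hG : Good G) : Bd G 10 15 := by
  intro S hc
  have h := pairs hG S S
  rw [hc] at h
  have : ∀ v ∈ S, 6 * d G S v ≤ d G S v * (d G S v - 1) + d G S v + 9 := by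
    intro v _
    generalize d G S v = x
    cases x with
    | zero => simp
    | succ x => simp only [Nat.add_sub_cancel]; nlinarith [sq_nonneg ((x:ℤ) - 2)]
  have h2 := Finset.sum_le_sum this
  rw [← Finset.mul_sum, Finset.sum_add_distrib, Finset.sum_add_distrib, Finset.sum_const, hc, smul_eq_mul] at h2
  have h3 : E2 G S = ∑ v ∈ S, d G S v := rfl
  omega

theorem reg10 (hG : Good G) {S : Finset V} (hc : S.card = 10) (he : E2 G S = 30) : ∀ v ∈ S, d G S v = 3 := by
  have h := pairs hG S S
  rw [hc] at h
  have key : ∀ v ∈ S, 6 * d G S v ≤ d G S v * (d G S v - 1) + d G S v + 9 := by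
    intro v _
    generalize d G S v = x
    cases x with
    | zero => simp
    | succ x => simp only [Nat.add_sub_cancel]; nlinarith [sq_nonneg ((x:ℤ) - 2)]
  intro v hv
  by_contra hne
  have hlt : 6 * d G S v < d G S v * (d G S v - 1) + d G S v + 9 := by
    revert hne
    generalize d G S v = x
    intro hne
    rcases Nat.lt_or_gt_of_ne hne with h | h
    · interval_cases x <;> simp
    · obtain ⟨y, rfl⟩ : ∃ y, x = y + 4 := ⟨x - 4, by omega⟩
      have : y + 4 - 1 = y + 3 := by omega
      rw [this]; nlinarith
  have h2 := Finset.sum_lt_sum key ⟨v, hv, hlt⟩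
  rw [← Finset.mul_sum, Finset.sum_add_distrib, Finset.sum_add_distrib, Finset.sum_const, hc, smul_eq_mul] at h2
  have h3 : E2 G S = ∑ v ∈ S, d G S v := rfl
  omega

theorem b11 (hG : Good G) : Bd G 11 16 := by
  intro S hc
  obtain ⟨e, he, h1, h2⟩ := setup (b10 hG) hc (by omega)
  by_contra hcon
  by_cases h3 : ∀ v ∈ S, 3 ≤ d G S v
  · obtain ⟨v, hv, hd⟩ := ex_big (G := G) (k := 3) hc (by omega)
    have := ball_le hG hv 3 h3
    omega
  · push Not at h3
    obtain ⟨v, hv, hd⟩ := h3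
    have := h2 v hv
    have hd2 : d G S v = 2 := by omega
    have he17 : e = 17 := by omega
    obtain ⟨N, hN, hNc, hadj⟩ := pickN (le_of_eq hd2.symm)
    obtain ⟨a, b, hab, rfl⟩ := Finset.card_eq_two.1 hNc
    have hva := hadj a (by simp)
    have hvb := hadj b (by simp)
    have haS : a ∈ S := hN (by simp)
    have hbS : b ∈ S := hN (by simp)
    have hvS : {v} ⊆ S := by simpa using hv
    have hE := E2_sdiff (G := G) hvS
    rw [E2_single, Finset.sum_singleton] at hE
    have hc' : (S \ {v}).card = 10 := by rw [Finset.card_sdiff_of_subset hvS, hc]; simp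
    have hr := reg10 hG hc' (by omega)
    have ha' : a ∈ S \ {v} := by simp [haS, hva.ne']
    have hb' : b ∈ S \ {v} := by simp [hbS, hvb.ne']
    have hs : ∑ u ∈ (S \ {v}).filter (G.Adj a), d G (S \ {v}) u = 9 := by
      rw [sum_const_eq (k := 3) fun u hu => hr u (Finset.mem_filter.1 hu).1]
      have : ((S \ {v}).filter (G.Adj a)).card = 3 := hr a ha'
      omega
    obtain ⟨u, hu, h5, h6⟩ := ball_full hG ha' (by omega) hb' hab.symm
      (fun h => hG.no3 v a b hva h hvb.symm)
    rw [Finset.mem_sdiff, Finset.mem_singleton] at hu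
    exact hG.no4 v a u b hva h5 h6 hvb.symm (Ne.symm hu.2) hab

theorem b12 (hG : Good G) : Bd G 12 18 := by
  intro S hc
  obtain ⟨e, he, h1, h2⟩ := setup (b11 hG) hc (by omega)
  by_contra hcon
  obtain ⟨v, hv, hd⟩ := ex_big (G := G) (k := 3) hc (by omega)
  have := ball_le hG hv 3 (fun u hu => by have := h2 u hu; omega)
  omega
theorem b13 (hG : Good G) : Bd G 13 21 := Bd_step (b12 hG) (by omega) (by omega)

theorem b14 (hG : Good G) : Bd G 14 23 := by
  intro S hc
  obtain ⟨e, he, h1, h2⟩ := setup (b13 hG) hc (by omega)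
  by_contra hcon
  have h3 : ∀ v ∈ S, 3 ≤ d G S v := fun u hu => by have := h2 u hu; omega
  have h4 : ∀ v ∈ S, d G S v ≤ 4 := fun u hu => by have := ball_le hG hu 3 h3; omega
  obtain ⟨c1, c2⟩ := three_deg (G := G) (S := S) 3 (fun v hv => ⟨h3 v hv, by have := h4 v hv; omega⟩)
  set T := S.filter (fun v => d G S v = 3) with hT
  have hTS : T ⊆ S := Finset.filter_subset _ _
  have mT : ∀ v, v ∈ T ↔ v ∈ S ∧ d G S v = 3 := fun v => by rw [hT, Finset.mem_filter]
  have z5 : (S.filter (fun v => d G S v = 3+2)).card = 0 := by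
    rw [Finset.card_eq_zero, Finset.filter_eq_empty_iff]; intro v hv; have := h4 v hv; omega
  have hind : ∀ u ∈ T, ∀ v ∈ T, ¬ G.Adj u v := by
    intro u hu v hv huv
    rw [mT] at hu hv
    have := del2 (b12 hG) hu.1 hv.1 huv hc
    omega
  have hA : (S \ T).card = 6 := by rw [Finset.card_sdiff_of_subset hTS]; omega
  have hdA : ∀ v ∈ T, d G (S \ T) v = 3 := by
    intro v hv
    have := d_split (G := G) hTS v
    have := d_zero (hind v hv)
    have := ((mT v).1 hv).2
    omega
  have hp := pairs hG (S \ T) T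
  rw [sum_const_eq (k := 6) (fun v hv => by rw [hdA v hv]), hA] at hp
  omega
theorem b15 (hG : Good G) : Bd G 15 26 := Bd_step (b14 hG) (by omega) (by omega)

theorem b16 (hG : Good G) : Bd G 16 28 := by
  intro S hc
  obtain ⟨e, he, h1, h2⟩ := setup (b15 hG) hc (by omega)
  by_contra hcon
  have h3 : ∀ v ∈ S, 3 ≤ d G S v := fun u hu => by have := h2 u hu; omega
  have h4 : ∀ v ∈ S, d G S v ≤ 5 := fun u hu => by have := ball_le hG hu 3 h3; omega
  obtain ⟨c1, c2⟩ := three_deg (G := G) (S := S) 3 (fun v hv => ⟨h3 v hv, by have := h4 v hv; omega⟩)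
  set T := S.filter (fun v => d G S v = 3) with hT
  set F4 := S.filter (fun v => d G S v = 3 + 1) with hF4
  set F5 := S.filter (fun v => d G S v = 3 + 2) with hF5
  have hTS : T ⊆ S := Finset.filter_subset _ _
  have mT : ∀ v, v ∈ T ↔ v ∈ S ∧ d G S v = 3 := fun v => by rw [hT, Finset.mem_filter]
  have m4 : ∀ v, v ∈ F4 ↔ v ∈ S ∧ d G S v = 4 := fun v => by rw [hF4, Finset.mem_filter]
  have m5 : ∀ v, v ∈ F5 ↔ v ∈ S ∧ d G S v = 5 := fun v => by rw [hF5, Finset.mem_filter]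
  have h45 : Disjoint F4 F5 := by
    rw [Finset.disjoint_left]; intro v hv hv'; rw [m4] at hv; rw [m5] at hv'; omega
  have hST : S \ T = F4 ∪ F5 := by
    ext v
    simp only [Finset.mem_sdiff, Finset.mem_union, mT, m4, m5]
    constructor
    · rintro ⟨hv, hn⟩
      have := h3 v hv; have := h4 v hv
      have : d G S v ≠ 3 := fun h => hn ⟨hv, h⟩
      have : d G S v = 4 ∨ d G S v = 5 := by omega
      tauto
    · rintro (⟨hv, h⟩ | ⟨hv, h⟩)
      · exact ⟨hv, fun h' => by omega⟩
      · exact ⟨hv, fun h' => by omega⟩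
  have hind : ∀ u ∈ T, ∀ v ∈ T, ¬ G.Adj u v := by
    intro u hu v hv huv
    rw [mT] at hu hv
    have := del2 (b14 hG) hu.1 hv.1 huv hc
    omega
  have hbl : ∀ v ∈ S, 1 + 3 * d G S v + d G (S \ T) v ≤ 16 := by
    intro v hv
    rw [← hc]
    exact ball_le2 hG hv 3 hTS h3 (fun u hu hn => by
      have := h3 u hu
      have : d G S u ≠ 3 := fun h => hn ((mT u).2 ⟨hu, h⟩)
      omega)
  have hspl := fun v => d_split (G := G) hTS v
  have hle2 : ∀ v ∈ F4, d G T v ≤ 2 := by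
    intro v hv
    by_contra hcon
    obtain ⟨N, hN, hNc, hadj⟩ := pickN (by omega : 3 ≤ d G T v)
    have := del_star (b12 hG) ((m4 v).1 hv).1 (hN.trans hTS) hadj (by omega)
    rw [sum_const_eq (k := 3) (fun u hu => ((mT u).1 (hN hu)).2), hNc, ((m4 v).1 hv).2] at this
    omega
  have hTd : ∀ v ∈ T, d G (S \ T) v = 3 := by
    intro v hv
    have := hspl v
    have := d_zero (hind v hv)
    have := ((mT v).1 hv).2
    omega
  have hcount : T.card * 3 = ∑ v ∈ F4, d G T v + ∑ v ∈ F5, d G T v := by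
    rw [← sum_const_eq hTd, dsum_comm, hST, Finset.sum_union h45]
  have s4 : ∑ v ∈ F4, d G T v ≤ F4.card * 2 := sum_const_le hle2
  have s5 : ∑ v ∈ F5, d G T v ≤ F5.card * 5 := sum_const_le fun v hv => by
    have := hspl v; have := ((m5 v).1 hv).2; omega
  have ha5 : F5.card ≤ 1 := by omega
  rcases Nat.lt_or_ge F5.card 1 with h0 | h0
  · -- six threes and ten fours
    have hF5e : F5 = ∅ := Finset.card_eq_zero.1 (by omega)
    rw [hF5e, Finset.union_empty] at hST
    have hge1 : ∀ v ∈ F4, 1 ≤ d G T v := by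
      intro v hv
      have := hbl v ((m4 v).1 hv).1
      have := hspl v; have := ((m4 v).1 hv).2; omega
    have k1 := cls F4 (d G T) (fun i => i) 3 (fun v hv => by have := hle2 v hv; omega)
    have k2 := clsc F4 (d G T) 3 (fun v hv => by have := hle2 v hv; omega)
    simp only [Finset.sum_range_succ, Finset.sum_range_zero] at k1 k2
    have z0 : (F4.filter (fun v => d G T v = 0)).card = 0 := by
      rw [Finset.card_eq_zero, Finset.filter_eq_empty_iff]; intro v hv; have := hge1 v hv; omega
    rw [hF5e] at hcount
    simp only [Finset.sum_empty] at hcount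
    have hPQu : F4.filter (fun v => d G T v = 1) ∪ F4.filter (fun v => d G T v = 2) = S \ T := by
      rw [hST]; ext v
      simp only [Finset.mem_union, Finset.mem_filter]
      constructor
      · rintro (h | h) <;> exact h.1
      · intro hv; have := hge1 v hv; have := hle2 v hv
        have : d G T v = 1 ∨ d G T v = 2 := by omega
        tauto
    have hsub4 : Disjoint T F4 := by
      rw [Finset.disjoint_left]; intro v hv hv'; rw [mT] at hv; rw [m4] at hv'; omega
    refine no16 G hG T (F4.filter (fun v => d G T v = 1)) (F4.filter (fun v => d G T v = 2)) (by omega) (by omega) (by omega)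
      (Finset.disjoint_of_subset_right (Finset.filter_subset _ _) hsub4)
      (Finset.disjoint_of_subset_right (Finset.filter_subset _ _) hsub4) ?_ ?_ ?_ ?_
    · rw [Finset.disjoint_left]; intro v hv hv'; simp only [Finset.mem_filter] at hv hv'; omega
    · intro v hv; rw [hPQu]; exact ⟨d_zero (hind v hv), hTd v hv⟩
    · intro v hv; rw [hPQu]
      rw [Finset.mem_filter] at hv
      have := hspl v; have := ((m4 v).1 hv.1).2; omega
    · intro v hv; rw [hPQu]
      rw [Finset.mem_filter] at hv
      have := hspl v; have := ((m4 v).1 hv.1).2; omega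
  · obtain ⟨x, hx⟩ := Finset.card_pos.1 h0
    have hxS := ((m5 x).1 hx).1
    have hx5 := ((m5 x).1 hx).2
    have hdx : d G T x = 5 := by
      have := hbl x hxS
      have := hspl x; omega
    have e1 : ∀ t ∈ T.filter (G.Adj x), 2 ≤ d G F4 t := by
      intro t ht
      have := hTd t (Finset.mem_filter.1 ht).1
      rw [hST, d_union h45] at this
      have := d_le_card (G := G) F5 t
      omega
    have e2 := le_sum_const e1
    rw [dsum_comm] at e2
    have e3 : ∑ w ∈ F4, d G (T.filter (G.Adj x)) w ≤ F4.card * 1 := sum_const_le fun w hw => by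
      refine common hG T ?_
      rintro rfl
      exact Finset.disjoint_left.1 h45 hw hx
    have : (T.filter (G.Adj x)).card = 5 := hdx
    omega

theorem b17 (hG : Good G) : Bd G 17 31 := Bd_step (b16 hG) (by omega) (by omega)
theorem b18 (hG : Good G) : Bd G 18 34 := Bd_step (b17 hG) (by omega) (by omega)
theorem b19 (hG : Good G) : Bd G 19 38 := Bd_step (b18 hG) (by omega) (by omega)
theorem L20 (hG : Good G) {S : Finset V} (hc : S.card = 20) (he : 82 ≤ E2 G S) (h : ∀ v ∈ S, 4 ≤ d G S v) : False := by
  obtain ⟨v, hv, hd⟩ := ex_big (G := G) (k := 4) hc (by omega)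
  have := ball_le hG hv 4 h
  omega
theorem b20 (hG : Good G) : Bd G 20 41 := by
  intro S hc
  obtain ⟨e, he, h1, h2⟩ := setup (b19 hG) hc (by omega)
  by_contra hcon
  exact L20 hG hc (by omega) (fun u hu => by have := h2 u hu; omega)

/-- fours and fives -/
structure FF (G : SimpleGraph V) [DecidableRel G.Adj] (S F : Finset V) : Prop where
  sub : F ⊆ S
  four : ∀ v ∈ F, d G S v = 4
  five : ∀ v ∈ S \ F, d G S v = 5
theorem FF_mk {S : Finset V} (h : ∀ v ∈ S, 4 ≤ d G S v ∧ d G S v ≤ 5) :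
    ∃ F, FF G S F ∧ 4 * F.card + 5 * (S \ F).card = E2 G S ∧ F.card + (S \ F).card = S.card ∧ ∀ v, v ∈ F ↔ v ∈ S ∧ d G S v = 4 := by
  have hs : S.filter (fun v => d G S v = 4) ⊆ S := Finset.filter_subset _ _
  have hff : FF G S (S.filter (fun v => d G S v = 4)) := ⟨hs, fun v hv => (Finset.mem_filter.1 hv).2, fun v hv => by
      rw [Finset.mem_sdiff, Finset.mem_filter] at hv
      have := h v hv.1
      have : d G S v ≠ 4 := fun e => hv.2 ⟨hv.1, e⟩
      omega⟩
  refine ⟨_, hff, ?_, ?_, fun v => Finset.mem_filter⟩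
  · unfold E2
    rw [← Finset.sum_sdiff hs, sum_const_eq hff.four, sum_const_eq hff.five]; ring
  · rw [Finset.card_sdiff_of_subset hs]
    have := Finset.card_le_card hs; omega

theorem b21 (hG : Good G) : Bd G 21 44 := by
  intro S hc
  obtain ⟨e, he, h1, h2⟩ := setup (b20 hG) hc (by omega)
  by_contra hcon
  have h3 : ∀ v ∈ S, 4 ≤ d G S v := fun u hu => by have := h2 u hu; omega
  have h4 : ∀ v ∈ S, d G S v ≤ 5 := fun u hu => by have := ball_le hG hu 4 h3; omega
  obtain ⟨F, hF, c1, c2, mF⟩ := FF_mk fun v hv => ⟨h3 v hv, h4 v hv⟩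
  have z : ∀ v ∈ S \ F, d G (S \ F) v = 0 := by
    intro v hv
    have := ball_le2 hG (Finset.mem_sdiff.1 hv).1 4 hF.sub h3 (fun u hu hn => by
      have := hF.five u (Finset.mem_sdiff.2 ⟨hu, hn⟩); omega)
    have := hF.five v hv
    omega
  have hspl := fun v => d_split (G := G) hF.sub v
  have k1 : ∑ v ∈ S \ F, d G F v = (S \ F).card * 5 := sum_const_eq fun v hv => by
    have := hspl v; have := z v hv; have := hF.five v hv; omega
  have k2 : ∑ v ∈ F, d G S v = E2 G F + ∑ v ∈ F, d G (S \ F) v := by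
    rw [E2, ← Finset.sum_add_distrib]; exact Finset.sum_congr rfl fun v _ => hspl v
  rw [sum_const_eq hF.four, dsum_comm, k1] at k2
  have k3 : E2 G F ≤ F.card * 1 := sum_const_le fun v hv => by
    by_contra hcon
    obtain ⟨N, hN, hNc, hadj⟩ := pickN (by omega : 2 ≤ d G F v)
    have := del_star (b18 hG) (hF.sub hv) (hN.trans hF.sub) hadj (by omega)
    rw [sum_const_eq (k := 4) (fun u hu => hF.four u (hN hu)), hNc, hF.four v hv] at this
    omega
  omega

theorem b22 (hG : Good G) : Bd G 22 47 := by
  intro S hc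
  obtain ⟨e, he, h1, h2⟩ := setup (b21 hG) hc (by omega)
  by_contra hcon
  have h3 : ∀ v ∈ S, 4 ≤ d G S v := fun u hu => by have := h2 u hu; omega
  have h4 : ∀ v ∈ S, d G S v ≤ 5 := fun u hu => by have := ball_le hG hu 4 h3; omega
  obtain ⟨F, hF, c1, c2, mF⟩ := FF_mk fun v hv => ⟨h3 v hv, h4 v hv⟩
  have hspl := fun v => d_split (G := G) hF.sub v
  have q2 : ∀ v ∈ F, d G F v < 3 := by
    intro v hv
    by_contra hcon
    obtain ⟨N, hN, hNc, hadj⟩ := pickN (by omega : 3 ≤ d G F v)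
    have := del_star (b18 hG) (hF.sub hv) (hN.trans hF.sub) hadj (by omega)
    rw [sum_const_eq (k := 4) (fun u hu => hF.four u (hN hu)), hNc, hF.four v hv] at this
    omega
  have hpath : ∀ u ∈ F, d G F u = 2 → ∀ a ∈ F, G.Adj u a → d G F a = 1 := by
    intro u hu hq a ha hua
    by_contra hne
    have ha1 := d_pos (G := G) hu hua.symm
    have ha2 : d G F a = 2 := by have := q2 a ha; omega
    have : ∃ b ∈ F, G.Adj u b ∧ b ≠ a := by
      by_contra hc; push Not at hc
      have : d G F u ≤ 1 := Finset.card_le_one.2 fun x hx y hy => by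
        rw [Finset.mem_filter] at hx hy
        rw [hc x hx.1 hx.2, hc y hy.1 hy.2]
      omega
    obtain ⟨b, hb, hub, hba⟩ := this
    have : ∃ c ∈ F, G.Adj a c ∧ c ≠ u := by
      by_contra hc; push Not at hc
      have : d G F a ≤ 1 := Finset.card_le_one.2 fun x hx y hy => by
        rw [Finset.mem_filter] at hx hy
        rw [hc x hx.1 hx.2, hc y hy.1 hy.2]
      omega
    obtain ⟨c, hcF, hac, hcu⟩ := this
    have hcb : c ≠ b := by rintro rfl; exact hG.no3 u a c hua hac hub.symm
    have n1 : u ∉ ({a} : Finset V) := by simpa using hua.ne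
    have n2 : b ∉ ({u, a} : Finset V) := by simp [hub.ne', hba]
    have n3 : c ∉ ({b, u, a} : Finset V) := by simp [hac.ne', hcu, hcb]
    have i1 := E2_insert_ge (G := G) n1 (by simp) hua
    have i2 := E2_insert_ge (G := G) n2 (u := u) (by simp) hub.symm
    have i3 := E2_insert_ge (G := G) n3 (u := a) (by simp) hac.symm
    have := delT (b18 hG) (S := S) (T := {c, b, u, a}) (by
      intro x hx; simp only [Finset.mem_insert, Finset.mem_singleton] at hx
      rcases hx with rfl | rfl | rfl | rfl <;> exact hF.sub (by assumption)) (by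
      rw [Finset.card_insert_of_notMem n3, Finset.card_insert_of_notMem n2, Finset.card_insert_of_notMem n1]
      simpa using hc)
    rw [Finset.sum_insert n3, Finset.sum_insert n2, Finset.sum_insert n1, Finset.sum_singleton, hF.four _ hu,
      hF.four _ ha, hF.four _ hb, hF.four _ hcF] at this
    omega
  have k0 := clsc F (d G F) 3 q2
  have k1 := cls F (d G F) (fun i => i) 3 q2
  have k2 := cls F (d G F) (fun i => (4 - i) * (4 - i - 1)) 3 q2
  simp only [Finset.sum_range_succ, Finset.sum_range_zero] at k0 k1 k2
  norm_num at k2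
  have hp := pairs hG (S \ F) F
  have e1 : ∑ w ∈ F, d G (S \ F) w * (d G (S \ F) w - 1) = ∑ v ∈ F, (4 - d G F v) * (4 - d G F v - 1) := by
    refine Finset.sum_congr rfl fun v hv => ?_
    have := hspl v; have := hF.four v hv
    have : d G (S \ F) v = 4 - d G F v := by omega
    rw [this]
  have hA : (S \ F).card = 8 := by omega
  rw [e1, k2, hA] at hp
  have k3 : ∑ v ∈ F, d G S v = ∑ v ∈ F, d G F v + ∑ v ∈ F, d G (S \ F) v := by
    rw [← Finset.sum_add_distrib]; exact Finset.sum_congr rfl fun v _ => hspl v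
  have k4 : ∑ v ∈ S \ F, d G S v = ∑ v ∈ S \ F, d G F v + E2 G (S \ F) := by
    rw [E2, ← Finset.sum_add_distrib]; exact Finset.sum_congr rfl fun v _ => hspl v
  rw [sum_const_eq hF.four] at k3
  rw [sum_const_eq hF.five] at k4
  have k5 := dsum_comm (G := G) F (S \ F)
  have k6 : (F.filter (fun v => d G F v = 2)).card * 2 ≤ (F.filter (fun v => d G F v = 1)).card * 1 := by
    have a1 : (F.filter (fun v => d G F v = 2)).card * 2 ≤ ∑ v ∈ F.filter (fun v => d G F v = 2), d G (F.filter (fun v => d G F v = 1)) v := by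
      refine le_sum_const fun v hv => ?_
      rw [Finset.mem_filter] at hv
      rw [← hv.2]
      refine Finset.card_le_card fun x hx => ?_
      simp only [Finset.mem_filter] at hx ⊢
      exact ⟨⟨hx.1, hpath v hv.1 hv.2 x hx.1 hx.2⟩, hx.2⟩
    rw [dsum_comm] at a1
    refine a1.trans (sum_const_le fun v hv => ?_)
    rw [Finset.mem_filter] at hv
    rw [← hv.2]; exact d_mono (Finset.filter_subset _ _) v
  omega
end Gr

namespace Gr
variable {V : Type} [DecidableEq V] {G : SimpleGraph V} [DecidableRel G.Adj]

theorem d_other {S : Finset V} {v : V} (h : 2 ≤ d G S v) (a : V) : ∃ b ∈ S, G.Adj v b ∧ b ≠ a := by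
  by_contra hc; push Not at hc
  have : d G S v ≤ 1 := Finset.card_le_one.2 fun x hx y hy => by
    rw [Finset.mem_filter] at hx hy
    rw [hc x hx.1 hx.2, hc y hy.1 hy.2]
  omega
theorem d_le_one {S : Finset V} {v : V} (h : ∀ x ∈ S, ∀ y ∈ S, G.Adj v x → G.Adj v y → x = y) : d G S v ≤ 1 :=
  Finset.card_le_one.2 fun x hx y hy => by
    rw [Finset.mem_filter] at hx hy
    exact h x hx.1 y hy.1 hx.2 hy.2

/-- connected sets -/
structure Cn (G : SimpleGraph V) [DecidableRel G.Adj] (F T : Finset V) (n : ℕ) : Prop where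
  sub : T ⊆ F
  card : T.card = n
  edge : 2 * n ≤ E2 G T + 2
theorem Cn.one {F : Finset V} {v : V} (h : v ∈ F) : Cn G F {v} 1 :=
  ⟨by simpa using h, by simp, by omega⟩
theorem Cn.ins {F T : Finset V} {n : ℕ} (hc : Cn G F T n) {v u : V} (hv : v ∈ F) (hT : v ∉ T) (hu : u ∈ T) (h : G.Adj v u) :
    Cn G F (insert v T) (n + 1) :=
  ⟨Finset.insert_subset hv hc.sub, by rw [Finset.card_insert_of_notMem hT, hc.card],
    by have := E2_insert_ge hT hu h; have := hc.edge; omega⟩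

theorem core21 (hG : Good G) {H : Finset V} (hc : H.card = 21) (he : 88 ≤ E2 G H) (h3 : ∀ v ∈ H, 4 ≤ d G H v)
    {u : V} (hu : u ∉ H) (hu3 : d G H u = 3) (hu4 : ∀ v ∈ H, G.Adj u v → d G H v = 4) : False := by
  have he2 := b21 hG H hc
  have h4 : ∀ v ∈ H, d G H v ≤ 5 := fun u hu => by have := ball_le hG hu 4 h3; omega
  obtain ⟨F, hF, c1, c2, mF⟩ := FF_mk fun v hv => ⟨h3 v hv, h4 v hv⟩
  have z : ∀ v ∈ H \ F, d G (H \ F) v = 0 := by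
    intro v hv
    have := ball_le2 hG (Finset.mem_sdiff.1 hv).1 4 hF.sub h3 (fun u hu hn => by
      have := hF.five u (Finset.mem_sdiff.2 ⟨hu, hn⟩); omega)
    have := hF.five v hv
    omega
  have hspl := fun v => d_split (G := G) hF.sub v
  have hu0 : d G (H \ F) u = 0 := d_zero fun v hv hav => by
    rw [Finset.mem_sdiff] at hv
    exact hv.2 ((mF v).2 ⟨hv.1, hu4 v hv.1 hav⟩)
  refine no22 G hG u F (H \ F) (by omega) (by omega) (fun h => hu (hF.sub h)) (fun h => hu (Finset.mem_sdiff.1 h).1)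
    Finset.disjoint_sdiff ?_ ?_ ⟨hu0, by have := hspl u; omega⟩ ?_
  · intro v hv
    have := hspl v; have := z v hv; have := hF.five v hv; omega
  · intro v hv
    rw [Finset.union_sdiff_of_subset hF.sub]; exact hF.four v hv
  · intro x hx w hw hne hna
    rw [Finset.union_sdiff_of_subset hF.sub] at hw
    have hxH := (Finset.mem_sdiff.1 hx).1
    obtain ⟨i, hi, h5, h6⟩ := ball_full hG hxH (by
      have := nbr_sum (G := G) (v := x) 4 hF.sub h3 (fun u hu hn => by
        have := hF.five u (Finset.mem_sdiff.2 ⟨hu, hn⟩); omega)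
      have := hF.five x hx; omega) hw hne hna
    refine ⟨i, ?_, h5, h6.symm⟩
    by_contra hiF
    exact d_zero' (z x hx) i (Finset.mem_sdiff.2 ⟨hi, hiF⟩) h5

/-- neighbours of adjacent vertices are nonadjacent -/
theorem na (hG : Good G) {a b x y : V} (hab : G.Adj a b) (hax : G.Adj a x) (hby : G.Adj b y) (h1 : x ≠ b) (h2 : y ≠ a) :
    ¬ G.Adj x y := fun h => hG.no4 a x y b hax h hby.symm hab.symm h2.symm h1

theorem b23_aux (hG : Good G) {S F : Finset V} (hc : S.card = 23) (he : E2 G S = 102) (hF : FF G S F)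
   : (∀ T, Cn G F T 5 → False) ∧
     (∀ u ∈ F, ∀ v ∈ F, G.Adj u v → d G F u = 1 → d G F v = 1 → False) ∧
     (∀ v ∈ F, ∀ a ∈ F, ∀ b ∈ F, G.Adj v a → G.Adj v b → a ≠ b → d G F a = 1 → d G F b = 1 → d G F v = 2 → False) := by
  have hspl := fun v => d_split (G := G) hF.sub v
  refine ⟨?_, ?_, ?_⟩
  · intro T hT
    have := delT (b18 hG) (hT.sub.trans hF.sub) (by rw [hT.card]; exact hc)
    rw [sum_const_eq (k := 4) (fun u hu => hF.four u (hT.sub hu)), hT.card] at this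
    have := hT.edge
    omega
  · intro u hu v hv huv qu qv
    have hTs : ({u, v} : Finset V) ⊆ S := by
      intro x hx; simp only [Finset.mem_insert, Finset.mem_singleton] at hx
      rcases hx with rfl | rfl <;> exact hF.sub (by assumption)
    have hsp2 := fun w => d_split (G := G) hTs w
    have hcd : (S \ {u, v}).card = 21 := by
      rw [Finset.card_sdiff_of_subset hTs, Finset.card_pair huv.ne]; omega
    have hE := E2_sdiff (G := G) hTs
    rw [Finset.sum_pair huv.ne, hF.four u hu, hF.four v hv] at hE
    have := E2_pair huv
    have le1 : ∀ w, d G {u, v} w ≤ 1 := fun w => d_le_one fun x hx y hy hwx hwy => by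
      simp only [Finset.mem_insert, Finset.mem_singleton] at hx hy
      rcases hx with rfl | rfl <;> rcases hy with rfl | rfl
      · rfl
      · exact (hG.no3 _ _ _ hwx huv hwy.symm).elim
      · exact (hG.no3 _ _ _ hwx huv.symm hwy.symm).elim
      · rfl
    have hfive : ∀ w ∈ S, w ∉ F → d G S w = 5 := fun w h1 h2 => hF.five w (Finset.mem_sdiff.2 ⟨h1, h2⟩)
    refine core21 hG (u := u) hcd (by omega) ?_ (by simp) ?_ ?_
    · intro w hw
      have h1 := hsp2 w
      have h2 := le1 w
      rw [Finset.mem_sdiff] at hw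
      by_cases hwF : w ∈ F
      · have h4 := hF.four w hwF
        have : d G {u, v} w = 0 := d_zero fun x hx hwx => by
          have hw2 := hw.2
          simp only [Finset.mem_insert, Finset.mem_singleton, not_or] at hx hw2
          rcases hx with rfl | rfl
          · exact hw2.2 (d_one hv huv (by omega) w hwF hwx.symm)
          · exact hw2.1 (d_one hu huv.symm (by omega) w hwF hwx.symm)
        omega
      · have := hfive w hw.1 hwF; omega
    · have h1 := hsp2 u
      have h2 := le1 u
      have h3 : 1 ≤ d G {u, v} u := d_pos (u := v) (by simp) huv
      have := hF.four u hu; omega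
    · intro w hw huw
      have h1 := hsp2 w
      have h2 := le1 w
      have h3 : 1 ≤ d G {u, v} w := d_pos (u := u) (by simp) huw.symm
      rw [Finset.mem_sdiff] at hw
      have hwF : w ∉ F := fun hwF => hw.2 (by simp [d_one hv huv (by omega) w hwF huw])
      have := hfive w hw.1 hwF; omega
  · intro v hv a ha b hb hva hvb hab qa qb qv
    have hav := hva.ne'
    have hTs : ({a, b, v} : Finset V) ⊆ F := by
      intro x hx; simp only [Finset.mem_insert, Finset.mem_singleton] at hx
      rcases hx with rfl | rfl | rfl <;> assumption
    have hsp2 := fun w => d_split (G := G) (hTs.trans hF.sub) w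
    have hC := ((Cn.one (G := G) hv).ins hb (by simpa using hvb.ne') (by simp) hvb.symm).ins ha
      (by simp [hav, hab]) (u := v) (by simp) hva.symm
    have hE := E2_sdiff (G := G) (hTs.trans hF.sub)
    rw [sum_const_eq (k := 4) (fun u hu => hF.four u (hTs hu)), hC.card] at hE
    have := hC.edge
    refine L20 hG (S := S \ {a, b, v}) (by
      rw [Finset.card_sdiff_of_subset (hTs.trans hF.sub), hC.card]; omega) (by omega) ?_
    intro w hw
    have h1 := hsp2 w
    rw [Finset.mem_sdiff] at hw
    have hw2 := hw.2
    simp only [Finset.mem_insert, Finset.mem_singleton, not_or] at hw2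
    by_cases hwF : w ∈ F
    · have h4 := hF.four w hwF
      have : d G {a, b, v} w = 0 := d_zero fun x hx hwx => by
        simp only [Finset.mem_insert, Finset.mem_singleton] at hx
        rcases hx with rfl | rfl | rfl
        · exact hw2.2.2 (d_one hv hva.symm (by omega) w hwF hwx.symm)
        · exact hw2.2.2 (d_one hv hvb.symm (by omega) w hwF hwx.symm)
        · have : ({a, b, w} : Finset V) ⊆ F.filter (G.Adj x) := by
            intro y hy; simp only [Finset.mem_insert, Finset.mem_singleton] at hy
            rw [Finset.mem_filter]
            rcases hy with rfl | rfl | rfl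
            · exact ⟨ha, hva⟩
            · exact ⟨hb, hvb⟩
            · exact ⟨hwF, hwx.symm⟩
          have := Finset.card_le_card this
          rw [Finset.card_insert_of_notMem (by simp [hab, Ne.symm hw2.1]), Finset.card_pair (Ne.symm hw2.2.1)] at this
          unfold d at qv; omega
      omega
    · have := hF.five w (Finset.mem_sdiff.2 ⟨hw.1, hwF⟩)
      have : d G {a, b, v} w ≤ 1 := d_le_one fun x hx y hy hwx hwy => by
        have e1 := fun h => hG.no3 w a v h hva.symm
        have e2 := fun h => hG.no3 w b v h hvb.symm
        have e3 := fun h h' => hG.no4 w a v b h hva.symm hvb h' hw2.2.2 hab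
        simp only [Finset.mem_insert, Finset.mem_singleton] at hx hy
        rcases hx with rfl | rfl | rfl <;> rcases hy with rfl | rfl | rfl <;>
          first
          | rfl
          | exact (e1 hwx hwy.symm).elim
          | exact (e1 hwy hwx.symm).elim
          | exact (e2 hwx hwy.symm).elim
          | exact (e2 hwy hwx.symm).elim
          | exact (e3 hwx hwy.symm).elim
          | exact (e3 hwy hwx.symm).elim
      omega
end Gr

namespace Gr
variable {V : Type} [DecidableEq V] {G : SimpleGraph V} [DecidableRel G.Adj]

/-- structure of fours in a putative (23,51) graph -/
theorem b23_q (hG : Good G) {S F : Finset V} (hc : S.card = 23) (he : E2 G S = 102) (hF : FF G S F) :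
    (∀ v ∈ F, d G F v < 4) ∧ (∀ v ∈ F, ∀ a ∈ F, G.Adj v a → d G F v = 1 → 2 ≤ d G F a) ∧
    (∀ v ∈ F, ∀ a ∈ F, G.Adj v a → d G F v = 3 → d G F a = 1) ∧
    (∀ v ∈ F, d G F v = 2 → ∃ a ∈ F, ∃ b ∈ F, G.Adj v a ∧ G.Adj v b ∧ a ≠ b ∧ d G F a = 1 ∧ d G F b = 2) := by
  obtain ⟨h5, h2, h3⟩ := b23_aux hG hc he hF
  have q4 : ∀ v ∈ F, d G F v < 4 := by
    intro v hv
    by_contra hcon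
    obtain ⟨N, hN, hNc, hadj⟩ := pickN (by omega : 4 ≤ d G F v)
    have := del_star (b18 hG) (hF.sub hv) (hN.trans hF.sub) hadj (by omega)
    rw [sum_const_eq (k := 4) (fun u hu => hF.four u (hN hu)), hNc, hF.four v hv] at this
    omega
  have q3 : ∀ v ∈ F, ∀ a ∈ F, G.Adj v a → d G F v = 3 → d G F a = 1 := by
    intro v hv a ha hva hq
    by_contra hne
    have ha1 := d_pos (G := G) hv hva.symm
    obtain ⟨b, hb, hab, hbv⟩ := d_other (by omega : 2 ≤ d G F a) v
    have : ∃ c ∈ F, ∃ e ∈ F, G.Adj v c ∧ G.Adj v e ∧ c ≠ e ∧ c ≠ a ∧ e ≠ a := by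
      have h : ((F.filter (G.Adj v)).erase a).card = 2 := by
        rw [Finset.card_erase_of_mem (Finset.mem_filter.2 ⟨ha, hva⟩)]; unfold d at hq; omega
      obtain ⟨c, e, hce, hs⟩ := Finset.card_eq_two.1 h
      have hcc : c ∈ (F.filter (G.Adj v)).erase a := by rw [hs]; simp
      have hee : e ∈ (F.filter (G.Adj v)).erase a := by rw [hs]; simp
      rw [Finset.mem_erase, Finset.mem_filter] at hcc hee
      exact ⟨c, hcc.2.1, e, hee.2.1, hcc.2.2, hee.2.2, hce, hcc.1, hee.1⟩
    obtain ⟨c, hcF, e, heF, hvc, hve, hce, hca, hea⟩ := this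
    have hcb : b ≠ c := by rintro rfl; exact hG.no3 v a b hva hab hvc.symm
    have heb : b ≠ e := by rintro rfl; exact hG.no3 v a b hva hab hve.symm
    exact h5 _ (((((Cn.one (G := G) hv).ins ha (by simpa using hva.ne') (u := v) (by simp) hva.symm).ins hcF
      (by simp [hca, hvc.ne']) (u := v) (by simp) hvc.symm).ins heF
      (by simp [hea, hve.ne', hce.symm]) (u := v) (by simp) hve.symm).ins hb
      (by simp [hcb, heb, hbv, hab.ne']) (u := a) (by simp) hab.symm)
  refine ⟨q4, ?_, q3, ?_⟩
  · intro v hv a ha hva hq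
    have ha1 := d_pos (G := G) hv hva.symm
    by_contra hne
    exact h2 v hv a ha hva hq (by omega)
  · intro v hv hq
    obtain ⟨a, ha, hva⟩ := d_ex (by omega : 1 ≤ d G F v)
    obtain ⟨b, hb, hvb, hba⟩ := d_other (by omega : 2 ≤ d G F v) a
    have ha1 := d_pos (G := G) hv hva.symm
    have hb1 := d_pos (G := G) hv hvb.symm
    have ha3 : d G F a ≠ 3 := fun e => by have := q3 a ha v hv hva.symm e; omega
    have hb3 : d G F b ≠ 3 := fun e => by have := q3 b hb v hv hvb.symm e; omega
    have := q4 a ha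
    have := q4 b hb
    by_cases e1 : d G F a = 1
    · by_cases e2 : d G F b = 1
      · exact (h3 v hv a ha b hb hva hvb hba.symm e1 e2 hq).elim
      · exact ⟨a, ha, b, hb, hva, hvb, hba.symm, e1, by omega⟩
    · by_cases e2 : d G F b = 1
      · exact ⟨b, hb, a, ha, hvb, hva, hba, e2, by omega⟩
      · exfalso
        obtain ⟨x, hx, hax, hxv⟩ := d_other (by omega : 2 ≤ d G F a) v
        obtain ⟨y, hy, hby, hyv⟩ := d_other (by omega : 2 ≤ d G F b) v
        have hxb : x ≠ b := by rintro rfl; exact hG.no3 v a x hva hax hvb.symm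
        have hya : y ≠ a := by rintro rfl; exact hG.no3 v b y hvb hby hva.symm
        have hxy : x ≠ y := by
          rintro rfl; exact hG.no4 v a x b hva hax hby.symm hvb.symm hxv.symm hba.symm
        exact h5 _ (((((Cn.one (G := G) hv).ins ha (by simpa using hva.ne') (u := v) (by simp) hva.symm).ins hb
          (by simp [hba, hvb.ne']) (u := v) (by simp) hvb.symm).ins hx
          (by simp [hxb, hax.ne', hxv]) (u := a) (by simp) hax.symm).ins hy
          (by simp [hxy.symm, hby.ne', hya, hyv]) (u := b) (by simp) hby.symm)

/-- sum of m(m-1) -/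
theorem mm_sum (A : Finset V) (f : V → ℕ) : 2 * ∑ v ∈ A, f v ≤ ∑ v ∈ A, f v * (f v - 1) + A.card * 2 := by
  rw [Finset.mul_sum, ← smul_eq_mul, ← Finset.sum_const, ← Finset.sum_add_distrib]
  refine Finset.sum_le_sum fun v _ => ?_
  generalize f v = x
  cases x with
  | zero => simp
  | succ x => simp only [Nat.add_sub_cancel]; nlinarith [sq_nonneg ((x:ℤ) - 1), Nat.le_mul_self x]

theorem b23 (hG : Good G) : Bd G 23 50 := by
  intro S hc
  obtain ⟨e, he, h1, h2⟩ := setup (b22 hG) hc (by omega)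
  by_contra hcon
  have he' : E2 G S = 102 := by omega
  have h3 : ∀ v ∈ S, 4 ≤ d G S v := fun u hu => by have := h2 u hu; omega
  have h4 : ∀ v ∈ S, d G S v ≤ 5 := fun u hu => by have := ball_le hG hu 4 h3; omega
  obtain ⟨F, hF, c1, c2, mF⟩ := FF_mk fun v hv => ⟨h3 v hv, h4 v hv⟩
  have hspl := fun v => d_split (G := G) hF.sub v
  obtain ⟨q4, q1, q3, q2⟩ := b23_q hG hc he' hF
  have k0 := clsc F (d G F) 4 q4
  have k1 := cls F (d G F) (fun i => i) 4 q4
  have k2 := cls F (d G F) (fun i => (4 - i) * (4 - i - 1)) 4 q4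
  simp only [Finset.sum_range_succ, Finset.sum_range_zero] at k0 k1 k2
  norm_num at k2
  set A := S \ F with hAdef
  have hp := pairs hG A S
  have e1 : ∑ w ∈ F, d G A w * (d G A w - 1) = ∑ v ∈ F, (4 - d G F v) * (4 - d G F v - 1) := by
    refine Finset.sum_congr rfl fun v hv => ?_
    have := hspl v; have := hF.four v hv
    have : d G A v = 4 - d G F v := by omega
    rw [this]
  have hA : A.card = 10 := by omega
  rw [← Finset.sum_sdiff hF.sub, ← hAdef, e1, k2, hA] at hp
  have k3 : ∑ v ∈ F, d G S v = ∑ v ∈ F, d G F v + ∑ v ∈ F, d G A v := by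
    rw [← Finset.sum_add_distrib]; exact Finset.sum_congr rfl fun v _ => hspl v
  have k4 : ∑ v ∈ A, d G S v = ∑ v ∈ A, d G F v + E2 G A := by
    rw [E2, ← Finset.sum_add_distrib]; exact Finset.sum_congr rfl fun v _ => hspl v
  rw [sum_const_eq hF.four] at k3
  rw [sum_const_eq (A := A) hF.five] at k4
  have k5 := dsum_comm (G := G) F A
  set F1 := F.filter (fun v => d G F v = 1) with hF1
  set F2 := F.filter (fun v => d G F v = 2) with hF2
  set F3 := F.filter (fun v => d G F v = 3) with hF3
  have k6 : F1.card * 1 = F2.card * 1 + F3.card * 3 := by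
    have d23 : Disjoint F2 F3 := Finset.disjoint_filter.2 fun v _ h h' => by omega
    have a1 : ∑ v ∈ F1, d G (F2 ∪ F3) v = F1.card * 1 := sum_const_eq fun v hv => by
      rw [hF1, Finset.mem_filter] at hv
      rw [← hv.2]
      unfold d
      congr 1
      ext x
      simp only [Finset.mem_filter, Finset.mem_union, hF2, hF3]
      constructor
      · tauto
      · rintro ⟨hx, hvx⟩
        have := q1 v hv.1 x hx hvx hv.2
        have := q4 x hx
        have : d G F x = 2 ∨ d G F x = 3 := by omega
        tauto
    rw [dsum_comm, Finset.sum_union d23] at a1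
    rw [← a1]
    congr 1
    · refine sum_const_eq fun v hv => ?_
      rw [hF2, Finset.mem_filter] at hv
      obtain ⟨a, ha, b, hb, hva, hvb, hab, ea, eb⟩ := q2 v hv.1 hv.2
      have l1 : 1 ≤ d G F1 v := d_pos (Finset.mem_filter.2 ⟨ha, ea⟩) hva
      have l2 := d_split (G := G) (T := F1) (S := F) (Finset.filter_subset _ _) v
      have l3 : 1 ≤ d G (F \ F1) v := d_pos (u := b) (by simp [hF1, hb, eb]) hvb
      omega
    · refine sum_const_eq fun v hv => ?_
      rw [hF3, Finset.mem_filter] at hv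
      rw [← hv.2]
      unfold d
      congr 1
      ext x
      simp only [Finset.mem_filter, hF1]
      constructor
      · tauto
      · rintro ⟨hx, hvx⟩
        exact ⟨⟨hx, q3 v hv.1 x hx hvx hv.2⟩, hvx⟩
  have k7 := mm_sum A (d G A)
  have k8 : E2 G A = ∑ v ∈ A, d G A v := rfl
  have hE : E2 G A = 16 ∧ 2 * F3.card + ∑ v ∈ A, d G A v * (d G A v - 1) ≤ 14 ∧ F2.card + 2 * F3.card = 6 := by omega
  clear k7 hp k0 k1 k2 k3 k4 k5 k6 c1 c2
  have mA : ∀ v, v ∈ A ↔ v ∈ S ∧ v ∉ F := fun v => Finset.mem_sdiff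
  have nAF : ∀ x ∈ A, ∀ y ∈ F, x ≠ y := fun x hx y hy e => ((mA x).1 hx).2 (e ▸ hy)
  have dA : ∀ v ∈ F, d G A v = 4 - d G F v := fun v hv => by
    have := hspl v; have := hF.four v hv; omega
  by_cases h30 : 1 ≤ F3.card
  · obtain ⟨c, hc3⟩ := Finset.card_pos.1 h30
    rw [hF3, Finset.mem_filter] at hc3
    obtain ⟨z, hz, hcz⟩ := d_ex (by have := dA c hc3.1; omega : 1 ≤ d G A c)
    have hz0 : ∀ y ∈ A, ¬ G.Adj z y := by
      intro y hy hzy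
      -- the neighbourhoods cover
      have hcov : A ⊆ insert z ((F.filter (G.Adj c)).biUnion fun l => A.filter (G.Adj l)) := by
        refine (Finset.eq_of_subset_of_card_le ?_ ?_).ge
        · intro t ht
          simp only [Finset.mem_insert, Finset.mem_biUnion, Finset.mem_filter] at ht
          rcases ht with rfl | ⟨l, _, ht, _⟩ <;> assumption
        · rw [Finset.card_insert_of_notMem, Finset.card_biUnion, sum_const_eq (k := 3), hA]
          · unfold d at hc3; omega
          · intro l hl
            rw [Finset.mem_filter] at hl
            have := dA l hl.1
            have := q3 c hc3.1 l hl.1 hl.2 hc3.2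
            unfold d at *; omega
          · intro l hl l' hl' hne
            rw [Finset.mem_coe, Finset.mem_filter] at hl hl'
            rw [Function.onFun, Finset.disjoint_left]
            intro t ht ht'
            rw [Finset.mem_filter] at ht ht'
            exact hG.no4 c l t l' hl.2 ht.2 ht'.2.symm hl'.2.symm (nAF t ht.1 c hc3.1).symm hne
          · simp only [Finset.mem_biUnion, Finset.mem_filter]
            rintro ⟨l, hl, _, hlz⟩
            exact hG.no3 c l z hl.2 hlz hcz.symm
      have := hcov hy
      simp only [Finset.mem_insert, Finset.mem_biUnion, Finset.mem_filter] at this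
      rcases this with rfl | ⟨l, hl, _, hly⟩
      · exact G.loopless.irrefl _ hzy
      · exact na hG hl.2 hcz hly (nAF z hz l hl.1) (nAF y hy c hc3.1) hzy
    have hz1 := d_zero hz0
    have k7 := mm_sum (A.erase z) (d G A)
    have s1 := Finset.add_sum_erase A (d G A) hz
    have s2 := Finset.add_sum_erase A (fun v => d G A v * (d G A v - 1)) hz
    simp only [hz1] at s1 s2
    rw [Finset.card_erase_of_mem hz] at k7
    omega
  · obtain ⟨b, hb2⟩ := Finset.card_pos.1 (by omega : 0 < F2.card)
    rw [hF2, Finset.mem_filter] at hb2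
    obtain ⟨a, ha, c, hcF, hba, hbc, hac, qa, qc⟩ := q2 b hb2.1 hb2.2
    obtain ⟨x, hx, y, hy, hcx, hcy, hxy, qx, qy⟩ := q2 c hcF qc
    have hxb : x ≠ b := by rintro rfl; omega
    have hxa : x ≠ a := by rintro rfl; exact hG.no3 b x c hba hcx.symm hbc.symm
    have hb := hb2.1
    set A1 := A.filter (G.Adj a)
    set B1 := A.filter (G.Adj b)
    set C1 := A.filter (G.Adj c)
    set D1 := A.filter (G.Adj x)
    have cA : A1.card = 3 := (dA a ha).trans (by omega)
    have cB : B1.card = 2 := (dA b hb).trans (by omega)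
    have cC : C1.card = 2 := (dA c hcF).trans (by omega)
    have cD : D1.card = 3 := (dA x hx).trans (by omega)
    have dj3 : ∀ p ∈ F, ∀ q ∈ F, G.Adj p q → Disjoint (A.filter (G.Adj p)) (A.filter (G.Adj q)) := by
      intro p hp q hq hpq
      rw [Finset.disjoint_left]
      intro t ht ht'
      rw [Finset.mem_filter] at ht ht'
      exact hG.no3 p t q ht.2 ht'.2.symm hpq.symm
    have dj4 : ∀ p ∈ F, ∀ q ∈ F, ∀ r ∈ F, G.Adj r p → G.Adj r q → p ≠ q → Disjoint (A.filter (G.Adj p)) (A.filter (G.Adj q)) := by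
      intro p hp q hq r hr hrp hrq hpq
      rw [Finset.disjoint_left]
      intro t ht ht'
      rw [Finset.mem_filter] at ht ht'
      exact hG.no4 r p t q hrp ht.2 ht'.2.symm hrq.symm (nAF t ht.1 r hr).symm hpq
    have dAB : Disjoint A1 B1 := dj3 a ha b hb hba.symm
    have dBC : Disjoint B1 C1 := dj3 b hb c hcF hbc
    have dCD : Disjoint C1 D1 := dj3 c hcF x hx hcx
    have dAC : Disjoint A1 C1 := dj4 a ha c hcF b hb hba hbc hac
    have dBD : Disjoint B1 D1 := dj4 b hb x hx c hcF hbc.symm hcx hxb.symm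
    have dAD : Disjoint A1 D1 := by
      rw [Finset.disjoint_left]
      intro t ht ht'
      rw [Finset.mem_filter] at ht ht'
      have hC := ((((Cn.one (G := G) hb).ins ha (by simpa using hba.ne') (u := b) (by simp) hba.symm).ins hcF
        (by simp [hac.symm, hbc.ne']) (u := b) (by simp) hbc.symm).ins hx
        (by simp [hxb, hxa, hcx.ne']) (u := c) (by simp) hcx.symm)
      have htn : t ∉ ({x, c, a, b} : Finset V) := by
        have := nAF t ht.1
        simp [this x hx, this c hcF, this a ha, this b hb]
      have := delT (b18 hG) (S := S) (T := insert t {x, c, a, b}) (Finset.insert_subset ((mA t).1 ht.1).1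
        (hC.sub.trans hF.sub)) (by rw [Finset.card_insert_of_notMem htn, hC.card]; exact hc)
      rw [Finset.sum_insert htn, sum_const_eq (k := 4) (fun u hu => hF.four u (hC.sub hu)), hC.card, E2_insert htn,
        hF.five t ht.1] at this
      have h2 : 2 ≤ d G {x, c, a, b} t := d_two (u := a) (w := x) (by simp) ht.2.symm (by simp) ht'.2.symm hxa.symm
      have := hC.edge
      omega
    have hU : (A1 ∪ B1) ∪ (C1 ∪ D1) = A := by
      have dd : Disjoint (A1 ∪ B1) (C1 ∪ D1) := by
        rw [Finset.disjoint_union_left, Finset.disjoint_union_right, Finset.disjoint_union_right]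
        exact ⟨⟨dAC, dAD⟩, dBC, dBD⟩
      refine Finset.eq_of_subset_of_card_le ?_ ?_
      · intro t ht
        simp only [Finset.mem_union] at ht
        rcases ht with (ht | ht) | ht | ht <;> exact (Finset.mem_filter.1 ht).1
      · rw [Finset.card_union_of_disjoint dd, Finset.card_union_of_disjoint dAB, Finset.card_union_of_disjoint dCD]
        omega
    have dd : Disjoint (A1 ∪ B1) (C1 ∪ D1) := by
      rw [Finset.disjoint_union_left, Finset.disjoint_union_right, Finset.disjoint_union_right]
      exact ⟨⟨dAC, dAD⟩, dBC, dBD⟩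
    have dU : ∀ v, d G A v = d G A1 v + d G B1 v + (d G C1 v + d G D1 v) := fun v => by
      rw [← hU, d_union dd, d_union dAB, d_union dCD]
    have z0 : ∀ p ∈ F, ∀ t ∈ A.filter (G.Adj p), d G (A.filter (G.Adj p)) t = 0 := by
      intro p hp t ht
      refine d_zero fun s hs hts => ?_
      rw [Finset.mem_filter] at ht hs
      exact hG.no3 p t s ht.2 hts hs.2.symm
    have z1 : ∀ p ∈ F, ∀ q ∈ F, G.Adj p q → ∀ t ∈ A.filter (G.Adj p), d G (A.filter (G.Adj q)) t = 0 := by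
      intro p hp q hq hpq t ht
      refine d_zero fun s hs => ?_
      rw [Finset.mem_filter] at ht hs
      exact na hG hpq ht.2 hs.2 (nAF t ht.1 q hq) (nAF s hs.1 p hp)
    have z2 : ∀ p ∈ F, ∀ t ∈ A, d G (A.filter (G.Adj p)) t ≤ 1 := fun p hp t ht => common hG A (nAF t ht p hp).symm
    have t1 : ∑ v ∈ A1, d G A v = ∑ v ∈ A1, d G C1 v + ∑ v ∈ A1, d G D1 v := by
      rw [← Finset.sum_add_distrib]
      refine Finset.sum_congr rfl fun v hv => ?_
      rw [dU, z0 a ha v hv, z1 a ha b hb hba.symm v hv]; ring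
    have t2 : ∑ v ∈ B1, d G A v = ∑ v ∈ B1, d G D1 v := by
      refine Finset.sum_congr rfl fun v hv => ?_
      rw [dU, z0 b hb v hv, z1 b hb a ha hba v hv, z1 b hb c hcF hbc v hv]; ring
    have t3 : ∑ v ∈ C1, d G A v = ∑ v ∈ C1, d G A1 v := by
      refine Finset.sum_congr rfl fun v hv => ?_
      rw [dU, z0 c hcF v hv, z1 c hcF b hb hbc.symm v hv, z1 c hcF x hx hcx v hv]; ring
    have t4 : ∑ v ∈ D1, d G A v = ∑ v ∈ D1, d G A1 v + ∑ v ∈ D1, d G B1 v := by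
      rw [← Finset.sum_add_distrib]
      refine Finset.sum_congr rfl fun v hv => ?_
      rw [dU, z0 x hx v hv, z1 x hx c hcF hcx.symm v hv]; ring
    have tt : E2 G A = (∑ v ∈ A1, d G A v + ∑ v ∈ B1, d G A v) + (∑ v ∈ C1, d G A v + ∑ v ∈ D1, d G A v) := by
      rw [← Finset.sum_union dAB, ← Finset.sum_union dCD, ← Finset.sum_union dd, hU]; rfl
    have sA : ∀ p, A.filter (G.Adj p) ⊆ A := fun p => Finset.filter_subset _ _
    have u1 : ∑ v ∈ C1, d G A1 v ≤ C1.card * 1 := sum_const_le fun v hv => z2 a ha v (sA _ hv)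
    have u2 : ∑ v ∈ D1, d G A1 v ≤ D1.card * 1 := sum_const_le fun v hv => z2 a ha v (sA _ hv)
    have u3 : ∑ v ∈ B1, d G D1 v ≤ B1.card * 1 := sum_const_le fun v hv => z2 x hx v (sA _ hv)
    have v1 := dsum_comm (G := G) A1 C1
    have v2 := dsum_comm (G := G) A1 D1
    have v3 := dsum_comm (G := G) B1 D1
    omega
theorem b24 (hG : Good G) : Bd G 24 54 := Bd_step (b23 hG) (by omega) (by omega)
end Gr

namespace Gr
variable {V : Type} [DecidableEq V] {G : SimpleGraph V} [DecidableRel G.Adj]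

structure SD (G : SimpleGraph V) [DecidableRel G.Adj] (S F H : Finset V) (v : V) : Prop where
  mem : ∀ w, w ∈ H ↔ w ∈ S ∧ w ≠ v ∧ ¬ (w ∈ F ∧ G.Adj v w)
  card : H.card + (d G F v + 1) = S.card
  edge : E2 G S + 2 * d G F v = E2 G H + 2 * (d G S v + 4 * d G F v)
  four : ∀ w ∈ H, 4 ≤ d G H w
  drop : ∀ w ∈ H, d G S w ≤ d G H w + 1
  dropv : ∀ w ∈ H, G.Adj v w → d G S w = d G H w + 1
  out : ∀ u ∈ F, G.Adj v u → d G H u = 3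
  out2 : ∀ u ∈ F, G.Adj v u → ∀ w ∈ H, G.Adj u w → d G S w = d G H w + 1
  same : ∀ w ∈ H, ¬ G.Adj v w → (∀ u ∈ F, G.Adj v u → ¬ G.Adj u w) → d G H w = d G S w

theorem star_del (hG : Good G) {S F : Finset V} {v : V} (hv : v ∈ S) (hvF : v ∉ F) (hF : F ⊆ S)
    (h4 : ∀ u ∈ F, d G S u = 4) (h5 : ∀ u ∈ S, u ∉ F → 5 ≤ d G S u) (hi : ∀ a ∈ F, ∀ b ∈ F, ¬ G.Adj a b) :
    ∃ H, H ⊆ S ∧ SD G S F H v := by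
  set N := F.filter (G.Adj v) with hN
  have mN : ∀ u, u ∈ N ↔ u ∈ F ∧ G.Adj v u := fun u => by rw [hN, Finset.mem_filter]
  have hvN : v ∉ N := fun h => hvF ((mN v).1 h).1
  have hT : insert v N ⊆ S := Finset.insert_subset hv ((Finset.filter_subset _ _).trans hF)
  have hk : N.card = d G F v := rfl
  have hsp := fun w => d_split (G := G) hT w
  have mH : ∀ w, w ∈ S \ insert v N ↔ w ∈ S ∧ w ≠ v ∧ ¬ (w ∈ F ∧ G.Adj v w) := by
    intro w; rw [Finset.mem_sdiff, Finset.mem_insert, mN]; tauto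
  have le1 : ∀ w, w ≠ v → d G (insert v N) w ≤ 1 := by
    intro w hw
    refine d_le_one fun x hx y hy hwx hwy => ?_
    rw [Finset.mem_insert, mN] at hx hy
    rcases hx with rfl | hx <;> rcases hy with rfl | hy
    · rfl
    · exact (hG.no3 w x y hwx hy.2 hwy.symm).elim
    · exact (hG.no3 w y x hwy hx.2 hwx.symm).elim
    · by_contra hne
      exact hG.no4 v x w y hx.2 hwx.symm hwy hy.2.symm hw.symm hne
  have ge1 : ∀ u ∈ insert v N, ∀ w, G.Adj u w → 1 ≤ d G (insert v N) w := fun u hu w h => d_pos hu h.symm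
  refine ⟨S \ insert v N, Finset.sdiff_subset, mH, ?_, ?_, ?_, ?_, ?_, ?_, ?_, ?_⟩
  · have := Finset.card_sdiff_add_card_eq_card hT
    rw [Finset.card_insert_of_notMem hvN, hk] at this; omega
  · have h1 := E2_sdiff (G := G) hT
    rw [E2_insert hvN, Finset.sum_insert hvN, sum_const_eq (k := 4) (fun u hu => h4 u ((mN u).1 hu).1),
      E2_indep (fun a ha b hb => hi a ((mN a).1 ha).1 b ((mN b).1 hb).1)] at h1
    have h2 : d G N v = N.card := by
      unfold d; rw [Finset.filter_true_of_mem fun u hu => ((mN u).1 hu).2]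
    omega
  · intro w hw
    rw [mH] at hw
    have h1 := hsp w
    have h2 := le1 w hw.2.1
    by_cases hwF : w ∈ F
    · have := h4 w hwF
      have : d G (insert v N) w = 0 := d_zero fun x hx hwx => by
        rw [Finset.mem_insert, mN] at hx
        rcases hx with rfl | hx
        · exact hw.2.2 ⟨hwF, hwx.symm⟩
        · exact hi w hwF x hx.1 hwx
      omega
    · have := h5 w hw.1 hwF; omega
  · intro w hw
    rw [mH] at hw
    have h1 := hsp w
    have h2 := le1 w hw.2.1
    omega
  · intro w hw hvw
    rw [mH] at hw
    have h1 := hsp w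
    have h2 := le1 w hw.2.1
    have := ge1 v (by simp) w hvw
    omega
  · intro u hu hvu
    have h1 := hsp u
    have h2 := le1 u hvu.ne'
    have := ge1 v (by simp) u hvu
    have := h4 u hu
    omega
  · intro u hu hvu w hw huw
    rw [mH] at hw
    have h1 := hsp w
    have h2 := le1 w hw.2.1
    have := ge1 u (Finset.mem_insert_of_mem ((mN u).2 ⟨hu, hvu⟩)) w huw
    omega
  · intro w hw hvw h
    have h1 := hsp w
    have : d G (insert v N) w = 0 := d_zero fun x hx hwx => by
      rw [Finset.mem_insert, mN] at hx
      rcases hx with rfl | hx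
      · exact hvw hwx.symm
      · exact h x hx.1 hx.2 hwx.symm
    omega

theorem b25 (hG : Good G) : Bd G 25 57 := by
  intro S hc
  obtain ⟨e, he, h1, h2⟩ := setup (b24 hG) hc (by omega)
  by_contra hcon
  have he' : E2 G S = 116 := by omega
  have h3 : ∀ v ∈ S, 4 ≤ d G S v := fun u hu => by have := h2 u hu; omega
  have h6 : ∀ v ∈ S, d G S v ≤ 6 := fun u hu => by have := ball_le hG hu 4 h3; omega
  have hi : ∀ a ∈ S, ∀ b ∈ S, d G S a = 4 → d G S b = 4 → ¬ G.Adj a b := by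
    intro a ha b hb qa qb hab
    have := del2 (b23 hG) ha hb hab hc
    omega
  have h4 : ∀ v ∈ S, d G S v ≤ 5 := by
    intro v hv
    by_contra hcon
    have hd : d G S v = 6 := by have := h6 v hv; omega
    obtain ⟨t1, t2⟩ := three_deg (G := G) (S := S) 4 fun v hv => ⟨h3 v hv, h6 v hv⟩
    set F := S.filter (fun v => d G S v = 4) with hF
    have hFs : F ⊆ S := Finset.filter_subset _ _
    have h5 : ∀ u ∈ S, u ∉ F → 4 + 1 ≤ d G S u := fun u hu hn => by
      have : d G S u ≠ 4 := fun e => hn (Finset.mem_filter.2 ⟨hu, e⟩)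
      have := h3 u hu; omega
    have hz := ball_le2 hG hv 4 hFs h3 h5
    have hz0 : d G (S \ F) v = 0 := by omega
    have hsub : F ⊆ S.filter (G.Adj v) := by
      intro w hw
      rw [Finset.mem_filter]
      refine ⟨hFs hw, ?_⟩
      by_contra hna
      have hw4 := (Finset.mem_filter.1 hw).2
      obtain ⟨u, hu, hvu, huw⟩ := ball_full hG hv (by
        have := nbr_sum (G := G) (v := v) 4 hFs h3 h5; omega) (hFs hw) (by rintro rfl; omega) hna
      have huF : u ∈ F := by
        by_contra huF
        exact d_zero' hz0 u (Finset.mem_sdiff.2 ⟨hu, huF⟩) hvu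
      exact hi u hu w (hFs hw) (Finset.mem_filter.1 huF).2 hw4 huw
    have := Finset.card_le_card hsub
    unfold d at *
    omega
  obtain ⟨F, hF, c1, c2, mF⟩ := FF_mk fun v hv => ⟨h3 v hv, h4 v hv⟩
  have hspl := fun v => d_split (G := G) hF.sub v
  have hi' : ∀ a ∈ F, ∀ b ∈ F, ¬ G.Adj a b := fun a ha b hb =>
    hi a (hF.sub ha) b (hF.sub hb) (hF.four a ha) (hF.four b hb)
  set A := S \ F with hAdef
  have h5 : ∀ u ∈ S, u ∉ F → 5 ≤ d G S u := fun u hu hn => (hF.five u (Finset.mem_sdiff.2 ⟨hu, hn⟩)).ge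
  have dA : ∀ v ∈ A, d G A v < 5 ∧ d G A v ≠ 1 ∧ d G A v ≠ 2 := by
    intro v hv
    have hvS := (Finset.mem_sdiff.1 hv).1
    have hvF := (Finset.mem_sdiff.1 hv).2
    have hb := ball_le2 hG hvS 4 hF.sub h3 h5
    have h55 := hF.five v hv
    rw [← hAdef] at hb
    have hs := hspl v
    obtain ⟨H, hHS, hH⟩ := star_del hG hvS hvF hF.sub hF.four h5 hi'
    have hHc := hH.card
    have hHe := hH.edge
    refine ⟨by omega, ?_, ?_⟩
    · intro h
      exact L20 hG (S := H) (by omega) (by omega) hH.four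
    · intro h
      obtain ⟨u, hu, hvu⟩ := d_ex (by omega : 1 ≤ d G F v)
      refine core21 hG (H := H) (u := u) (by omega) (by omega) hH.four (fun h => ((hH.mem u).1 h).2.2 ⟨hu, hvu⟩)
        (hH.out u hu hvu) ?_
      intro w hw huw
      have := hH.out2 u hu hvu w hw huw
      have := h4 w (hHS hw)
      have := hH.four w hw
      omega
  have k0 := clsc A (d G A) 5 fun v hv => (dA v hv).1
  have k1 := cls A (d G A) (fun i => i) 5 fun v hv => (dA v hv).1
  have k2 := cls A (d G A) (fun i => i * (i - 1)) 5 fun v hv => (dA v hv).1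
  have z1 : (A.filter (fun v => d G A v = 1)).card = 0 := by
    rw [Finset.card_eq_zero, Finset.filter_eq_empty_iff]; exact fun v hv => (dA v hv).2.1
  have z2 : (A.filter (fun v => d G A v = 2)).card = 0 := by
    rw [Finset.card_eq_zero, Finset.filter_eq_empty_iff]; exact fun v hv => (dA v hv).2.2
  simp only [Finset.sum_range_succ, Finset.sum_range_zero, z1, z2] at k0 k1 k2
  norm_num at k2
  have hA : A.card = 16 := by omega
  have dF : ∀ v ∈ F, d G A v = 4 := fun v hv => by
    have := hspl v; have := hF.four v hv
    have := d_zero (hi' v hv)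
    omega
  have hp := pairs hG A S
  have e1 : ∑ w ∈ F, d G A w * (d G A w - 1) = F.card * 12 := sum_const_eq fun v hv => by rw [dF v hv]
  rw [← Finset.sum_sdiff hF.sub, ← hAdef, e1, k2, hA] at hp
  have k4 : ∑ v ∈ A, d G S v = ∑ v ∈ A, d G F v + E2 G A := by
    rw [E2, ← Finset.sum_add_distrib]; exact Finset.sum_congr rfl fun v _ => hspl v
  rw [sum_const_eq (A := A) hF.five, dsum_comm, sum_const_eq (A := F) dF] at k4
  have k8 : E2 G A = ∑ v ∈ A, d G A v := rfl
  omega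
theorem b26 (hG : Good G) : Bd G 26 61 := Bd_step (b25 hG) (by omega) (by omega)
end Gr

namespace Gr
variable {V : Type} [DecidableEq V] {G : SimpleGraph V} [DecidableRel G.Adj]

theorem star_common (hG : Good G) {v w : V} (A : Finset V) (h : w ≠ v) : d G (insert v (A.filter (G.Adj v))) w ≤ 1 := by
  refine d_le_one fun x hx y hy hwx hwy => ?_
  rw [Finset.mem_insert, Finset.mem_filter] at hx hy
  rcases hx with rfl | hx <;> rcases hy with rfl | hy
  · rfl
  · exact (hG.no3 w x y hwx hy.2 hwy.symm).elim
  · exact (hG.no3 w y x hwy hx.2 hwx.symm).elim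
  · by_contra hne
    exact hG.no4 v x w y hx.2 hwx.symm hwy hy.2.symm h.symm hne

structure KB (G : SimpleGraph V) [DecidableRel G.Adj] (Z P Q F : Finset V) (p q : V) : Prop where
  good : Good G
  cZ : Z.card = 12
  cP : P.card = 4
  cQ : Q.card = 4
  dZP : Disjoint Z P
  dZQ : Disjoint Z Q
  dPQ : Disjoint P Q
  zF : Z ⊆ F
  pF : p ∈ F
  qF : q ∈ F
  pZ : p ∉ Z
  qZ : q ∉ Z
  hp : ∀ v ∈ P, G.Adj p v
  hq : ∀ v ∈ Q, G.Adj q v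
  five : ∀ T ⊆ F, T.card = 5 → E2 G T ≤ 8
  six : ∀ T ⊆ F, T.card = 6 → E2 G T ≤ 10
  zdeg : ∀ z ∈ Z, d G P z + d G Q z + d G Z z = 4
  zP : ∀ z ∈ Z, d G P z ≤ 1
  zQ : ∀ z ∈ Z, d G Q z ≤ 1
  PQ : ∀ v ∈ P, d G Q v ≤ 1
  QP : ∀ v ∈ Q, d G P v ≤ 1
  P4 : ∀ v ∈ P, v ∈ F → d G Q v + d G Z v = 3
  Q4 : ∀ v ∈ Q, v ∈ F → d G P v + d G Z v = 3
  P5 : ∀ v ∈ P, v ∉ F → d G Q v + d G Z v = 4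
  Q5 : ∀ v ∈ Q, v ∉ F → d G P v + d G Z v = 4
  zr : ∀ z ∈ Z, ∀ a ∈ P ∪ Q, ∀ b ∈ P ∪ Q, a ∈ F → b ∈ F → a ≠ b → G.Adj z a → ¬ G.Adj z b
  ri : ∀ a ∈ P ∪ Q, ∀ b ∈ P ∪ Q, a ∈ F → b ∈ F → ¬ G.Adj a b

variable {Z P Q F : Finset V} {p q : V}

theorem KB.swap (K : KB G Z P Q F p q) : KB G Z Q P F q p :=
  ⟨K.good, K.cZ, K.cQ, K.cP, K.dZQ, K.dZP, K.dPQ.symm, K.zF, K.qF, K.pF, K.qZ, K.pZ, K.hq, K.hp, K.five, K.six,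
    fun z hz => by have := K.zdeg z hz; omega, K.zQ, K.zP, K.QP, K.PQ, K.Q4, K.P4, K.Q5, K.P5,
    fun z hz a ha b hb => K.zr z hz a (by rwa [Finset.union_comm]) b (by rwa [Finset.union_comm]),
    fun a ha b hb => K.ri a (by rwa [Finset.union_comm]) b (by rwa [Finset.union_comm])⟩

theorem KB.no5 (K : KB G Z P Q F p q) {a b c e f : V} (ha : a ∈ F) (hb : b ∈ F) (hc : c ∈ F) (he : e ∈ F) (hf : f ∈ F)
    (h1 : G.Adj a b) (h2 : G.Adj b c) (h3 : G.Adj c e) (h4 : G.Adj e f) (h5 : G.Adj f a) : False := by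
  have hG := K.good
  have n1 : a ≠ c := by rintro rfl; exact hG.no3 _ _ _ h3 h4 h5
  have n2 : b ≠ e := by rintro rfl; exact hG.no3 _ _ _ h4 h5 h1
  have n3 : c ≠ f := by rintro rfl; exact hG.no3 _ _ _ h5 h1 h2
  have n4 : e ≠ a := by rintro rfl; exact hG.no3 _ _ _ h1 h2 h3
  have n5 : f ≠ b := by rintro rfl; exact hG.no3 _ _ _ h2 h3 h4
  have hC := (((Cn.one (G := G) ha).ins hb (by simpa using h1.ne') (u := a) (by simp) h1.symm).ins hc
    (by simp [n1.symm, h2.ne']) (u := b) (by simp) h2.symm).ins he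
    (by simp [n2.symm, n4, h3.ne']) (u := c) (by simp) h3.symm
  have hfn : f ∉ ({e, c, b, a} : Finset V) := by simp [n3.symm, n5, h4.ne', h5.ne]
  have := K.five (insert f {e, c, b, a}) (Finset.insert_subset hf hC.sub) (by
    rw [Finset.card_insert_of_notMem hfn, hC.card])
  rw [E2_insert hfn] at this
  have h2 : 2 ≤ d G {e, c, b, a} f := d_two (u := a) (w := e) (by simp) h5 (by simp) h4.symm n4.symm
  have := hC.edge
  omega

theorem KB.no6 (K : KB G Z P Q F p q) {a b c e f g : V} (ha : a ∈ F) (hb : b ∈ F) (hc : c ∈ F) (he : e ∈ F) (hf : f ∈ F)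
    (hg : g ∈ F) (h1 : G.Adj a b) (h2 : G.Adj b c) (h3 : G.Adj c e) (h4 : G.Adj e f) (h5 : G.Adj f g) (h6 : G.Adj g a)
    (n1 : a ≠ c) (n2 : b ≠ e) (n3 : c ≠ f) (n4 : e ≠ g) (n5 : f ≠ a) (n6 : g ≠ b) : False := by
  have hG := K.good
  have m1 : a ≠ e := by rintro rfl; exact hG.no3 _ _ _ h1 h2 h3
  have m2 : b ≠ f := by rintro rfl; exact hG.no3 _ _ _ h2 h3 h4
  have m3 : c ≠ g := by rintro rfl; exact hG.no3 _ _ _ h3 h4 h5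
  have hC := ((((Cn.one (G := G) ha).ins hb (by simpa using h1.ne') (u := a) (by simp) h1.symm).ins hc
    (by simp [n1.symm, h2.ne']) (u := b) (by simp) h2.symm).ins he
    (by simp [n2.symm, m1.symm, h3.ne']) (u := c) (by simp) h3.symm).ins hf
    (by simp [n3.symm, n5, m2.symm, h4.ne']) (u := e) (by simp) h4.symm
  have hfn : g ∉ ({f, e, c, b, a} : Finset V) := by simp [n4.symm, n6, m3.symm, h5.ne', h6.ne]
  have := K.six (insert g {f, e, c, b, a}) (Finset.insert_subset hg hC.sub) (by
    rw [Finset.card_insert_of_notMem hfn, hC.card])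
  rw [E2_insert hfn] at this
  have h2 : 2 ≤ d G {f, e, c, b, a} g := d_two (u := a) (w := f) (by simp) h6 (by simp) h5.symm n5.symm
  have := hC.edge
  omega

theorem KB.nZP (K : KB G Z P Q F p q) {z v : V} (hz : z ∈ Z) (hv : v ∈ P) : z ≠ v := by
  rintro rfl; exact Finset.disjoint_left.1 K.dZP hz hv
theorem KB.sumZ (K : KB G Z P Q F p q) : ∑ v ∈ P, d G Z v ≤ 12 := by
  rw [dsum_comm]
  have := sum_const_le K.zP
  rw [K.cZ] at this; omega
theorem KB.sumPQ (K : KB G Z P Q F p q) : ∑ v ∈ P, d G Q v ≤ 4 := by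
  have := sum_const_le K.PQ
  rw [K.cP] at this; omega
theorem all_one {A : Finset V} {f : V → ℕ} (h : ∀ v ∈ A, f v ≤ 1) (hs : A.card ≤ ∑ v ∈ A, f v) : ∀ v ∈ A, f v = 1 := by
  intro v hv
  by_contra hne
  have h0 : f v = 0 := by have := h v hv; omega
  have h1 := Finset.add_sum_erase A f hv
  have h2 : ∑ w ∈ A.erase v, f w ≤ (A.erase v).card * 1 := sum_const_le fun w hw => h w (Finset.mem_of_mem_erase hw)
  rw [Finset.card_erase_of_mem hv] at h2
  have := Finset.card_pos.2 ⟨v, hv⟩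
  omega

/-- neighbours in Q of the star of z avoid m -/
theorem KB.star_avoid (K : KB G Z P Q F p q) {r m z : V} (hr : r ∈ P) (hm : m ∈ Q) (hrm : G.Adj r m) (hz : z ∈ Z)
    (hrz : G.Adj r z) : ∀ v ∈ insert z (Z.filter (G.Adj z)), ¬ G.Adj v m := by
  intro v hv hvm
  rw [Finset.mem_insert, Finset.mem_filter] at hv
  rcases hv with rfl | hv
  · exact K.good.no3 r v m hrz hvm hrm.symm
  · exact K.good.no4 r z v m hrz hv.2 hvm hrm.symm (K.nZP hv.1 hr).symm (K.swap.nZP hz hm)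

theorem d_erase {A : Finset V} {v m : V} (h : ¬ G.Adj v m) : d G (A.erase m) v = d G A v := by
  unfold d
  congr 1
  ext x
  simp only [Finset.mem_filter, Finset.mem_erase]
  constructor
  · tauto
  · rintro ⟨h1, h2⟩
    exact ⟨⟨by rintro rfl; exact h h2, h1⟩, h2⟩

/-- a star all of whose vertices have Q-neighbours is of size three and hits everything but m -/
theorem KB.star_hit (K : KB G Z P Q F p q) {r m z : V} (hr : r ∈ P) (hm : m ∈ Q) (hrm : G.Adj r m) (hz : z ∈ Z)
    (hrz : G.Adj r z) (h : ∀ v ∈ insert z (Z.filter (G.Adj z)), d G Q v = 1) :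
    d G Z z = 2 ∧ ∀ a ∈ Q, a ≠ m → ∃ v ∈ insert z (Z.filter (G.Adj z)), G.Adj v a := by
  have hav := K.star_avoid hr hm hrm hz hrz
  set T := insert z (Z.filter (G.Adj z)) with hT
  have hTc : T.card = d G Z z + 1 := by
    rw [hT, Finset.card_insert_of_notMem (by simp)]; rfl
  have hd : 2 ≤ d G Z z := by
    have := K.zdeg z hz; have := K.zP z hz; have := K.zQ z hz; omega
  have h1 : ∑ v ∈ T, d G (Q.erase m) v = T.card * 1 := sum_const_eq fun v hv => by
    rw [d_erase (hav v hv)]; exact h v hv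
  rw [dsum_comm] at h1
  have h2 : ∀ a ∈ Q.erase m, d G T a ≤ 1 := fun a ha =>
    star_common K.good Z (K.swap.nZP hz (Finset.mem_of_mem_erase ha)).symm
  have h3 := sum_const_le h2
  have h4 : (Q.erase m).card = 3 := by rw [Finset.card_erase_of_mem hm, K.cQ]
  refine ⟨by omega, ?_⟩
  have h5 := all_one h2 (by omega)
  intro a ha ham
  obtain ⟨v, hv, hav⟩ := d_ex (h5 a (Finset.mem_erase.2 ⟨ham, ha⟩)).ge
  exact ⟨v, hv, hav.symm⟩

/-- both exceptional vertices in P -/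
theorem KB.case1 (K : KB G Z P Q F p q) {r s : V} (hr : r ∈ P) (hs : s ∈ P) (hrs : r ≠ s) (hrF : r ∈ F) (hsF : s ∈ F)
    (hQ : ∀ v ∈ Q, v ∉ F) : False := by
  have hG := K.good
  have e1 : ∑ v ∈ Q, (d G P v + d G Z v) = Q.card * 4 := sum_const_eq fun v hv => K.Q5 v hv (hQ v hv)
  rw [Finset.sum_add_distrib, K.cQ] at e1
  have e2 := K.swap.sumZ
  have e3 := K.swap.sumPQ
  have q1 : ∀ v ∈ Q, d G P v = 1 := all_one K.QP (by rw [K.cQ]; omega)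
  have e4 := dsum_comm (G := G) P Q
  have p1 : ∀ v ∈ P, d G Q v = 1 := all_one K.PQ (by rw [K.cP]; omega)
  have e5 := dsum_comm (G := G) Z Q
  have z1 : ∀ z ∈ Z, d G Q z = 1 := all_one K.zQ (by rw [K.cZ]; omega)
  obtain ⟨m, hm, hrm⟩ := d_ex (p1 r hr).ge
  obtain ⟨n, hn, hsn⟩ := d_ex (p1 s hs).ge
  have : ∃ a ∈ Q, a ≠ m ∧ a ≠ n := by
    by_contra hc; push Not at hc
    have : Q ⊆ {m, n} := by
      intro a ha
      by_cases h : a = m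
      · simp [h]
      · simp [hc a ha h]
    have := Finset.card_le_card this
    have := Finset.card_le_two (a := m) (b := n)
    have := K.cQ; omega
  obtain ⟨a, ha, ham, han⟩ := this
  have da : d G Z a = 3 := by have := K.Q5 a ha (hQ a ha); have := q1 a ha; omega
  have key : ∀ r' ∈ P, ∀ m' ∈ Q, G.Adj r' m' → a ≠ m' → ∀ z ∈ Z, G.Adj r' z → ∃ v ∈ Z, G.Adj v a ∧ (v = z ∨ G.Adj z v) := by
    intro r' hr' m' hm' hrm' ham' z hz hrz
    obtain ⟨_, h⟩ := K.star_hit hr' hm' hrm' hz hrz (fun v hv => z1 v (by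
      rw [Finset.mem_insert, Finset.mem_filter] at hv
      rcases hv with rfl | hv
      · exact hz
      · exact hv.1))
    obtain ⟨v, hv, hva⟩ := h a ha ham'
    rw [Finset.mem_insert, Finset.mem_filter] at hv
    rcases hv with rfl | hv
    · exact ⟨v, hz, hva, Or.inl rfl⟩
    · exact ⟨v, hv.1, hva, Or.inr hv.2⟩
  set R := Z.filter (G.Adj r) ∪ Z.filter (G.Adj s) with hR
  have hdis : Disjoint (Z.filter (G.Adj r)) (Z.filter (G.Adj s)) := by
    rw [Finset.disjoint_left]
    intro z hz hz'
    rw [Finset.mem_filter] at hz hz'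
    exact K.zr z hz.1 r (Finset.mem_union_left _ hr) s (Finset.mem_union_left _ hs) hrF hsF hrs hz.2.symm hz'.2.symm
  have hRc : R.card = 4 := by
    rw [hR, Finset.card_union_of_disjoint hdis]
    have h1 : d G Z r = 2 := by have := K.P4 r hr hrF; have := p1 r hr; omega
    have h2 : d G Z s = 2 := by have := K.P4 s hs hsF; have := p1 s hs; omega
    unfold d at h1 h2; omega
  have hex : ∀ z ∈ R, ∃ v ∈ Z, G.Adj v a ∧ (v = z ∨ G.Adj z v) := by
    intro z hz
    rw [hR, Finset.mem_union, Finset.mem_filter, Finset.mem_filter] at hz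
    rcases hz with hz | hz
    · exact key r hr m hm hrm ham z hz.1 hz.2
    · exact key s hs n hn hsn han z hz.1 hz.2
  choose! f f1 f2 f3 using hex
  have same : ∀ r' ∈ P, ∀ z ∈ Z, ∀ z' ∈ Z, G.Adj r' z → G.Adj r' z' → ∀ v ∈ Z, (v = z ∨ G.Adj z v) → (v = z' ∨ G.Adj z' v) → z = z' := by
    intro r' hr' z hz z' hz' h1 h2 v hv h3 h4
    by_contra hne
    rcases h3 with rfl | h3 <;> rcases h4 with rfl | h4
    · exact hne rfl
    · exact hG.no3 _ _ _ h1 h4.symm h2.symm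
    · exact hG.no3 _ _ _ h1 h3 h2.symm
    · exact hG.no4 _ _ _ _ h1 h3 h4.symm h2.symm (K.nZP hv hr').symm hne
  have diff : ∀ r ∈ P, ∀ s ∈ P, r ≠ s → r ∈ F → s ∈ F → ∀ z ∈ Z, ∀ z' ∈ Z, z ≠ z' → G.Adj r z → G.Adj s z' → ∀ v ∈ Z, (v = z ∨ G.Adj z v) → (v = z' ∨ G.Adj z' v) → False := by
    intro r hr s hs hrs hrF hsF z hz z' hz' hne h1 h2 v hv h3 h4
    have zf := K.zF hz
    have zf' := K.zF hz'
    rcases h3 with rfl | h3 <;> rcases h4 with rfl | h4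
    · exact hne rfl
    · exact K.no5 hrF zf zf' hsF K.pF h1 h4.symm h2.symm (K.hp s hs).symm (K.hp r hr)
    · exact K.no5 hrF zf zf' hsF K.pF h1 h3 h2.symm (K.hp s hs).symm (K.hp r hr)
    · exact K.no6 hrF zf (K.zF hv) zf' hsF K.pF h1 h3 h4.symm h2.symm (K.hp s hs).symm (K.hp r hr)
        (K.nZP hv hr).symm hne (K.nZP hv hs) (by rintro rfl; exact K.pZ hz') hrs.symm (by rintro rfl; exact K.pZ hz)
  have hinj : Set.InjOn f R := by
    intro z hz z' hz' hff
    have b1 := f1 z hz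
    have b3 := f3 z hz
    have b3' := f3 z' hz'
    rw [← hff] at b3'
    rw [Finset.mem_coe, hR, Finset.mem_union, Finset.mem_filter, Finset.mem_filter] at hz hz'
    rcases hz with hz | hz <;> rcases hz' with hz' | hz'
    · exact same r hr z hz.1 z' hz'.1 hz.2 hz'.2 _ b1 b3 b3'
    · by_contra hne
      exact diff r hr s hs hrs hrF hsF z hz.1 z' hz'.1 hne hz.2 hz'.2 _ b1 b3 b3'
    · by_contra hne
      exact diff s hs r hr hrs.symm hsF hrF z hz.1 z' hz'.1 hne hz.2 hz'.2 _ b1 b3 b3'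
    · exact same s hs z hz.1 z' hz'.1 hz.2 hz'.2 _ b1 b3 b3'
  have := Finset.card_le_card_of_injOn f (t := Z.filter (G.Adj a)) (s := R) (fun z hz => by
    exact Finset.mem_coe.2 (Finset.mem_filter.2 ⟨f1 z hz, (f2 z hz).symm⟩)) hinj
  unfold d at da; omega
end Gr

namespace Gr
variable {V : Type} [DecidableEq V] {G : SimpleGraph V} [DecidableRel G.Adj] {Z P Q F : Finset V} {p q : V}

theorem KB.d2 (K : KB G Z P Q F p q) {z : V} (hz : z ∈ Z) : 2 ≤ d G Z z := by
  have := K.zdeg z hz; have := K.zP z hz; have := K.zQ z hz; omega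

theorem KB.r2 (K : KB G Z P Q F p q) {r : V} (hr : r ∈ P) (hrF : r ∈ F) : d G Z r ≤ 2 := by
  by_contra hcon
  have hG := K.good
  set W := Z.filter (G.Adj r) with hW
  have hWc : 3 ≤ W.card := by have : d G Z r = W.card := rfl; omega
  have mW : ∀ v, v ∈ W ↔ v ∈ Z ∧ G.Adj r v := fun v => by rw [hW, Finset.mem_filter]
  set Y := Z.filter (fun v => 1 ≤ d G W v) with hY
  have mY : ∀ v, v ∈ Y ↔ v ∈ Z ∧ 1 ≤ d G W v := fun v => by rw [hY, Finset.mem_filter]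
  set X := Z.filter (fun v => v ∉ W ∧ v ∉ Y) with hX
  have mX : ∀ v, v ∈ X ↔ v ∈ Z ∧ v ∉ W ∧ v ∉ Y := fun v => by rw [hX, Finset.mem_filter]
  have hWY : ∀ v ∈ W, v ∉ Y := by
    intro v hv hvY
    obtain ⟨u, hu, hvu⟩ := d_ex ((mY v).1 hvY).2
    exact hG.no3 r v u ((mW v).1 hv).2 hvu ((mW u).1 hu).2.symm
  have c1 : W.card + Y.card + X.card ≤ 12 := by
    rw [← K.cZ, ← Finset.card_union_of_disjoint (Finset.disjoint_left.2 hWY), ← Finset.card_union_of_disjoint]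
    · refine Finset.card_le_card fun v hv => ?_
      simp only [Finset.mem_union] at hv
      rcases hv with (hv | hv) | hv
      · exact ((mW v).1 hv).1
      · exact ((mY v).1 hv).1
      · exact ((mX v).1 hv).1
    · rw [Finset.disjoint_left]
      intro v hv hv'
      rw [Finset.mem_union] at hv
      have := (mX v).1 hv'
      tauto
  have c2 : W.card * 2 ≤ Y.card * 1 := by
    have h1 : W.card * 2 ≤ ∑ w ∈ W, d G Y w := le_sum_const fun w hw => by
      have hwZ := ((mW w).1 hw).1
      refine (K.d2 hwZ).trans (Finset.card_le_card fun v hv => ?_)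
      rw [Finset.mem_filter] at hv ⊢
      exact ⟨(mY v).2 ⟨hv.1, d_pos hw hv.2.symm⟩, hv.2⟩
    rw [dsum_comm] at h1
    refine h1.trans (sum_const_le fun v hv => ?_)
    exact common hG Z (K.nZP ((mY v).1 hv).1 hr).symm
  have c3 : Y.card * 1 ≤ X.card * 1 := by
    have h1 : Y.card * 1 ≤ ∑ v ∈ Y, d G X v := le_sum_const fun v hv => by
      obtain ⟨hvZ, hvW⟩ := (mY v).1 hv
      obtain ⟨w, hw, hvw⟩ := d_ex hvW
      obtain ⟨u, hu, hvu, huw⟩ := d_other (K.d2 hvZ) w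
      refine d_pos (u := u) ((mX u).2 ⟨hu, ?_, ?_⟩) hvu
      · intro huW
        have := common hG Z (K.nZP hvZ hr).symm
        exact huw (d_one hw hvw this u huW hvu)
      · intro huY
        obtain ⟨w', hw', huw'⟩ := d_ex ((mY u).1 huY).2
        exact K.no5 hrF (K.zF ((mW w).1 hw).1) (K.zF hvZ) (K.zF hu) (K.zF ((mW w').1 hw').1)
          ((mW w).1 hw).2 hvw.symm hvu huw' ((mW w').1 hw').2.symm
    rw [dsum_comm] at h1
    refine h1.trans (sum_const_le fun x hx => ?_)
    obtain ⟨hxZ, hxW, hxY⟩ := (mX x).1 hx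
    refine d_le_one fun u hu v hv hxu hxv => ?_
    by_contra hne
    obtain ⟨huZ, huW⟩ := (mY u).1 hu
    obtain ⟨hvZ, hvW⟩ := (mY v).1 hv
    obtain ⟨w, hw, huw⟩ := d_ex huW
    obtain ⟨w', hw', hvw'⟩ := d_ex hvW
    have nxw : x ≠ w := by rintro rfl; exact hxW hw
    have nxw' : x ≠ w' := by rintro rfl; exact hxW hw'
    by_cases hww : w = w'
    · subst hww
      exact hG.no4 x u w v hxu huw hvw'.symm hxv.symm nxw hne
    · rw [mW] at hw hw'
      exact K.no6 hrF (K.zF hw.1) (K.zF huZ) (K.zF hxZ) (K.zF hvZ) (K.zF hw'.1) hw.2 huw.symm hxu.symm hxv hvw' hw'.2.symm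
        (K.nZP huZ hr).symm nxw.symm hne nxw' (K.nZP hvZ hr) (Ne.symm hww)
  omega

structure Hf (G : SimpleGraph V) [DecidableRel G.Adj] (Z Q : Finset V) (r s z w t β : V) : Prop where
  zZ : z ∈ Z
  wZ : w ∈ Z
  tZ : t ∈ Z
  bZ : β ∈ Z
  zw : z ≠ w
  rz : G.Adj r z
  rw : G.Adj r w
  wt : G.Adj w t
  ts : G.Adj t s
  dw : d G Z w = 2
  zb : G.Adj z β
  b0 : d G Q β = 0
  nh : ∀ v ∈ Z, G.Adj z v → ¬ G.Adj v s
  st : ∀ v ∈ Z, (v = w ∨ G.Adj w v) → d G Q v = 1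
  un : ∀ v ∈ Z, v ≠ β → d G Q v = 1
  sm : ∑ v ∈ Z, d G Q v = 11

theorem sum_one_lt {A : Finset V} {f : V → ℕ} {a b : V} (h : ∀ v ∈ A, f v ≤ 1) (ha : a ∈ A) (hb : b ∈ A) (hab : a ≠ b)
    (fa : f a = 0) (fb : f b = 0) : ∑ v ∈ A, f v + 2 ≤ A.card := by
  have h1 := Finset.add_sum_erase A f ha
  have hb' : b ∈ A.erase a := Finset.mem_erase.2 ⟨hab.symm, hb⟩
  have h2 := Finset.add_sum_erase (A.erase a) f hb'
  have h3 : ∑ w ∈ (A.erase a).erase b, f w ≤ ((A.erase a).erase b).card * 1 :=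
    sum_const_le fun w hw => h w (Finset.mem_of_mem_erase (Finset.mem_of_mem_erase hw))
  have h4 := Finset.card_erase_add_one hb'
  have h5 := Finset.card_erase_add_one ha
  omega

theorem KB.half (K : KB G Z P Q F p q) {r s : V} (hr : r ∈ P) (hs : s ∈ Q) (hrF : r ∈ F) (hsF : s ∈ F)
    (hP : ∀ v ∈ P, v ≠ r → v ∉ F) (hQ : ∀ v ∈ Q, v ≠ s → v ∉ F) : ∃ z w t β, Hf G Z Q r s z w t β := by
  have hG := K.good
  have hrz := K.r2 hr hrF
  have hr1 := K.P4 r hr hrF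
  have hr2 := K.PQ r hr
  have hdr : d G Z r = 2 := by omega
  obtain ⟨m, hm, hrm⟩ := d_ex (by omega : 1 ≤ d G Q r)
  have hsm : s ≠ m := by
    rintro rfl; exact K.ri r (Finset.mem_union_left _ hr) s (Finset.mem_union_right _ hs) hrF hsF hrm
  -- sums
  have e1 : ∑ v ∈ Q.erase s, (d G P v + d G Z v) = (Q.erase s).card * 4 := sum_const_eq fun v hv => by
    rw [Finset.mem_erase] at hv
    exact K.Q5 v hv.2 (hQ v hv.2 hv.1)
  have e1' := Finset.add_sum_erase Q (fun v => d G P v + d G Z v) hs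
  rw [e1, K.Q4 s hs hsF, Finset.card_erase_of_mem hs, K.cQ, Finset.sum_add_distrib] at e1'
  have e3 := K.swap.sumPQ
  have e5 := dsum_comm (G := G) Z Q
  have uniq : ∀ a ∈ Z, ∀ b ∈ Z, d G Q a = 0 → d G Q b = 0 → a = b := by
    intro a ha b hb qa qb
    by_contra hab
    have := sum_one_lt K.zQ ha hb hab qa qb
    rw [K.cZ] at this
    omega
  have hit : ∀ z ∈ Z, G.Adj r z → (∀ v ∈ Z, (v = z ∨ G.Adj z v) → d G Q v = 1) →
      d G Z z = 2 ∧ ∃ t ∈ Z, G.Adj z t ∧ G.Adj t s := by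
    intro z hz hrz h
    obtain ⟨h1, h2⟩ := K.star_hit hr hm hrm hz hrz (fun v hv => by
      rw [Finset.mem_insert, Finset.mem_filter] at hv
      rcases hv with rfl | hv
      · exact h v hz (Or.inl rfl)
      · exact h v hv.1 (Or.inr hv.2))
    refine ⟨h1, ?_⟩
    obtain ⟨v, hv, hvs⟩ := h2 s hs hsm
    rw [Finset.mem_insert, Finset.mem_filter] at hv
    rcases hv with rfl | hv
    · exact (K.zr v hz r (Finset.mem_union_left _ hr) s (Finset.mem_union_right _ hs) hrF hsF
        (by rintro rfl; exact Finset.disjoint_left.1 K.dPQ hr hs) hrz.symm hvs).elim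
    · exact ⟨v, hv.1, hv.2, hvs⟩
  have both : ∀ z ∈ Z, ∀ w ∈ Z, z ≠ w → G.Adj r z → G.Adj r w → ∀ t ∈ Z, ∀ u ∈ Z, G.Adj z t → G.Adj t s → G.Adj w u → G.Adj u s → False := by
    intro z hz w hw hne h1 h2 t ht u hu h3 h4 h5 h6
    by_cases htu : t = u
    · subst htu
      exact hG.no4 r z t w h1 h3 h5.symm h2.symm (K.nZP ht hr).symm hne
    · exact K.no6 hrF (K.zF hz) (K.zF ht) hsF (K.zF hu) (K.zF hw) h1 h3 h4 h6.symm h5.symm h2.symm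
        (K.nZP ht hr).symm (K.swap.nZP hz hs) htu (K.swap.nZP hw hs).symm (K.nZP hu hr) hne.symm
  -- main construction
  have main : ∀ z ∈ Z, ∀ w ∈ Z, z ≠ w → G.Adj r z → G.Adj r w →
      (∃ β ∈ Z, (β = z ∨ G.Adj z β) ∧ d G Q β = 0) → ∃ z w t β, Hf G Z Q r s z w t β := by
    rintro z hz w hw hne h1 h2 ⟨β, hβ, hzβ, b0⟩
    have stw : ∀ v ∈ Z, (v = w ∨ G.Adj w v) → d G Q v = 1 := by
      intro v hv hwv
      by_contra hcon
      have : v = β := uniq v hv β hβ (by have := K.zQ v hv; omega) b0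
      subst this
      rcases hzβ with rfl | h3 <;> rcases hwv with rfl | h4
      · exact hne rfl
      · exact hG.no3 _ _ _ h1 h4.symm h2.symm
      · exact hG.no3 _ _ _ h1 h3 h2.symm
      · exact hG.no4 _ _ _ _ h1 h3 h4.symm h2.symm (K.nZP hv hr).symm hne
    obtain ⟨dw, t, ht, hwt, hts⟩ := hit w hw h2 stw
    have nh : ∀ v ∈ Z, G.Adj z v → ¬ G.Adj v s := fun v hv hzv hvs => both z hz w hw hne h1 h2 v hv t ht hzv hvs hwt hts
    have zns : ¬ G.Adj z s := fun h => K.zr z hz r (Finset.mem_union_left _ hr) s (Finset.mem_union_right _ hs) hrF hsF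
        (by rintro rfl; exact Finset.disjoint_left.1 K.dPQ hr hs) h1.symm h
    have hzb : G.Adj z β := by
      rcases hzβ with rfl | h
      · exfalso
        -- star of z is too large
        have hav := K.star_avoid hr hm hrm hz h1
        have hTn : β ∉ Z.filter (G.Adj β) := by simp
        set T := Z.filter (G.Adj β) with hT
        have hdT : d G Z β = T.card := rfl
        have hd3 : 3 ≤ T.card := by
          have := K.zdeg β hz; have := K.zP β hz; omega
        have h3 : ∑ v ∈ T, d G ((Q.erase m).erase s) v = T.card * 1 := sum_const_eq fun v hv => by
          have hv' := Finset.mem_filter.1 hv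
          rw [d_erase (nh v hv'.1 hv'.2), d_erase (hav v (Finset.mem_insert_of_mem hv))]
          by_contra hcon
          have : v = β := uniq v hv'.1 β hβ (by have := K.zQ v hv'.1; omega) b0
          exact hv'.2.ne this.symm
        rw [dsum_comm] at h3
        have h4 : ∑ a ∈ (Q.erase m).erase s, d G T a ≤ ((Q.erase m).erase s).card * 1 := sum_const_le fun a ha =>
          common hG Z (K.swap.nZP hz (Finset.mem_of_mem_erase (Finset.mem_of_mem_erase ha)))
        rw [Finset.card_erase_of_mem (Finset.mem_erase.2 ⟨hsm, hs⟩), Finset.card_erase_of_mem hm, K.cQ] at h4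
        omega
      · exact h
    have un : ∀ v ∈ Z, v ≠ β → d G Q v = 1 := by
      intro v hv hvb
      by_contra hcon
      exact hvb (uniq v hv β hβ (by have := K.zQ v hv; omega) b0)
    refine ⟨z, w, t, β, hz, hw, ht, hβ, hne, h1, h2, hwt, hts, dw, hzb, b0, nh, stw, un, ?_⟩
    have s1 := Finset.add_sum_erase Z (d G Q) hβ
    have s2 : ∑ v ∈ Z.erase β, d G Q v = (Z.erase β).card * 1 := sum_const_eq fun v hv =>
      un v (Finset.mem_of_mem_erase hv) (Finset.ne_of_mem_erase hv)
    rw [Finset.card_erase_of_mem hβ, K.cZ] at s2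
    omega
  obtain ⟨z, hz, h1⟩ := d_ex (by omega : 1 ≤ d G Z r)
  obtain ⟨w, hw, h2, hne⟩ := d_other (by omega : 2 ≤ d G Z r) z
  by_cases a1 : ∃ β ∈ Z, (β = z ∨ G.Adj z β) ∧ d G Q β = 0
  · exact main z hz w hw hne.symm h1 h2 a1
  by_cases a2 : ∃ β ∈ Z, (β = w ∨ G.Adj w β) ∧ d G Q β = 0
  · exact main w hw z hz hne h2 h1 a2
  exfalso
  have a1' : ∀ v ∈ Z, (v = z ∨ G.Adj z v) → d G Q v = 1 := fun v hv h => by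
    by_contra hcon
    exact a1 ⟨v, hv, h, by have := K.zQ v hv; omega⟩
  have a2' : ∀ v ∈ Z, (v = w ∨ G.Adj w v) → d G Q v = 1 := fun v hv h => by
    by_contra hcon
    exact a2 ⟨v, hv, h, by have := K.zQ v hv; omega⟩
  obtain ⟨_, t, ht, t1, t2⟩ := hit z hz h1 a1'
  obtain ⟨_, u, hu, u1, u2⟩ := hit w hw h2 a2'
  exact both z hz w hw hne.symm h1 h2 t ht u hu t1 t2 u1 u2

theorem d_three {S : Finset V} {v a b c : V} (ha : a ∈ S) (hb : b ∈ S) (hc : c ∈ S) (va : G.Adj v a) (vb : G.Adj v b)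
    (vc : G.Adj v c) (hab : a ≠ b) (hac : a ≠ c) (hbc : b ≠ c) : 3 ≤ d G S v := by
  have : ({a, b, c} : Finset V) ⊆ S.filter (G.Adj v) := by
    intro x hx
    simp only [Finset.mem_insert, Finset.mem_singleton] at hx
    rw [Finset.mem_filter]
    rcases hx with rfl | rfl | rfl
    · exact ⟨ha, va⟩
    · exact ⟨hb, vb⟩
    · exact ⟨hc, vc⟩
  have := Finset.card_le_card this
  rwa [Finset.card_eq_three.2 ⟨a, b, c, hab, hac, hbc, rfl⟩] at this

theorem KB.case2 (K : KB G Z P Q F p q) {r r' : V} (hr : r ∈ P) (hs : r' ∈ Q) (hrF : r ∈ F) (hsF : r' ∈ F)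
    (hP : ∀ v ∈ P, v ≠ r → v ∉ F) (hQ : ∀ v ∈ Q, v ≠ r' → v ∉ F) : False := by
  have hG := K.good
  obtain ⟨z, w, s, β, A⟩ := K.half hr hs hrF hsF hP hQ
  obtain ⟨t, s', w', α, B⟩ := K.swap.half hs hr hsF hrF hQ hP
  have hds := K.swap.r2 hs hsF
  have hst : s ≠ t := by rintro rfl; exact B.nh w A.wZ A.wt.symm A.rw.symm
  have hss : s = s' := by
    by_contra hne
    have := d_three A.tZ B.zZ B.wZ A.ts.symm B.rz B.rw hst hne B.zw
    omega
  subst hss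
  have zF := fun v hv => @K.zF v hv
  have nr : ∀ v ∈ Z, v ≠ r := fun v hv => K.nZP hv hr
  have nr' : ∀ v ∈ Z, v ≠ r' := fun v hv => K.swap.nZP hv hs
  have d2 : ∀ v ∈ Z, v ≠ α → v ≠ β → d G Z v = 2 := by
    intro v hv h1 h2
    have := A.un v hv h2; have := B.un v hv h1; have := K.zdeg v hv; omega
  obtain ⟨w1, hw1, ww1, nw1⟩ := d_other (K.d2 A.wZ) s
  obtain ⟨s1, hs1, ss1, ns1⟩ := d_other (K.d2 A.tZ) w
  have w1b : w1 ≠ β := by rintro rfl; have := A.st w1 hw1 (Or.inr ww1); have := A.b0; omega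
  have w1a : w1 ≠ α := by
    rintro rfl
    exact K.no5 hsF (zF _ B.zZ) (zF _ hw1) (zF _ A.wZ) (zF _ A.tZ) B.rz B.zb ww1.symm A.wt A.ts
  have s1a : s1 ≠ α := by rintro rfl; have := B.st s1 hs1 (Or.inr ss1); have := B.b0; omega
  have s1b : s1 ≠ β := by
    rintro rfl
    exact K.no5 hrF (zF _ A.zZ) (zF _ hs1) (zF _ A.tZ) (zF _ A.wZ) A.rz A.zb ss1.symm A.wt.symm A.rw.symm
  obtain ⟨w2, hw2, ww2, nw2⟩ := d_other (K.d2 hw1) w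
  obtain ⟨s2, hs2, ss2, ns2⟩ := d_other (K.d2 hs1) s
  have w2b : w2 ≠ β := by
    rintro rfl
    exact K.no5 hrF (zF _ A.wZ) (zF _ hw1) (zF _ hw2) (zF _ A.zZ) A.rw ww1 ww2 A.zb.symm A.rz.symm
  have s2a : s2 ≠ α := by
    rintro rfl
    exact K.no5 hsF (zF _ A.tZ) (zF _ hs1) (zF _ hs2) (zF _ B.zZ) A.ts.symm ss1 ss2 B.zb.symm B.rz.symm
  have w1t : w1 ≠ t := by
    rintro rfl
    exact hG.no4 w1 w s r' ww1.symm A.wt A.ts B.rz nw1 (nr' _ A.wZ)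
  have s1z : s1 ≠ z := by
    rintro rfl
    exact hG.no4 s1 s w r ss1.symm A.wt.symm A.rw.symm A.rz ns1 (nr _ A.tZ)
  have w2a : w2 ≠ α := by
    rintro rfl
    exact K.no6 hsF (zF _ A.tZ) (zF _ A.wZ) (zF _ hw1) (zF _ hw2) (zF _ B.zZ) A.ts.symm A.wt.symm ww1 ww2 B.zb.symm B.rz.symm
      (nr' _ A.wZ).symm nw1.symm nw2.symm w1t (nr' _ hw2) hst.symm
  have s2b : s2 ≠ β := by
    rintro rfl
    exact K.no6 hrF (zF _ A.wZ) (zF _ A.tZ) (zF _ hs1) (zF _ hs2) (zF _ A.zZ) A.rw A.wt ss1 ss2 A.zb.symm A.rz.symm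
      (nr _ A.tZ).symm ns1.symm ns2.symm s1z (nr _ hs2) A.zw
  have x1 : w1 ≠ s1 := by rintro rfl; exact hG.no3 w s w1 A.wt ss1 ww1.symm
  have x2 : w2 ≠ s := by rintro rfl; exact hG.no3 w w1 w2 ww1 ww2 A.wt.symm
  have x3 : s2 ≠ w := by rintro rfl; exact hG.no3 s s1 s2 ss1 ss2 A.wt
  have x4 : w2 ≠ s1 := by rintro rfl; exact hG.no4 w w1 w2 s ww1 ww2 ss1.symm A.wt.symm nw2.symm nw1
  have x5 : s2 ≠ w1 := by rintro rfl; exact hG.no4 w s2 s1 s ww1 ss2.symm ss1.symm A.wt.symm ns1.symm ns2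
  have x6 : w2 ≠ s2 := by
    rintro rfl
    exact K.no5 (zF _ A.wZ) (zF _ hw1) (zF _ hw2) (zF _ hs1) (zF _ A.tZ) ww1 ww2 ss2.symm ss1.symm A.wt.symm
  have hC := ((((((Cn.one (G := G) A.wZ).ins A.tZ (by simpa using A.wt.ne') (u := w) (by simp) A.wt.symm).ins hw1
    (by simp [nw1, ww1.ne']) (u := w) (by simp) ww1.symm).ins hs1
    (by simp [ns1, ss1.ne', x1.symm]) (u := s) (by simp) ss1.symm).ins hw2
    (by simp [nw2, ww2.ne', x2, x4]) (u := w1) (by simp) ww2.symm).ins hs2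
    (by simp [ns2, ss2.ne', x3, x5, x6.symm]) (u := s1) (by simp) ss2.symm)
  set T : Finset V := {s2, w2, s1, w1, s, w} with hT
  have dT : ∀ v ∈ T, d G Z v = 2 := by
    intro v hv
    rw [hT] at hv
    simp only [Finset.mem_insert, Finset.mem_singleton] at hv
    rcases hv with rfl | rfl | rfl | rfl | rfl | rfl
    · exact d2 _ hs2 s2a s2b
    · exact d2 _ hw2 w2a w2b
    · exact d2 _ hs1 s1a s1b
    · exact d2 _ hw1 w1a w1b
    · exact B.dw
    · exact A.dw
  have hE := E2_sdiff (G := G) hC.sub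
  rw [sum_const_eq dT, hC.card] at hE
  have hcd : (Z \ T).card = 6 := by rw [Finset.card_sdiff_of_subset hC.sub, hC.card, K.cZ]
  have h6 := K.six (Z \ T) (Finset.sdiff_subset.trans K.zF) hcd
  have hs := sum_const_eq K.zdeg
  rw [Finset.sum_add_distrib, Finset.sum_add_distrib, A.sm, B.sm, K.cZ] at hs
  have : E2 G Z = ∑ v ∈ Z, d G Z v := rfl
  have := hC.edge
  omega
end Gr

namespace Gr
variable {V : Type} [DecidableEq V] {G : SimpleGraph V} [DecidableRel G.Adj]

structure BS (G : SimpleGraph V) [DecidableRel G.Adj] (S F : Finset V) : Prop where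
  good : Good G
  c : S.card = 27
  e : E2 G S = 130
  ge : ∀ v ∈ S, 4 ≤ d G S v
  le : ∀ v ∈ S, d G S v ≤ 6
  mF : ∀ v, v ∈ F ↔ v ∈ S ∧ d G S v = 4
  ind : ∀ a ∈ F, ∀ b ∈ F, ¬ G.Adj a b
  two : ∀ v ∈ S, d G S v = 5 → d G F v ≤ 2

theorem BS_mk (hG : Good G) {S : Finset V} (hc : S.card = 27) (he : E2 G S = 130) :
    BS G S (S.filter fun v => d G S v = 4) := by
  obtain ⟨e, he', h1, h2⟩ := setup (b26 hG) hc (by omega)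
  have h3 : ∀ v ∈ S, 4 ≤ d G S v := fun u hu => by have := h2 u hu; omega
  have h6 : ∀ v ∈ S, d G S v ≤ 6 := fun u hu => by have := ball_le hG hu 4 h3; omega
  refine ⟨hG, hc, he, h3, h6, fun v => Finset.mem_filter, ?_, ?_⟩
  · intro a ha b hb hab
    rw [Finset.mem_filter] at ha hb
    have := del2 (b25 hG) ha.1 hb.1 hab hc
    omega
  · intro v hv h5
    by_contra hcon
    obtain ⟨N, hN, hN3, hNa⟩ := pickN (j := 3) (by omega : 3 ≤ d G (S.filter fun v => d G S v = 4) v)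
    have := del_star (b23 hG) hv (hN.trans (Finset.filter_subset _ _)) hNa (by omega)
    rw [sum_const_eq (k := 4) (fun u hu => (Finset.mem_filter.1 (hN hu)).2)] at this
    omega

variable {S F : Finset V}
theorem BS.sub (B : BS G S F) : F ⊆ S := fun v h => ((B.mF v).1 h).1
theorem BS.four (B : BS G S F) : ∀ u ∈ F, d G S u = 4 := fun v h => ((B.mF v).1 h).2
theorem BS.five (B : BS G S F) : ∀ u ∈ S, u ∉ F → 5 ≤ d G S u := fun v h hn => by
  have := B.ge v h
  have : d G S v ≠ 4 := fun e => hn ((B.mF v).2 ⟨h, e⟩)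
  omega

theorem BS.k4 (B : BS G S F) {x : V} (hx : x ∈ S) (h6 : d G S x = 6) : d G F x = 4 := by
  have hG := B.good
  have hc := B.c
  have he := B.e
  have hb := ball_le2 hG hx 4 B.sub B.ge B.five
  have hs := d_split (G := G) B.sub x
  have hxF : x ∉ F := fun h => by have := B.four x h; omega
  obtain ⟨H, hHS, hH⟩ := star_del hG hx hxF B.sub B.four B.five B.ind
  have c1 := hH.card
  have c2 := hH.edge
  by_contra hcon
  have : d G F x = 5 ∨ d G F x = 6 := by omega
  rcases this with h | h
  · set X := H.filter (fun w => 5 ≤ d G H w) with hX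
    have hXc : X.card ≤ 4 := by
      have e1 : E2 G H = ∑ v ∈ H \ X, d G H v + ∑ v ∈ X, d G H v :=
        (Finset.sum_sdiff (Finset.filter_subset _ _)).symm
      have e2 := le_sum_const (A := X) (f := d G H) (k := 5) fun v hv => (Finset.mem_filter.1 hv).2
      have e3 := le_sum_const (A := H \ X) (f := d G H) (k := 4) fun v hv => hH.four v (Finset.mem_sdiff.1 hv).1
      have e4 : (H \ X).card + X.card = H.card := Finset.card_sdiff_add_card_eq_card (Finset.filter_subset _ _)
      omega
    have h1 : (F.filter (G.Adj x)).card * 1 ≤ ∑ y ∈ F.filter (G.Adj x), d G X y := by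
      refine le_sum_const fun y hy => ?_
      rw [Finset.mem_filter] at hy
      by_contra hz
      have hz := d_zero' (by omega : d G X y = 0)
      refine core21 hG (H := H) (u := y) (by omega) (by omega) hH.four (fun h => ((hH.mem y).1 h).2.2 hy)
        (hH.out y hy.1 hy.2) fun v hv hyv => ?_
      by_contra h4
      have := hH.four v hv
      exact hz v (Finset.mem_filter.2 ⟨hv, by omega⟩) hyv
    have h2 : ∑ w ∈ X, d G (F.filter (G.Adj x)) w ≤ X.card * 1 := by
      refine sum_const_le fun w hw => common hG F ?_
      exact ((hH.mem w).1 (Finset.mem_filter.1 hw).1).2.1.symm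
    rw [dsum_comm] at h1
    have : (F.filter (G.Adj x)).card = d G F x := rfl
    omega
  · exact L20 hG (S := H) (by omega) (by omega) hH.four

theorem BS.no6 (B : BS G S F) {x : V} (hx : x ∈ S) (h6 : d G S x = 6) : False := by
  have hG := B.good
  have hc := B.c
  have he := B.e
  have hk := B.k4 hx h6
  have hs := d_split (G := G) B.sub x
  have hxF : x ∉ F := fun h => by have := B.four x h; omega
  obtain ⟨H, hHS, hH⟩ := star_del hG hx hxF B.sub B.four B.five B.ind
  have c1 := hH.card
  have c2 := hH.edge
  have hns := nbr_sum (G := G) (v := x) 4 B.sub B.ge B.five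
  have hball := ball hG hx
  have hfull := fun w => ball_full (w := w) hG hx (by omega)
  set N := F.filter (G.Adj x) with hN
  have mN : ∀ w, w ∈ N ↔ w ∈ F ∧ G.Adj x w := fun w => Finset.mem_filter
  have hNc : N.card = 4 := hk
  obtain ⟨p, q, hpq, hpq'⟩ := Finset.card_eq_two.1 (by unfold d at *; omega : ((S \ F).filter (G.Adj x)).card = 2)
  have mpq : ∀ w, (w ∈ S \ F ∧ G.Adj x w) ↔ w = p ∨ w = q := fun w => by
    rw [← Finset.mem_filter, hpq']; simp
  obtain ⟨hp, hxp⟩ := (mpq p).2 (Or.inl rfl)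
  obtain ⟨hq, hxq⟩ := (mpq q).2 (Or.inr rfl)
  rw [Finset.mem_sdiff] at hp hq
  have hsum : ∑ u ∈ S.filter (G.Adj x), d G S u = 16 + d G S p + d G S q := by
    have : S.filter (G.Adj x) = N ∪ (S \ F).filter (G.Adj x) := by
      rw [hN, ← Finset.filter_union, Finset.union_sdiff_of_subset B.sub]
    rw [this, Finset.sum_union (Finset.disjoint_filter_filter Finset.disjoint_sdiff), hpq', Finset.sum_pair hpq,
      sum_const_eq (k := 4) (fun u hu => B.four u ((mN u).1 hu).1), hNc]
    omega
  have hp5 : d G S p = 5 := by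
    have := B.five p hp.1 hp.2; have := B.five q hq.1 hq.2; omega
  have hq5 : d G S q = 5 := by
    have := B.five p hp.1 hp.2; have := B.five q hq.1 hq.2; omega
  have npq : ¬ G.Adj p q := fun h => hG.no3 x p q hxp h hxq.symm
  -- neighbours of x
  have uniq : ∀ w u u', w ≠ x → G.Adj x u → G.Adj x u' → G.Adj u w → G.Adj u' w → u = u' := by
    intro w u u' hw h1 h2 h3 h4
    by_contra hne
    exact hG.no4 x u w u' h1 h3 h4.symm h2.symm hw.symm hne
  set P := (S.filter (G.Adj p)).erase x with hP
  set Q := (S.filter (G.Adj q)).erase x with hQ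
  have mP : ∀ w, w ∈ P ↔ w ≠ x ∧ w ∈ S ∧ G.Adj p w := fun w => by rw [hP, Finset.mem_erase, Finset.mem_filter]
  have mQ : ∀ w, w ∈ Q ↔ w ≠ x ∧ w ∈ S ∧ G.Adj q w := fun w => by rw [hQ, Finset.mem_erase, Finset.mem_filter]
  have cP : P.card = 4 := by
    have : P.card + 1 = d G S p := Finset.card_erase_add_one (Finset.mem_filter.2 ⟨hx, hxp.symm⟩)
    omega
  have cQ : Q.card = 4 := by
    have : Q.card + 1 = d G S q := Finset.card_erase_add_one (Finset.mem_filter.2 ⟨hx, hxq.symm⟩)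
    omega
  have dP1 : ∀ w, w ≠ p → d G P w ≤ 1 := fun w hw =>
    (d_mono (Finset.erase_subset _ _) w).trans (common hG S hw.symm)
  have dQ1 : ∀ w, w ≠ q → d G Q w ≤ 1 := fun w hw =>
    (d_mono (Finset.erase_subset _ _) w).trans (common hG S hw.symm)
  have restPQ : ∀ w ∈ F, w ∉ N → w ∈ P ∪ Q := by
    intro w hw hwN
    have hwx : w ≠ x := by rintro rfl; exact hxF hw
    obtain ⟨u, hu, h1, h2⟩ := hfull w (B.sub hw) hwx fun h => hwN ((mN w).2 ⟨hw, h⟩)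
    by_cases huF : u ∈ F
    · exact (B.ind u huF w hw h2).elim
    · rw [Finset.mem_union, mP, mQ]
      rcases (mpq u).1 ⟨Finset.mem_sdiff.2 ⟨hu, huF⟩, h1⟩ with rfl | rfl
      · exact Or.inl ⟨hwx, B.sub hw, h2⟩
      · exact Or.inr ⟨hwx, B.sub hw, h2⟩
  have NF : N ⊆ F := Finset.filter_subset _ _
  have dPQ : Disjoint P Q := by
    rw [Finset.disjoint_left]
    intro w h1 h2
    rw [mP] at h1; rw [mQ] at h2
    exact hpq (uniq w p q h1.1 hxp hxq h1.2.2 h2.2.2)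
  have only : ∀ x' ∈ S, d G S x' = 6 → x' = x := by
    intro x' hx' h6'
    by_contra hne
    have h1 := B.k4 hx' h6'
    have h2 := d_split (G := G) NF x'
    have h3 : d G N x' ≤ 1 := common hG F (Ne.symm hne)
    have h4 : d G (F \ N) x' ≤ d G (P ∪ Q) x' := d_mono (fun w hw => by
      rw [Finset.mem_sdiff] at hw; exact restPQ w hw.1 hw.2) x'
    rw [d_union dPQ] at h4
    have := dP1 x' (by rintro rfl; omega)
    have := dQ1 x' (by rintro rfl; omega)
    omega
  have h5 : ∀ w ∈ S, w ≠ x → w ∉ F → d G S w = 5 := by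
    intro w hw hwx hwF
    have := B.five w hw hwF
    have := B.le w hw
    by_contra hn
    exact hwx (only w hw (by omega))
  have hF6 : F.card = 6 := by
    obtain ⟨t1, t2⟩ := three_deg (G := G) (S := S) 4 fun v hv => ⟨B.ge v hv, B.le v hv⟩
    have e1 : S.filter (fun v => d G S v = 4) = F := by ext v; rw [Finset.mem_filter, B.mF]
    have e2 : S.filter (fun v => d G S v = 4 + 2) = {x} := by
      ext v; rw [Finset.mem_filter, Finset.mem_singleton]
      exact ⟨fun h => only v h.1 h.2, by rintro rfl; exact ⟨hx, h6⟩⟩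
    rw [e1, e2, Finset.card_singleton] at t1
    rw [e2, Finset.card_singleton] at t2
    omega
  have PH : ∀ w ∈ P, w ∈ H ∧ d G H w = d G S w := by
    intro w hw
    rw [mP] at hw
    have nx : ¬ G.Adj x w := fun h => hG.no3 x p w hxp hw.2.2 h.symm
    have hwH : w ∈ H := (hH.mem w).2 ⟨hw.2.1, hw.1, fun h => nx h.2⟩
    refine ⟨hwH, hH.same w hwH nx fun u hu hxu huw => ?_⟩
    have := uniq w u p hw.1 hxu hxp huw hw.2.2
    exact hp.2 (this ▸ hu)
  have QH : ∀ w ∈ Q, w ∈ H ∧ d G H w = d G S w := by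
    intro w hw
    rw [mQ] at hw
    have nx : ¬ G.Adj x w := fun h => hG.no3 x q w hxq hw.2.2 h.symm
    have hwH : w ∈ H := (hH.mem w).2 ⟨hw.2.1, hw.1, fun h => nx h.2⟩
    refine ⟨hwH, hH.same w hwH nx fun u hu hxu huw => ?_⟩
    have := uniq w u q hw.1 hxu hxq huw hw.2.2
    exact hq.2 (this ▸ hu)
  have pH : p ∈ H := (hH.mem p).2 ⟨hp.1, hxp.ne', fun h => hp.2 h.1⟩
  have qH : q ∈ H := (hH.mem q).2 ⟨hq.1, hxq.ne', fun h => hq.2 h.1⟩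
  have pP : p ∉ P := fun h => ((mP p).1 h).2.2.ne rfl
  have qQ : q ∉ Q := fun h => ((mQ q).1 h).2.2.ne rfl
  have pQ : p ∉ Q := fun h => npq ((mQ p).1 h).2.2.symm
  have qP : q ∉ P := fun h => npq ((mP q).1 h).2.2
  have qI : q ∉ P ∪ Q := by rw [Finset.mem_union]; tauto
  have pI : p ∉ insert q (P ∪ Q) := by rw [Finset.mem_insert, Finset.mem_union]; tauto
  set R := insert p (insert q (P ∪ Q)) with hR
  have mR : ∀ w, w ∈ R ↔ w = p ∨ w = q ∨ w ∈ P ∨ w ∈ Q := fun w => by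
    rw [hR, Finset.mem_insert, Finset.mem_insert, Finset.mem_union]
  have RH : R ⊆ H := by
    intro w hw
    rw [mR] at hw
    rcases hw with rfl | rfl | h | h
    · exact pH
    · exact qH
    · exact (PH w h).1
    · exact (QH w h).1
  have cR : R.card = 10 := by
    rw [hR, Finset.card_insert_of_notMem pI, Finset.card_insert_of_notMem qI, Finset.card_union_of_disjoint dPQ]
    omega
  set Z := H \ R with hZ
  have cZ : Z.card = 12 := by
    have : Z.card + R.card = H.card := Finset.card_sdiff_add_card_eq_card RH
    omega
  have mZ : ∀ z, z ∈ Z → z ∈ H ∧ z ∉ R := fun z => Finset.mem_sdiff.1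
  have zy : ∀ z ∈ Z, ∃ y ∈ F, G.Adj x y ∧ G.Adj y z := by
    intro z hz
    obtain ⟨zH, zR⟩ := mZ z hz
    rw [mR] at zR
    have hm := (hH.mem z).1 zH
    have hxz : ¬ G.Adj x z := fun h => by
      by_cases hzF : z ∈ F
      · exact hm.2.2 ⟨hzF, h⟩
      · have := (mpq z).1 ⟨Finset.mem_sdiff.2 ⟨hm.1, hzF⟩, h⟩; tauto
    obtain ⟨u, hu, h1, h2⟩ := hfull z hm.1 hm.2.1 hxz
    by_cases huF : u ∈ F
    · exact ⟨u, huF, h1, h2⟩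
    · exfalso
      rcases (mpq u).1 ⟨Finset.mem_sdiff.2 ⟨hu, huF⟩, h1⟩ with rfl | rfl
      · exact zR (Or.inr (Or.inr (Or.inl ((mP z).2 ⟨hm.2.1, hm.1, h2⟩))))
      · exact zR (Or.inr (Or.inr (Or.inr ((mQ z).2 ⟨hm.2.1, hm.1, h2⟩))))
  have zF : ∀ z ∈ Z, z ∉ F := by
    intro z hz hzF
    obtain ⟨y, hy, h1, h2⟩ := zy z hz
    exact B.ind y hy z hzF h2
  have z5 : ∀ z ∈ Z, d G S z = 5 := fun z hz =>
    have hm := (hH.mem z).1 (mZ z hz).1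
    h5 z hm.1 hm.2.1 (zF z hz)
  have z4 : ∀ z ∈ Z, d G H z = 4 := by
    intro z hz
    obtain ⟨y, hy, h1, h2⟩ := zy z hz
    have := hH.out2 y hy h1 z (mZ z hz).1 h2
    have := z5 z hz
    omega
  have dH : ∀ w, d G H w = d G P w + d G Q w + (if G.Adj w q then 1 else 0) + (if G.Adj w p then 1 else 0) + d G Z w := by
    intro w
    rw [d_split RH w, hR, d_insert pI, d_insert qI, d_union dPQ]
  have PF : ∀ w ∈ P ∪ Q, w ∈ H.filter (fun v => d G H v = 4) ↔ w ∈ F := by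
    intro w hw
    rw [Finset.mem_filter, B.mF]
    rcases Finset.mem_union.1 hw with h | h
    · have := PH w h; rw [this.2]; exact ⟨fun h => ⟨hHS h.1, h.2⟩, fun h => ⟨this.1, h.2⟩⟩
    · have := QH w h; rw [this.2]; exact ⟨fun h => ⟨hHS h.1, h.2⟩, fun h => ⟨this.1, h.2⟩⟩
  have Pd : ∀ w ∈ P, d G Q w + d G Z w + 1 = d G S w := by
    intro w hw
    have h1 := dH w
    rw [(PH w hw).2] at h1
    have hw' := (mP w).1 hw
    rw [if_pos hw'.2.2.symm, if_neg (fun h => Finset.disjoint_left.1 dPQ hw ((mQ w).2 ⟨hw'.1, hw'.2.1, h.symm⟩)),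
      d_zero (S := P) (fun u hu h => hG.no3 p w u hw'.2.2 h ((mP u).1 hu).2.2.symm)] at h1
    omega
  have Qd : ∀ w ∈ Q, d G P w + d G Z w + 1 = d G S w := by
    intro w hw
    have h1 := dH w
    rw [(QH w hw).2] at h1
    have hw' := (mQ w).1 hw
    rw [if_pos hw'.2.2.symm, if_neg (fun h => Finset.disjoint_right.1 dPQ hw ((mP w).2 ⟨hw'.1, hw'.2.1, h.symm⟩)),
      d_zero (S := Q) (fun u hu h => hG.no3 q w u hw'.2.2 h ((mQ u).1 hu).2.2.symm)] at h1
    omega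
  have Zd : ∀ z ∈ Z, d G P z + d G Q z + d G Z z = 4 := by
    intro z hz
    have h1 := dH z
    have hm := mZ z hz
    have hs := (hH.mem z).1 hm.1
    rw [mR] at hm
    rw [z4 z hz, if_neg (fun h => hm.2 (Or.inr (Or.inr (Or.inr ((mQ z).2 ⟨hs.2.1, hs.1, h.symm⟩))))),
      if_neg (fun h => hm.2 (Or.inr (Or.inr (Or.inl ((mP z).2 ⟨hs.2.1, hs.1, h.symm⟩)))))] at h1
    omega
  have ZR : Disjoint Z R := Finset.sdiff_disjoint
  have K : KB G Z P Q (H.filter (fun v => d G H v = 4)) p q := by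
    refine ⟨hG, cZ, cP, cQ, ?_, ?_, dPQ, ?_, ?_, ?_, ?_, ?_, ?_, ?_, ?_, ?_, Zd, ?_, ?_, ?_, ?_, ?_, ?_, ?_, ?_, ?_, ?_⟩
    · exact ZR.mono_right fun w hw => (mR w).2 (by tauto)
    · exact ZR.mono_right fun w hw => (mR w).2 (by tauto)
    · exact fun z hz => Finset.mem_filter.2 ⟨(mZ z hz).1, z4 z hz⟩
    · have := hH.dropv p pH hxp
      exact Finset.mem_filter.2 ⟨pH, by omega⟩
    · have := hH.dropv q qH hxq
      exact Finset.mem_filter.2 ⟨qH, by omega⟩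
    · exact fun h => (mZ p h).2 ((mR p).2 (by tauto))
    · exact fun h => (mZ q h).2 ((mR q).2 (by tauto))
    · exact fun v hv => ((mP v).1 hv).2.2
    · exact fun v hv => ((mQ v).1 hv).2.2
    · intro T hT hTc
      have := delT (b17 hG) (hT.trans (Finset.filter_subset _ _)) (by omega)
      rw [sum_const_eq (k := 4) (fun v hv => (Finset.mem_filter.1 (hT hv)).2)] at this
      omega
    · intro T hT hTc
      have := delT (b16 hG) (hT.trans (Finset.filter_subset _ _)) (by omega)
      rw [sum_const_eq (k := 4) (fun v hv => (Finset.mem_filter.1 (hT hv)).2)] at this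
      omega
    · exact fun z hz => dP1 z (by rintro rfl; exact (mZ z hz).2 ((mR z).2 (by tauto)))
    · exact fun z hz => dQ1 z (by rintro rfl; exact (mZ z hz).2 ((mR z).2 (by tauto)))
    · exact fun v hv => dQ1 v (by rintro rfl; exact qP hv)
    · exact fun v hv => dP1 v (by rintro rfl; exact pQ hv)
    · intro v hv hvF
      have := B.four v ((PF v (Finset.mem_union_left _ hv)).1 hvF)
      have := Pd v hv
      omega
    · intro v hv hvF
      have := B.four v ((PF v (Finset.mem_union_right _ hv)).1 hvF)
      have := Qd v hv
      omega
    · intro v hv hvF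
      rw [PF v (Finset.mem_union_left _ hv)] at hvF
      have := h5 v ((mP v).1 hv).2.1 ((mP v).1 hv).1 hvF
      have := Pd v hv
      omega
    · intro v hv hvF
      rw [PF v (Finset.mem_union_right _ hv)] at hvF
      have := h5 v ((mQ v).1 hv).2.1 ((mQ v).1 hv).1 hvF
      have := Qd v hv
      omega
    · intro z hz a ha b hb haF hbF hab hza hzb
      rw [PF a ha] at haF
      rw [PF b hb] at hbF
      obtain ⟨y, hy, h1, h2⟩ := zy z hz
      have hne : ∀ a ∈ P ∪ Q, y ≠ a := by
        rintro a ha rfl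
        have : y ∈ H := by
          rcases Finset.mem_union.1 ha with h | h
          · exact (PH y h).1
          · exact (QH y h).1
        exact ((hH.mem y).1 this).2.2 ⟨hy, h1⟩
      have := d_three (G := G) (v := z) hy haF hbF h2.symm hza hzb (hne a ha) (hne b hb) hab
      have := B.two z (hHS (mZ z hz).1) (z5 z hz)
      omega
    · intro a ha b hb haF hbF
      rw [PF a ha] at haF
      rw [PF b hb] at hbF
      exact B.ind a haF b hbF
  have hr : (F \ N).card = 2 := by
    have := Finset.card_sdiff_add_card_eq_card NF
    omega
  obtain ⟨r, s, hrs, hrs'⟩ := Finset.card_eq_two.1 hr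
  have mrs : ∀ w, (w ∈ F ∧ w ∉ N) ↔ w = r ∨ w = s := fun w => by
    rw [← Finset.mem_sdiff, hrs']; simp
  have hr1 := (mrs r).2 (Or.inl rfl)
  have hs1 := (mrs s).2 (Or.inr rfl)
  have hr2 := restPQ r hr1.1 hr1.2
  have hs2 := restPQ s hs1.1 hs1.2
  have hr3 := (PF r hr2).2 hr1.1
  have hs3 := (PF s hs2).2 hs1.1
  have oth : ∀ w ∈ P ∪ Q, w ∈ H.filter (fun v => d G H v = 4) → w = r ∨ w = s := by
    intro w hw hwF
    rw [PF w hw] at hwF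
    refine (mrs w).1 ⟨hwF, fun hN => ?_⟩
    have hwH : w ∈ H := by
      rcases Finset.mem_union.1 hw with h | h
      · exact (PH w h).1
      · exact (QH w h).1
    exact ((hH.mem w).1 hwH).2.2 ((mN w).1 hN)
  have othP : ∀ w ∈ P, w ∈ H.filter (fun v => d G H v = 4) → w = r ∨ w = s :=
    fun w hw => oth w (Finset.mem_union_left _ hw)
  have othQ : ∀ w ∈ Q, w ∈ H.filter (fun v => d G H v = 4) → w = r ∨ w = s :=
    fun w hw => oth w (Finset.mem_union_right _ hw)
  have dj : ∀ w, w ∈ P → w ∉ Q := fun w h => Finset.disjoint_left.1 dPQ h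
  rcases Finset.mem_union.1 hr2 with hr2 | hr2 <;> rcases Finset.mem_union.1 hs2 with hs2 | hs2
  · refine K.case1 hr2 hs2 hrs hr3 hs3 fun v hv hvF => ?_
    rcases othQ v hv hvF with rfl | rfl
    · exact dj _ hr2 hv
    · exact dj _ hs2 hv
  · refine K.case2 hr2 hs2 hr3 hs3 (fun v hv hne hvF => ?_) fun v hv hne hvF => ?_
    · rcases othP v hv hvF with rfl | rfl
      · exact hne rfl
      · exact dj _ hv hs2
    · rcases othQ v hv hvF with rfl | rfl
      · exact dj _ hr2 hv
      · exact hne rfl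
  · refine K.case2 hs2 hr2 hs3 hr3 (fun v hv hne hvF => ?_) fun v hv hne hvF => ?_
    · rcases othP v hv hvF with rfl | rfl
      · exact dj _ hv hr2
      · exact hne rfl
    · rcases othQ v hv hvF with rfl | rfl
      · exact hne rfl
      · exact dj _ hs2 hv
  · refine K.swap.case1 hr2 hs2 hrs hr3 hs3 fun v hv hvF => ?_
    rcases othP v hv hvF with rfl | rfl
    · exact dj _ hv hr2
    · exact dj _ hv hs2

theorem final (hG : Good G) {S : Finset V} (hc : S.card = 27) (he : E2 G S = 130) :
    (∀ v ∈ S, 4 ≤ d G S v ∧ d G S v ≤ 5) ∧ (∃ v ∈ S, d G S v = 4) ∧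
      ∃ v ∈ S, d G S v = 5 ∧ ∀ u ∈ S, G.Adj v u → 5 ≤ d G S u := by
  have B := BS_mk hG hc he
  have h45 : ∀ v ∈ S, 4 ≤ d G S v ∧ d G S v ≤ 5 := by
    intro v hv
    refine ⟨B.ge v hv, ?_⟩
    have := B.le v hv
    by_contra hcon
    exact B.no6 hv (by omega)
  obtain ⟨F, hF, c1, c2, mF⟩ := FF_mk h45
  refine ⟨h45, ?_, ?_⟩
  · obtain ⟨v, hv⟩ := Finset.card_pos.1 (by omega : 0 < F.card)
    exact ⟨v, (mF v).1 hv⟩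
  · by_contra hcon
    push Not at hcon
    have h1 : (S \ F).card * 1 ≤ ∑ v ∈ S \ F, d G F v := by
      refine le_sum_const fun v hv => ?_
      obtain ⟨u, hu, hvu, hu5⟩ := hcon v (Finset.mem_sdiff.1 hv).1 (hF.five v hv)
      have := (h45 u hu).1
      exact d_pos ((mF u).2 ⟨hu, by omega⟩) hvu
    rw [dsum_comm] at h1
    have h2 : ∑ v ∈ F, d G (S \ F) v ≤ F.card * 4 := sum_const_le fun v hv => by
      have := d_split (G := G) hF.sub v
      have := hF.four v hv
      omega
    omega
end Gr

theorem girth_good {V : Type} {G : SimpleGraph V} (hg : GirthAtLeast5 G) : Gr.Good G := by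
  classical
  constructor
  · intro a b c h1 h2 h3
    have := hg (SimpleGraph.Walk.cons h1 (SimpleGraph.Walk.cons h2 (SimpleGraph.Walk.cons h3 SimpleGraph.Walk.nil)))
      (by
        rw [SimpleGraph.Walk.cons_isCycle_iff]
        have := h1.ne; have := h2.ne; have := h3.ne
        refine ⟨?_, ?_⟩
        · simp; grind
        · simp; grind)
    simp at this
  · intro a b c e h1 h2 h3 h4 n1 n2
    have := hg (SimpleGraph.Walk.cons h1 (SimpleGraph.Walk.cons h2 (SimpleGraph.Walk.cons h3
      (SimpleGraph.Walk.cons h4 SimpleGraph.Walk.nil))))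
      (by
        rw [SimpleGraph.Walk.cons_isCycle_iff]
        have := h1.ne; have := h2.ne; have := h3.ne; have := h4.ne
        refine ⟨?_, ?_⟩
        · simp; grind
        · simp; grind)
    simp at this

theorem stmt14 (G : SimpleGraph (Fin 27)) [DecidableRel G.Adj]
    (hg : GirthAtLeast5 G) (he : G.edgeFinset.card = 65) :
    (G.minDegree, G.maxDegree) = (4, 5) ∧ HasEmbeddedStar G 5 ![4, 4, 4, 4, 4] := by
  have hG := girth_good hg
  have hd : ∀ v, Gr.d G Finset.univ v = G.degree v := fun v => by
    rw [← SimpleGraph.card_neighborFinset_eq_degree, SimpleGraph.neighborFinset_eq_filter]; rfl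
  have h2 : Gr.E2 G Finset.univ = 130 := by
    unfold Gr.E2
    rw [Finset.sum_congr rfl fun v _ => hd v, SimpleGraph.sum_degrees_eq_twice_card_edges, he]
  obtain ⟨h45, ⟨v, -, hv⟩, x, -, hx5, hxn⟩ := Gr.final hG (by simp) h2
  simp only [Finset.mem_univ, true_implies, hd] at h45 hv hx5 hxn
  refine ⟨?_, ?_⟩
  · have a1 : G.minDegree ≤ 4 := hv ▸ G.minDegree_le_degree v
    have a2 : 4 ≤ G.minDegree := G.le_minDegree_of_forall_le_degree 4 fun v => (h45 v).1
    have a3 : 5 ≤ G.maxDegree := hx5 ▸ G.degree_le_maxDegree x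
    have a4 : G.maxDegree ≤ 5 := G.maxDegree_le_of_forall_degree_le 5 fun v => (h45 v).2
    rw [Prod.mk.injEq]; omega
  · have hc : (G.neighborFinset x).card = 5 := by rw [SimpleGraph.card_neighborFinset_eq_degree, hx5]
    let f := (Finset.equivFinOfCardEq hc).symm
    have hf : ∀ i, G.Adj x (f i) := fun i => (G.mem_neighborFinset x _).1 (f i).2
    refine ⟨x, fun i => (f i : Fin 27), hx5, fun i j h => f.injective (Subtype.ext h), hf, fun i => ?_⟩
    have := hxn _ (hf i)
    fin_cases i <;> exact this
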